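/- Let F ∈ ℂ[x,y,s,t] be an irreducible polynomial of total degree δ such that none of the partial derivatives F_x, F_y, F_s, F_t is identically zero. Then at least one of the following holds: (i) there exists a constant c, depending only on δ, such that for all finite sets A, B, C, D ⊂ ℂ one has |Z(F) ∩ (A×B×C×D)| ≤ c·(|A|^{2/3}|B|^{2/3}|C|^{2/3}|D|^{2/3} + |A||B| + |A||C| + |A||D| + |B||C| + |B||D| + |C||D|); or (ii) F has the special sum form. -/

import Mathlib

open MvPolynomial

noncomputable section

attribute [local instance] Classical.propDecidable

/-- The common zero set in `ℂⁿ` of a family of polynomials. -/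
def zeroSetOf {n : ℕ} (I : Set (MvPolynomial (Fin n) ℂ)) : Set (Fin n → ℂ) :=
  {p | ∀ f ∈ I, eval p f = 0}

/-- An algebraic subset of `ℂⁿ`. -/
def IsAlgSet {n : ℕ} (S : Set (Fin n → ℂ)) : Prop :=
  ∃ I : Set (MvPolynomial (Fin n) ℂ), S = zeroSetOf I

/-- An irreducible algebraic subset of `ℂⁿ`: a nonempty algebraic set that is not the
union of two proper algebraic subsets. -/
def IsIrredAlgSet {n : ℕ} (S : Set (Fin n → ℂ)) : Prop :=
  IsAlgSet S ∧ S.Nonempty ∧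
    ∀ S₁ S₂ : Set (Fin n → ℂ), IsAlgSet S₁ → IsAlgSet S₂ → S = S₁ ∪ S₂ → S = S₁ ∨ S = S₂

/-- `S` has (Krull) dimension at most `d`: there is no strictly increasing chain of
`d+2` irreducible algebraic subsets contained in `S`. -/
def algDimLE {n : ℕ} (S : Set (Fin n → ℂ)) (d : ℕ) : Prop :=
  ∀ Z : Fin (d + 2) → Set (Fin n → ℂ),
    (∀ i, IsIrredAlgSet (Z i) ∧ Z i ⊆ S) → ¬ StrictMono Z

/-- `F` has the special sum form: off a subvariety `Z₀ ⊆ Z(F)` of dimension at most 2,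
locally `F(x,y,s,t) = 0` is equivalent to `φ₁(x)+φ₂(y)+φ₃(s)+φ₄(t) = 0` for
injective analytic functions `φᵢ` with analytic inverses. -/
def SpecialSumForm (F : MvPolynomial (Fin 4) ℂ) : Prop :=
  ∃ Z₀ : Set (Fin 4 → ℂ), IsAlgSet Z₀ ∧ Z₀ ⊆ {v | eval v F = 0} ∧ algDimLE Z₀ 2 ∧
    ∀ v : Fin 4 → ℂ, eval v F = 0 → v ∉ Z₀ →
      ∃ (D : Fin 4 → Set ℂ) (φ ψ : Fin 4 → ℂ → ℂ),
        (∀ i, IsOpen (D i) ∧ v i ∈ D i ∧ Set.InjOn (φ i) (D i) ∧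
          ∀ z ∈ D i, AnalyticAt ℂ (φ i) z ∧ AnalyticAt ℂ (ψ i) (φ i z) ∧ ψ i (φ i z) = z) ∧
        ∀ x y s t : ℂ, x ∈ D 0 → y ∈ D 1 → s ∈ D 2 → t ∈ D 3 →
          (eval ![x, y, s, t] F = 0 ↔ φ 0 x + φ 1 y + φ 2 s + φ 3 t = 0)

/-- The elementary symmetric polynomial of degree `n - 1` in the entries of `a`. -/
def codimOne : (n : ℕ) → (Fin n → ℕ) → ℕ
  | 0, _ => 0
  | n + 1, a => a 0 * codimOne n (Fin.tail a) + ∏ i, Fin.tail a i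

/-- The elementary symmetric polynomial of degree `n - 2` in the entries of `a`. -/
def codimTwo : (n : ℕ) → (Fin n → ℕ) → ℕ
  | 0, _ => 0
  | n + 1, a => a 0 * codimTwo n (Fin.tail a) + codimOne n (Fin.tail a)

lemma card_filter_piFinset_succ_le {n : ℕ} (A : Fin (n + 1) → Finset ℂ)
    (p : (Fin (n + 1) → ℂ) → Prop) [DecidablePred p] (T : Finset (Fin n → ℂ)) (k : ℕ)
    (h1 : ∀ x ∈ Fintype.piFinset A, p x → Fin.tail x ∈ T)
    (h2 : ∀ x' ∈ T, ((A 0).filter fun x0 => p (Fin.cons x0 x')).card ≤ k) :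
    ((Fintype.piFinset A).filter p).card ≤ k * T.card := by
  apply Finset.card_le_mul_card_image_of_maps_to (f := Fin.tail)
  · intro x hx
    rw [Finset.mem_filter] at hx
    exact h1 x hx.1 hx.2
  · intro x' hx'
    refine le_trans ?_ (h2 x' hx')
    apply Finset.card_le_card_of_injOn (fun x => x 0)
    · intro x hx
      simp only [Finset.coe_filter, Finset.mem_filter, Fintype.mem_piFinset, Set.mem_ofPred_eq] at hx ⊢
      refine ⟨hx.1.1 0, ?_⟩
      rw [← hx.2, Fin.cons_self_tail]
      exact hx.1.2
    · intro x hx y hy hxy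
      simp only [Finset.coe_filter, Finset.mem_filter, Set.mem_ofPred_eq] at hx hy
      rw [← Fin.cons_self_tail x, ← Fin.cons_self_tail y, hx.2, hy.2]
      simp only at hxy
      rw [hxy]

lemma eval_finSuccEquiv {n : ℕ} (f : MvPolynomial (Fin (n + 1)) ℂ) (x0 : ℂ) (x' : Fin n → ℂ) :
    eval (Fin.cons x0 x' : Fin (n + 1) → ℂ) f
      = Polynomial.eval x0 (Polynomial.map (eval x') (finSuccEquiv ℂ n f)) :=
  eval_eq_eval_mv_eval' x' x0 f

lemma card_roots_fibre_le {n : ℕ} (f : MvPolynomial (Fin (n + 1)) ℂ) {δ : ℕ}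
    (hf : f.totalDegree ≤ δ) (x' : Fin n → ℂ) (i : ℕ)
    (hi : eval x' ((finSuccEquiv ℂ n f).coeff i) ≠ 0) (S : Finset ℂ) :
    (S.filter fun x0 => eval (Fin.cons x0 x' : Fin (n + 1) → ℂ) f = 0).card ≤ δ := by
  set q := Polynomial.map (eval x') (finSuccEquiv ℂ n f) with hq
  have hq0 : q ≠ 0 := by
    intro h
    apply hi
    rw [← Polynomial.coeff_map, ← hq, h, Polynomial.coeff_zero]
  have hsub : (S.filter fun x0 => eval (Fin.cons x0 x' : Fin (n + 1) → ℂ) f = 0)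
      ⊆ q.roots.toFinset := by
    intro x hx
    rw [Finset.mem_filter, eval_finSuccEquiv] at hx
    simp only [Multiset.mem_toFinset]
    exact (Polynomial.mem_roots hq0).2 hx.2
  calc _ ≤ q.roots.toFinset.card := Finset.card_le_card hsub
    _ ≤ q.roots.card := Multiset.toFinset_card_le _
    _ ≤ q.natDegree := Polynomial.card_roots' q
    _ ≤ (finSuccEquiv ℂ n f).natDegree := Polynomial.natDegree_map_le
    _ = f.degreeOf 0 := natDegree_finSuccEquiv f
    _ ≤ f.totalDegree := degreeOf_le_totalDegree f 0
    _ ≤ δ := hf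

lemma totalDegree_coeff_finSuccEquiv_le {n : ℕ} (f : MvPolynomial (Fin (n + 1)) ℂ) (i : ℕ) :
    ((finSuccEquiv ℂ n f).coeff i).totalDegree ≤ f.totalDegree := by
  by_cases h : (finSuccEquiv ℂ n f).coeff i = 0
  · rw [h]; simp
  · have := totalDegree_coeff_finSuccEquiv_add_le f i h
    omega

lemma card_zeros_le {n : ℕ} (f : MvPolynomial (Fin n) ℂ) (hf : f ≠ 0) {δ : ℕ}
    (hδ : f.totalDegree ≤ δ) (A : Fin n → Finset ℂ) :
    ((Fintype.piFinset A).filter fun x => eval x f = 0).card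
      ≤ δ * codimOne n (fun i => (A i).card) := by
  induction n with
  | zero =>
    rw [Finset.card_eq_zero.2]
    · exact Nat.zero_le _
    · rw [Finset.filter_eq_empty_iff]
      intro x _ hx
      apply hf
      rw [f.eq_C_of_isEmpty] at hx ⊢
      simp only [eval_C] at hx
      rw [hx, C_0]
  | succ n ih =>
    set P := finSuccEquiv ℂ n f with hP
    have hP0 : P ≠ 0 := by
      rw [hP]; simpa using hf
    set ℓ := P.leadingCoeff with hℓ
    have hℓ0 : ℓ ≠ 0 := Polynomial.leadingCoeff_ne_zero.2 hP0
    have hℓδ : ℓ.totalDegree ≤ δ := (totalDegree_coeff_finSuccEquiv_le f _).trans hδ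
    set a := fun i => (A i).card with ha
    have hsplit : ((Fintype.piFinset A).filter fun x => eval x f = 0) ⊆
        ((Fintype.piFinset A).filter fun x => eval (Fin.tail x) ℓ = 0) ∪
        ((Fintype.piFinset A).filter fun x => eval x f = 0 ∧ eval (Fin.tail x) ℓ ≠ 0) := by
      intro x hx
      simp only [Finset.mem_union, Finset.mem_filter] at hx ⊢
      tauto
    have h1 : ((Fintype.piFinset A).filter fun x => eval (Fin.tail x) ℓ = 0).card
        ≤ a 0 * (δ * codimOne n (Fin.tail a)) := by
      refine (card_filter_piFinset_succ_le A _
        ((Fintype.piFinset (Fin.tail A)).filter fun x => eval x ℓ = 0) (a 0) ?_ ?_).trans ?_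
      · intro x hx h
        rw [Finset.mem_filter, Fintype.mem_piFinset]
        rw [Fintype.mem_piFinset] at hx
        exact ⟨fun i => hx i.succ, h⟩
      · intro x' _
        exact Finset.card_filter_le _ _
      · exact Nat.mul_le_mul_left _ (ih ℓ hℓ0 hℓδ _)
    have h2 : ((Fintype.piFinset A).filter
        fun x => eval x f = 0 ∧ eval (Fin.tail x) ℓ ≠ 0).card
        ≤ δ * ∏ i, Fin.tail a i := by
      refine (card_filter_piFinset_succ_le A _
        ((Fintype.piFinset (Fin.tail A)).filter fun x => eval x ℓ ≠ 0) δ ?_ ?_).trans ?_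
      · intro x hx h
        rw [Finset.mem_filter, Fintype.mem_piFinset]
        rw [Fintype.mem_piFinset] at hx
        exact ⟨fun i => hx i.succ, h.2⟩
      · intro x' hx'
        rw [Finset.mem_filter] at hx'
        refine le_trans (Finset.card_le_card ?_)
          (card_roots_fibre_le f hδ x' _ hx'.2 (A 0))
        intro x hx
        rw [Finset.mem_filter] at hx ⊢
        exact ⟨hx.1, hx.2.1⟩
      · refine Nat.mul_le_mul_left _ ((Finset.card_filter_le _ _).trans ?_)
        rw [Fintype.card_piFinset]
        rfl
    calc _ ≤ _ := Finset.card_le_card hsplit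
      _ ≤ _ := Finset.card_union_le _ _
      _ ≤ a 0 * (δ * codimOne n (Fin.tail a)) + δ * ∏ i, Fin.tail a i := add_le_add h1 h2
      _ = δ * (a 0 * codimOne n (Fin.tail a) + ∏ i, Fin.tail a i) := by ring
      _ = _ := rfl

lemma one_le_totalDegree_of_irreducible {σ : Type*} {p : MvPolynomial σ ℂ}
    (hp : Irreducible p) : 1 ≤ p.totalDegree := by
  by_contra h
  have h0 : p.totalDegree = 0 := by omega
  rw [totalDegree_eq_zero_iff_eq_C] at h0
  rw [h0] at hp
  have hc : coeff 0 p ≠ 0 := by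
    intro hc
    rw [hc, C_0] at hp
    exact hp.ne_zero rfl
  exact hp.not_isUnit ((isUnit_iff_ne_zero.2 hc).map C)

lemma card_filter_eval_le_of_irreducible {n : ℕ} (T : Finset (Fin n → ℂ)) (δ K : ℕ)
    (h : ∀ π : MvPolynomial (Fin n) ℂ, Irreducible π → π.totalDegree ≤ δ →
      (T.filter fun x => eval x π = 0).card ≤ K)
    (ℓ : MvPolynomial (Fin n) ℂ) (hℓ : ℓ ≠ 0) (hδ : ℓ.totalDegree ≤ δ) :
    (T.filter fun x => eval x ℓ = 0).card ≤ ℓ.totalDegree * K := by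
  induction ℓ using WfDvdMonoid.induction_on_irreducible with
  | zero => exact absurd rfl hℓ
  | unit u hu =>
    rw [Finset.card_eq_zero.2]
    · exact Nat.zero_le _
    · rw [Finset.filter_eq_empty_iff]
      intro x _ hx
      have := hu.map (eval x)
      rw [hx] at this
      exact not_isUnit_zero this
  | mul ℓ π hℓ0 hπ ih =>
    have hd : (π * ℓ).totalDegree = π.totalDegree + ℓ.totalDegree :=
      totalDegree_mul_of_isDomain hπ.ne_zero hℓ0
    have h1 := h π hπ (by omega)
    have h2 := ih hℓ0 (by omega)
    have h3 := one_le_totalDegree_of_irreducible hπ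
    have hsub : (T.filter fun x => eval x (π * ℓ) = 0) ⊆
        (T.filter fun x => eval x π = 0) ∪ (T.filter fun x => eval x ℓ = 0) := by
      intro x hx
      simp only [Finset.mem_union, Finset.mem_filter, map_mul, mul_eq_zero] at hx ⊢
      tauto
    calc _ ≤ _ := Finset.card_le_card hsub
      _ ≤ _ := Finset.card_union_le _ _
      _ ≤ 1 * K + ℓ.totalDegree * K := by omega
      _ ≤ π.totalDegree * K + ℓ.totalDegree * K := by gcongr
      _ = _ := by rw [hd]; ring

lemma totalDegree_det_le {n : ℕ} {m : Type*} [Fintype m] [DecidableEq m]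
    (M : Matrix m m (MvPolynomial (Fin n) ℂ)) (δ : ℕ) (h : ∀ i j, (M i j).totalDegree ≤ δ) :
    M.det.totalDegree ≤ Fintype.card m * δ := by
  rw [Matrix.det_apply]
  apply totalDegree_finsetSum_le
  intro σ _
  have h1 : (∏ i, M (σ i) i).totalDegree ≤ Fintype.card m * δ := by
    refine (totalDegree_finsetProd _ _).trans ?_
    refine (Finset.sum_le_card_nsmul _ _ δ fun i _ => h _ _).trans ?_
    simp
  rcases Int.units_eq_one_or (Equiv.Perm.sign σ) with hs | hs <;> rw [hs] <;> simpa using h1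

lemma totalDegree_resultant_le {n : ℕ} (f g : Polynomial (MvPolynomial (Fin n) ℂ)) (δ : ℕ)
    (hf : ∀ i, (f.coeff i).totalDegree ≤ δ) (hg : ∀ i, (g.coeff i).totalDegree ≤ δ)
    (hfn : f.natDegree ≤ δ) (hgn : g.natDegree ≤ δ) :
    (f.resultant g).totalDegree ≤ 2 * δ * δ := by
  unfold Polynomial.resultant
  refine (totalDegree_det_le _ δ ?_).trans ?_
  · intro i j
    unfold Polynomial.sylvester
    simp only [Matrix.of_apply]
    refine Fin.addCases (fun k => ?_) (fun k => ?_) j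
    · simp only [Fin.addCases_left]
      split_ifs
      · exact hg _
      · simp
    · simp only [Fin.addCases_right]
      split_ifs
      · exact hf _
      · simp
  · simp only [Fintype.card_fin]
    gcongr
    omega

lemma exists_resultant {n : ℕ} (f g : Polynomial (MvPolynomial (Fin n) ℂ)) (δ : ℕ)
    (hf : ∀ i, (f.coeff i).totalDegree ≤ δ) (hg : ∀ i, (g.coeff i).totalDegree ≤ δ)
    (hfn : f.natDegree ≤ δ) (hgn : g.natDegree ≤ δ) (hirr : Irreducible f)
    (hpos : f.natDegree ≠ 0) (hfg : ¬ f ∣ g) :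
    ∃ r : MvPolynomial (Fin n) ℂ, r ≠ 0 ∧ r.totalDegree ≤ 2 * δ * δ ∧
      ∃ p q, f * p + g * q = Polynomial.C r := by
  refine ⟨f.resultant g, ?_, totalDegree_resultant_le f g δ hf hg hfn hgn, ?_⟩
  · have hprim : f.IsPrimitive := hirr.isPrimitive hpos
    set K := FractionRing (MvPolynomial (Fin n) ℂ)
    have hirrK := (hprim.irreducible_iff_irreducible_map_fraction_map (K := K)).1 hirr
    have hinj := IsFractionRing.injective (MvPolynomial (Fin n) ℂ) K
    have hcop : IsCoprime (f.map (algebraMap _ K)) (g.map (algebraMap _ K)) := by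
      refine (hirrK.coprime_iff_not_dvd).2 ?_
      by_cases hg0 : g = 0
      · rw [hg0] at hfg; exact absurd (dvd_zero f) hfg
      · intro hd
        obtain ⟨d, hd0, hd⟩ : ∃ d : MvPolynomial (Fin n) ℂ, d ≠ 0 ∧ f ∣ Polynomial.C d * g := by
          obtain ⟨h, hh⟩ := hd
          obtain ⟨d, hd0, hd'⟩ := IsLocalization.integerNormalization_spec
            (nonZeroDivisors (MvPolynomial (Fin n) ℂ)) h
          refine ⟨d, nonZeroDivisors.ne_zero hd0, 
            IsLocalization.integerNormalization (nonZeroDivisors (MvPolynomial (Fin n) ℂ)) h, ?_⟩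
          apply Polynomial.map_injective _ hinj
          rw [Polynomial.map_mul, Polynomial.map_mul, hd', hh, Polynomial.map_C]
          simp only [Algebra.smul_def, Polynomial.algebraMap_apply]
          ring
        have hp : Prime f := hirr.prime
        rcases hp.dvd_or_dvd hd with h | h
        · have := Polynomial.natDegree_le_of_dvd h (by simpa using hd0)
          simp at this
          omega
        · exact hfg h
    have := Polynomial.resultant_ne_zero _ _ hcop
    intro h0
    apply this
    rw [Polynomial.natDegree_map_eq_of_injective hinj, Polynomial.natDegree_map_eq_of_injective hinj,
      Polynomial.resultant_map_map, h0, map_zero]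
  · obtain ⟨p, q, -, -, h⟩ := Polynomial.exists_mul_add_mul_eq_C_resultant f g le_rfl le_rfl
      (Or.inl hpos)
    exact ⟨p, q, h⟩

theorem card_common_zeros_le (n δ : ℕ) : ∃ K : ℕ, ∀ f g : MvPolynomial (Fin n) ℂ,
    Irreducible f → ¬ f ∣ g → f.totalDegree ≤ δ → g.totalDegree ≤ δ → ∀ A : Fin n → Finset ℂ,
    ((Fintype.piFinset A).filter fun x => eval x f = 0 ∧ eval x g = 0).card
      ≤ K * codimTwo n (fun i => (A i).card) := by
  induction n with
  | zero =>
    refine ⟨0, fun f g hf => ?_⟩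
    have := one_le_totalDegree_of_irreducible hf
    rw [f.eq_C_of_isEmpty] at this
    simp at this
  | succ n ih =>
    obtain ⟨K, hK⟩ := ih
    refine ⟨δ * K + 2 * δ * δ * δ + K + δ * δ, ?_⟩
    intro f g hf hfg hfδ hgδ A
    set P := finSuccEquiv ℂ n f with hP
    set Q := finSuccEquiv ℂ n g with hQ
    have hPirr : Irreducible P := (MulEquiv.irreducible_iff (finSuccEquiv ℂ n)).2 hf
    have hPQ : ¬ P ∣ Q := by
      rw [hP, hQ, map_dvd_iff]; exact hfg
    have hPc := fun i => (totalDegree_coeff_finSuccEquiv_le f i).trans hfδ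
    have hQc := fun i => (totalDegree_coeff_finSuccEquiv_le g i).trans hgδ
    have hPn : P.natDegree ≤ δ :=
      (natDegree_finSuccEquiv f).le.trans ((degreeOf_le_totalDegree f 0).trans hfδ)
    have hQn : Q.natDegree ≤ δ :=
      (natDegree_finSuccEquiv g).le.trans ((degreeOf_le_totalDegree g 0).trans hgδ)
    set a := fun i => (A i).card with ha
    have hA : ∀ x ∈ Fintype.piFinset A, Fin.tail x ∈ Fintype.piFinset (Fin.tail A) := by
      intro x hx
      rw [Fintype.mem_piFinset] at hx ⊢
      exact fun i => hx i.succ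
    by_cases hdeg : P.natDegree = 0
    · obtain ⟨f', hf'⟩ := Polynomial.natDegree_eq_zero.1 hdeg
      have hf'irr : Irreducible f' := by
        rw [← hf'] at hPirr
        refine ⟨fun h => hPirr.not_isUnit (h.map Polynomial.C), fun u v huv => ?_⟩
        rcases hPirr.isUnit_or_isUnit (a := Polynomial.C u) (b := Polynomial.C v)
          (by rw [huv, Polynomial.C_mul]) with h | h
        · exact Or.inl (Polynomial.isUnit_C.1 h)
        · exact Or.inr (Polynomial.isUnit_C.1 h)
      have hf'δ : f'.totalDegree ≤ δ := by
        have := hPc 0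
        rwa [← hP, ← hf', Polynomial.coeff_C_zero] at this
      obtain ⟨i, hi⟩ : ∃ i, ¬ f' ∣ Q.coeff i := by
        by_contra hcon
        push Not at hcon
        exact hPQ (hf' ▸ (Polynomial.C_dvd_iff_dvd_coeff f' Q).2 hcon)
      have hev : ∀ x, eval x f = 0 → eval (Fin.tail x) f' = 0 := by
        intro x hx
        rw [← Fin.cons_self_tail x, eval_finSuccEquiv, ← hP, ← hf'] at hx
        simpa using hx
      have hsplit : ((Fintype.piFinset A).filter fun x => eval x f = 0 ∧ eval x g = 0) ⊆
          ((Fintype.piFinset A).filter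
            fun x => eval (Fin.tail x) f' = 0 ∧ eval (Fin.tail x) (Q.coeff i) = 0) ∪
          ((Fintype.piFinset A).filter
            fun x => eval x g = 0 ∧ eval (Fin.tail x) f' = 0 ∧ eval (Fin.tail x) (Q.coeff i) ≠ 0) := by
        intro x hx
        simp only [Finset.mem_union, Finset.mem_filter] at hx ⊢
        have := hev x hx.2.1
        tauto
      have h1 : ((Fintype.piFinset A).filter
            fun x => eval (Fin.tail x) f' = 0 ∧ eval (Fin.tail x) (Q.coeff i) = 0).card
          ≤ a 0 * (K * codimTwo n (Fin.tail a)) := by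
        refine (card_filter_piFinset_succ_le A _
          ((Fintype.piFinset (Fin.tail A)).filter
            fun x => eval x f' = 0 ∧ eval x (Q.coeff i) = 0) (a 0) ?_ ?_).trans ?_
        · intro x hx h
          rw [Finset.mem_filter]
          exact ⟨hA x hx, h⟩
        · intro x' _
          exact Finset.card_filter_le _ _
        · exact Nat.mul_le_mul_left _ (hK f' (Q.coeff i) hf'irr hi hf'δ (hQc i) _)
      have h2 : ((Fintype.piFinset A).filter
            fun x => eval x g = 0 ∧ eval (Fin.tail x) f' = 0 ∧ eval (Fin.tail x) (Q.coeff i) ≠ 0).card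
          ≤ δ * (δ * codimOne n (Fin.tail a)) := by
        refine (card_filter_piFinset_succ_le A _
          ((Fintype.piFinset (Fin.tail A)).filter
            fun x => eval x f' = 0 ∧ eval x (Q.coeff i) ≠ 0) δ ?_ ?_).trans ?_
        · intro x hx h
          rw [Finset.mem_filter]
          exact ⟨hA x hx, h.2⟩
        · intro x' hx'
          rw [Finset.mem_filter] at hx'
          refine le_trans (Finset.card_le_card ?_)
            (card_roots_fibre_le g hgδ x' _ hx'.2.2 (A 0))
          intro x hx
          rw [Finset.mem_filter] at hx ⊢
          exact ⟨hx.1, hx.2.1⟩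
        · refine Nat.mul_le_mul_left _ (le_trans (Finset.card_le_card ?_)
            (card_zeros_le f' hf'irr.ne_zero hf'δ (Fin.tail A)))
          intro x hx
          rw [Finset.mem_filter] at hx ⊢
          exact ⟨hx.1, hx.2.1⟩
      calc _ ≤ _ := Finset.card_le_card hsplit
        _ ≤ _ := Finset.card_union_le _ _
        _ ≤ a 0 * (K * codimTwo n (Fin.tail a)) + δ * (δ * codimOne n (Fin.tail a)) :=
          add_le_add h1 h2
        _ ≤ (δ * K + 2 * δ * δ * δ + K + δ * δ) *
            (a 0 * codimTwo n (Fin.tail a) + codimOne n (Fin.tail a)) := by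
          nlinarith [Nat.zero_le (a 0 * codimTwo n (Fin.tail a)), Nat.zero_le (codimOne n (Fin.tail a)),
            Nat.zero_le ((δ * K + 2 * δ * δ * δ + δ * δ) * (a 0 * codimTwo n (Fin.tail a))),
            Nat.zero_le ((δ * K + 2 * δ * δ * δ + K) * codimOne n (Fin.tail a))]
        _ = _ := rfl
    · obtain ⟨r, hr0, hrδ, p, q, hpq⟩ := exists_resultant P Q δ hPc hQc hPn hQn hPirr hdeg hPQ
      set ℓ := P.leadingCoeff with hℓ
      have hℓ0 : ℓ ≠ 0 := Polynomial.leadingCoeff_ne_zero.2 hPirr.ne_zero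
      set T := (Fintype.piFinset (Fin.tail A)).filter fun x => ∀ i, eval x (P.coeff i) = 0 with hT
      have hTcard : T.card ≤ δ * (K * codimTwo n (Fin.tail a)) := by
        have := card_filter_eval_le_of_irreducible T δ (K * codimTwo n (Fin.tail a)) ?_ ℓ hℓ0
          (hPc _)
        · refine le_trans (le_trans (Finset.card_le_card ?_) this)
            (Nat.mul_le_mul_right _ (hPc _))
          intro x hx
          rw [Finset.mem_filter]
          refine ⟨hx, ?_⟩
          rw [hT, Finset.mem_filter] at hx
          exact hx.2 _
        · intro π hπ hπδ
          obtain ⟨i, hi⟩ : ∃ i, ¬ π ∣ P.coeff i := by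
            by_contra hcon
            push Not at hcon
            have hd := (Polynomial.C_dvd_iff_dvd_coeff π P).2 hcon
            have hu := (hPirr.isPrimitive hdeg) π hd
            exact hπ.not_isUnit hu
          refine le_trans (Finset.card_le_card ?_)
            (hK π (P.coeff i) hπ hi hπδ (hPc i) (Fin.tail A))
          intro x hx
          rw [Finset.mem_filter, hT, Finset.mem_filter] at hx
          rw [Finset.mem_filter]
          exact ⟨hx.1.1, hx.2, hx.1.2 i⟩
      have hsplit : ((Fintype.piFinset A).filter fun x => eval x f = 0 ∧ eval x g = 0) ⊆
          ((Fintype.piFinset A).filter fun x => ∀ i, eval (Fin.tail x) (P.coeff i) = 0) ∪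
          ((Fintype.piFinset A).filter
            fun x => eval x f = 0 ∧ eval (Fin.tail x) r = 0 ∧
              ∃ i, eval (Fin.tail x) (P.coeff i) ≠ 0) := by
        intro x hx
        simp only [Finset.mem_union, Finset.mem_filter] at hx ⊢
        have hr : eval (Fin.tail x) r = 0 := by
          have h1 := hx.2.1
          have h2 := hx.2.2
          rw [← Fin.cons_self_tail x, eval_finSuccEquiv] at h1 h2
          have := congrArg (fun w => Polynomial.eval (x 0) (Polynomial.map (eval (Fin.tail x)) w)) hpq
          simp only [Polynomial.map_add, Polynomial.map_mul, Polynomial.eval_add,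
            Polynomial.eval_mul, Polynomial.map_C, Polynomial.eval_C] at this
          rw [hP, hQ, h1, h2] at this
          simpa using this.symm
        by_cases hc : ∀ i, eval (Fin.tail x) (P.coeff i) = 0
        · exact Or.inl ⟨hx.1, hc⟩
        · push Not at hc
          exact Or.inr ⟨hx.1, hx.2.1, hr, hc⟩
      have h1 : ((Fintype.piFinset A).filter
          fun x => ∀ i, eval (Fin.tail x) (P.coeff i) = 0).card
          ≤ a 0 * (δ * (K * codimTwo n (Fin.tail a))) := by
        refine (card_filter_piFinset_succ_le A _ T (a 0) ?_ ?_).trans ?_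
        · intro x hx h
          rw [hT, Finset.mem_filter]
          exact ⟨hA x hx, h⟩
        · intro x' _
          exact Finset.card_filter_le _ _
        · exact Nat.mul_le_mul_left _ hTcard
      have h2 : ((Fintype.piFinset A).filter
            fun x => eval x f = 0 ∧ eval (Fin.tail x) r = 0 ∧
              ∃ i, eval (Fin.tail x) (P.coeff i) ≠ 0).card
          ≤ δ * (2 * δ * δ * codimOne n (Fin.tail a)) := by
        refine (card_filter_piFinset_succ_le A _
          ((Fintype.piFinset (Fin.tail A)).filter
            fun x => eval x r = 0 ∧ ∃ i, eval x (P.coeff i) ≠ 0) δ ?_ ?_).trans ?_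
        · intro x hx h
          rw [Finset.mem_filter]
          exact ⟨hA x hx, h.2⟩
        · intro x' hx'
          rw [Finset.mem_filter] at hx'
          obtain ⟨-, -, i, hi⟩ := hx'
          refine le_trans (Finset.card_le_card ?_)
            (card_roots_fibre_le f hfδ x' i hi (A 0))
          intro x hx
          rw [Finset.mem_filter] at hx ⊢
          exact ⟨hx.1, hx.2.1⟩
        · refine Nat.mul_le_mul_left _ (le_trans (Finset.card_le_card ?_)
            (card_zeros_le r hr0 hrδ (Fin.tail A)))
          intro x hx
          rw [Finset.mem_filter] at hx ⊢
          exact ⟨hx.1, hx.2.1⟩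
      calc _ ≤ _ := Finset.card_le_card hsplit
        _ ≤ _ := Finset.card_union_le _ _
        _ ≤ a 0 * (δ * (K * codimTwo n (Fin.tail a))) + δ * (2 * δ * δ * codimOne n (Fin.tail a)) :=
          add_le_add h1 h2
        _ ≤ (δ * K + 2 * δ * δ * δ + K + δ * δ) *
            (a 0 * codimTwo n (Fin.tail a) + codimOne n (Fin.tail a)) := by
          nlinarith [Nat.zero_le (a 0 * codimTwo n (Fin.tail a)), Nat.zero_le (codimOne n (Fin.tail a)),
            Nat.zero_le ((2 * δ * δ * δ + K + δ * δ) * (a 0 * codimTwo n (Fin.tail a))),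
            Nat.zero_le ((δ * K + K + δ * δ) * codimOne n (Fin.tail a))]
        _ = _ := rfl

/-- A uniform bound for the number of common zeros of two coprime plane curves. -/
theorem exists_bezout_bound (δ : ℕ) : ∃ B : ℕ, ∀ f g : MvPolynomial (Fin 2) ℂ,
    Irreducible f → ¬ f ∣ g → f.totalDegree ≤ δ → g.totalDegree ≤ δ →
    ∀ T : Finset (Fin 2 → ℂ), (∀ x ∈ T, eval x f = 0 ∧ eval x g = 0) → T.card ≤ B := by
  obtain ⟨K, hK⟩ := card_common_zeros_le 2 δ
  refine ⟨K, fun f g hf hfg h1 h2 T hT => ?_⟩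
  have := hK f g hf hfg h1 h2 (fun i => T.image fun x => x i)
  simp only [codimTwo, codimOne] at this
  refine le_trans (Finset.card_le_card ?_) (this.trans (by simp))
  intro x hx
  rw [Finset.mem_filter, Fintype.mem_piFinset]
  exact ⟨fun i => Finset.mem_image_of_mem _ hx, hT x hx⟩

open MeasureTheory in
/-- The area covered by a holomorphic function that takes every value at most `p` times. -/
lemma lintegral_norm_deriv_sq_le {u : ℂ → ℂ} {U S : Set ℂ} (hU : IsOpen U)
    (hu : DifferentiableOn ℂ u U) (hS : MeasurableSet S) (hSU : S ⊆ U) (p : ℕ)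
    (hp : ∀ c : ℂ, ∀ T : Finset ℂ, (∀ z ∈ T, z ∈ U ∧ u z = c) → T.card ≤ p)
    {R : ℝ} (hR : ∀ z ∈ S, ‖u z‖ ≤ R) :
    ∫⁻ z in S, ENNReal.ofReal (‖deriv u z‖ ^ 2) ≤ p * volume (Metric.closedBall (0 : ℂ) R) := by
  have hderiv : ContinuousOn (deriv u) U := (hu.deriv hU).continuousOn
  set V : Set ℂ := U ∩ deriv u ⁻¹' {0}ᶜ with hV
  have hVo : IsOpen V := hderiv.isOpen_inter_preimage hU isOpen_compl_singleton
  have hinj : ∀ z ∈ V, ∃ W ∈ nhdsWithin z V, Set.InjOn u W := by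
    intro z hz
    have hs : HasStrictDerivAt u (deriv u z) z :=
      (hu.analyticAt (hU.mem_nhds hz.1)).hasStrictDerivAt
    have h2 := hs.hasStrictFDerivAt_equiv hz.2
    refine ⟨(h2.toOpenPartialHomeomorph u).source, ?_, ?_⟩
    · exact mem_nhdsWithin_of_mem_nhds
        ((h2.toOpenPartialHomeomorph u).open_source.mem_nhds h2.mem_toOpenPartialHomeomorph_source)
    · have := (h2.toOpenPartialHomeomorph u).injOn
      rwa [h2.toOpenPartialHomeomorph_coe] at this
  choose! W hW hWinj using hinj
  obtain ⟨t, htV, htc, hcov⟩ := TopologicalSpace.countable_cover_nhdsWithin (f := fun z => interior (W z)) (s := V)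
    (fun z hz => by
      have : W z ∈ nhds z := by
        have := hW z hz
        rwa [hVo.nhdsWithin_eq hz] at this
      exact mem_nhdsWithin_of_mem_nhds (interior_mem_nhds.2 this))
  have hS0 : ∫⁻ z in S, ENNReal.ofReal (‖deriv u z‖ ^ 2)
      = ∫⁻ z in S ∩ V, ENNReal.ofReal (‖deriv u z‖ ^ 2) := by
    rw [← lintegral_inter_add_sdiff _ S hVo.measurableSet]
    rw [setLIntegral_congr_fun (g := fun _ => 0) (hS.diff hVo.measurableSet)]
    · simp
    · intro z hz
      have : deriv u z = 0 := by
        by_contra h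
        exact hz.2 ⟨hSU hz.1, h⟩
      simp [this]
  rcases t.eq_empty_or_nonempty with hte | hte
  · have : V = ∅ := by
      rw [hte] at hcov
      simpa using hcov
    rw [hS0, this]; simp
  obtain ⟨e, he⟩ := htc.exists_eq_range hte
  set Q : ℕ → Set ℂ := fun k => S ∩ V ∩ disjointed (fun k => interior (W (e k))) k with hQ
  have hQm : ∀ k, MeasurableSet (Q k) := fun k =>
    (hS.inter hVo.measurableSet).inter
      (MeasurableSet.disjointed (fun k => isOpen_interior.measurableSet) k)
  have hQd : Pairwise (Function.onFun Disjoint Q) := by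
    intro i j hij
    exact (disjoint_disjointed _ hij).mono Set.inter_subset_right Set.inter_subset_right
  have hQU : ⋃ k, Q k = S ∩ V := by
    rw [hQ, ← Set.inter_iUnion, iUnion_disjointed, Set.inter_eq_left]
    intro z hz
    have := hcov hz.2
    rw [he] at this
    simpa using this
  have hQinj : ∀ k, Set.InjOn u (Q k) := by
    intro k
    have hk : e k ∈ V := htV (he ▸ Set.mem_range_self k)
    refine (hWinj (e k) hk).mono ?_
    intro z hz
    exact interior_subset (disjointed_subset _ k hz.2)
  have hQUsub : ∀ k, Q k ⊆ U := fun k z hz => hSU hz.1.1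
  have hQint : ∀ k, ∫⁻ z in Q k, ENNReal.ofReal (‖deriv u z‖ ^ 2) = volume (u '' Q k) := by
    intro k
    rw [← lintegral_abs_det_fderiv_eq_addHaar_image volume (hQm k)
      (f' := fun z => ((ContinuousLinearMap.toSpanSingleton ℂ (deriv u z)).restrictScalars ℝ)) _ (hQinj k)]
    · apply lintegral_congr
      intro z
      congr 1
      have : ((ContinuousLinearMap.toSpanSingleton ℂ (deriv u z)).restrictScalars ℝ).det
          = ‖deriv u z‖ ^ 2 := by
        have h1 : ((ContinuousLinearMap.toSpanSingleton ℂ (deriv u z)).restrictScalars ℝ).det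
          = (((ContinuousLinearMap.toSpanSingleton ℂ (deriv u z)) : ℂ →ₗ[ℂ] ℂ).restrictScalars ℝ).det := rfl
        rw [h1, LinearMap.det_restrictScalars, LinearMap.det_ring, Algebra.norm_complex_apply]
        simp [Complex.normSq_eq_norm_sq]
      rw [this, abs_of_nonneg (by positivity)]
    · intro z hz
      have : HasDerivAt u (deriv u z) z :=
        (hu.differentiableAt (hU.mem_nhds (hQUsub k hz))).hasDerivAt
      exact (this.hasFDerivAt.restrictScalars ℝ).hasFDerivWithinAt
  have himm : ∀ k, MeasurableSet (u '' Q k) := fun k =>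
    (hQm k).image_of_continuousOn_injOn (hu.continuousOn.mono (hQUsub k)) (hQinj k)
  rw [hS0, ← hQU, lintegral_iUnion hQm hQd]
  simp_rw [hQint]
  calc ∑' k, volume (u '' Q k) = ∑' k, ∫⁻ c, (u '' Q k).indicator 1 c := by
        congr 1; ext k; rw [lintegral_indicator_one (himm k)]
    _ = ∫⁻ c, ∑' k, (u '' Q k).indicator 1 c := by
        rw [lintegral_tsum]
        intro k
        exact (measurable_one.indicator (himm k)).aemeasurable
    _ ≤ ∫⁻ c, (Metric.closedBall (0 : ℂ) R).indicator (fun _ => (p : ENNReal)) c := by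
        apply lintegral_mono
        intro c
        simp only
        by_cases hc : c ∈ Metric.closedBall (0 : ℂ) R
        · rw [Set.indicator_of_mem hc, ENNReal.tsum_eq_iSup_sum]
          apply iSup_le
          intro s
          have hsum : ∑ k ∈ s, (u '' Q k).indicator (1 : ℂ → ENNReal) c
              = ((s.filter fun k => c ∈ u '' Q k).card : ENNReal) := by
            rw [Finset.card_filter]
            push_cast
            apply Finset.sum_congr rfl
            intro k _
            simp [Set.indicator_apply]
          rw [hsum]
          norm_cast
          have hex : ∀ k ∈ s.filter fun k => c ∈ u '' Q k, ∃ z, z ∈ Q k ∧ u z = c := by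
            intro k hk
            exact (Finset.mem_filter.1 hk).2
          choose! g hg using hex
          rw [← Finset.card_image_of_injOn (f := g)]
          · apply hp c
            intro z hz
            obtain ⟨k, hk, rfl⟩ := Finset.mem_image.1 hz
            exact ⟨hQUsub k (hg k hk).1, (hg k hk).2⟩
          · intro i hi j hj hij
            by_contra hne
            exact Set.disjoint_left.1 (hQd hne) (hg i hi).1 (hij ▸ (hg j hj).1)
        · have : ∀ k, (u '' Q k).indicator (1 : ℂ → ENNReal) c = 0 := by
            intro k
            apply Set.indicator_of_notMem
            rintro ⟨z, hz, rfl⟩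
            apply hc
            simpa using hR z hz.1.1
          simp [this]
    _ = _ := by
        rw [lintegral_indicator Metric.isClosed_closedBall.measurableSet]
        simp

open MeasureTheory in
/-- The length–area principle: a nonnegative function on the plane of bounded square integral has
a circle on which its integral is small. -/
lemma exists_circle_small_length (ε M : ℝ) (hε : 0 < ε) :
    ∃ α : ℝ, 0 < α ∧ α < 1 / 2 ∧ ∀ v : ℂ → ℝ, Measurable v → (∀ z, 0 ≤ v z) →
      ∫⁻ z, ENNReal.ofReal (v z ^ 2) ≤ ENNReal.ofReal M →
      ∃ r : ℝ, α < r ∧ r < 1 / 2 ∧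
        ∫⁻ θ in Set.Ioo (-Real.pi) Real.pi, ENNReal.ofReal (r * v (r * Complex.exp (θ * Complex.I)))
          < ENNReal.ofReal ε := by
  set L : ℝ := (|M| + 1) * (2 * Real.pi) / ε ^ 2 with hL
  have hLpos : 0 < L := by positivity
  refine ⟨Real.exp (-L) / 2, by positivity, ?_, ?_⟩
  · have : Real.exp (-L) < 1 := by rw [Real.exp_lt_one_iff]; linarith
    linarith
  intro v hvm hv0 hvM
  set α := Real.exp (-L) / 2 with hα
  have hα0 : 0 < α := by positivity
  have hα2 : α < 1 / 2 := by
    have : Real.exp (-L) < 1 := by rw [Real.exp_lt_one_iff]; linarith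
    linarith
  by_contra hcon
  push Not at hcon
  have hkey : ∀ r ∈ Set.Ioo α (1 / 2), ENNReal.ofReal (ε ^ 2 / (2 * Real.pi) * r⁻¹) ≤
      ∫⁻ θ in Set.Ioo (-Real.pi) Real.pi,
        ENNReal.ofReal r * ENNReal.ofReal (v (r * Complex.exp (θ * Complex.I)) ^ 2) := by
    intro r hr
    have hr0 : 0 < r := hα0.trans hr.1
    have h1 := hcon r hr.1 hr.2
    set H := ∫⁻ θ in Set.Ioo (-Real.pi) Real.pi,
        ENNReal.ofReal r * ENNReal.ofReal (v (r * Complex.exp (θ * Complex.I)) ^ 2) with hH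
    by_cases htop : H = ⊤
    · rw [htop]; exact le_top
    have h2 : ∫⁻ θ in Set.Ioo (-Real.pi) Real.pi,
        ENNReal.ofReal (r * v (r * Complex.exp (θ * Complex.I)))
        ≤ ENNReal.ofReal (Real.pi / ε * r) * H + ENNReal.ofReal (ε / 2) := by
      calc _ ≤ ∫⁻ θ in Set.Ioo (-Real.pi) Real.pi,
            (ENNReal.ofReal (Real.pi / ε * r) * (ENNReal.ofReal r *
              ENNReal.ofReal (v (r * Complex.exp (θ * Complex.I)) ^ 2))
              + ENNReal.ofReal (ε / (4 * Real.pi))) := by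
            apply lintegral_mono
            intro θ
            simp only
            set w := v (r * Complex.exp (θ * Complex.I)) with hw
            rw [← ENNReal.ofReal_mul (by positivity), ← ENNReal.ofReal_mul (by positivity),
              ← ENNReal.ofReal_add (by positivity) (by positivity)]
            apply ENNReal.ofReal_le_ofReal
            have hpi := Real.pi_pos
            have : Real.pi / ε * r * (r * w ^ 2) + ε / (4 * Real.pi) - r * w
                = Real.pi / ε * (r * w - ε / (2 * Real.pi)) ^ 2 := by
              field_simp; ring
            have h3 : 0 ≤ Real.pi / ε * (r * w - ε / (2 * Real.pi)) ^ 2 := by positivity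
            linarith
        _ = _ := by
            rw [lintegral_add_right _ measurable_const, lintegral_const_mul']
            · congr 1
              rw [lintegral_const, Measure.restrict_apply MeasurableSet.univ, Set.univ_inter,
                Real.volume_Ioo, ← ENNReal.ofReal_mul (by positivity)]
              congr 1
              have hpi := Real.pi_pos
              field_simp; ring
            · exact ENNReal.ofReal_ne_top
    have h3 := h1.trans h2
    lift H to NNReal using htop with H'
    rw [← ENNReal.ofReal_coe_nnreal, ← ENNReal.ofReal_mul (by positivity),
      ← ENNReal.ofReal_add (by positivity) (by positivity),
      ENNReal.ofReal_le_ofReal_iff (by positivity)] at h3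
    rw [← ENNReal.ofReal_coe_nnreal]
    apply ENNReal.ofReal_le_ofReal
    have hpi := Real.pi_pos
    have h4 : ε / 2 ≤ Real.pi / ε * r * H' := by linarith
    calc ε ^ 2 / (2 * Real.pi) * r⁻¹ = (ε / 2) * (ε / (Real.pi * r)) := by field_simp
      _ ≤ (Real.pi / ε * r * H') * (ε / (Real.pi * r)) := by gcongr
      _ = H' := by field_simp
  have hInt : ∫⁻ r in Set.Ioo α (1 / 2), ENNReal.ofReal (ε ^ 2 / (2 * Real.pi) * r⁻¹)
      = ENNReal.ofReal (ε ^ 2 / (2 * Real.pi) * L) := by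
    rw [← ofReal_integral_eq_lintegral_ofReal]
    · congr 1
      rw [← integral_Ioc_eq_integral_Ioo, ← intervalIntegral.integral_of_le hα2.le,
        intervalIntegral.integral_const_mul, integral_inv_of_pos hα0 (by norm_num)]
      congr 1
      rw [hα, show (1 / 2 : ℝ) / (Real.exp (-L) / 2) = Real.exp L by
        rw [Real.exp_neg]; field_simp, Real.log_exp]
    · have : IntervalIntegrable (fun r : ℝ => ε ^ 2 / (2 * Real.pi) * r⁻¹) volume α (1 / 2) := by
        apply ContinuousOn.intervalIntegrable
        apply continuousOn_const.mul
        apply continuousOn_inv₀.mono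
        intro r hr
        rw [Set.uIcc_of_le hα2.le] at hr
        exact (hα0.trans_le hr.1).ne'
      exact ((intervalIntegrable_iff_integrableOn_Ioc_of_le hα2.le).1 this).mono_set
        Set.Ioo_subset_Ioc_self
    · rw [Filter.EventuallyLE, ae_restrict_iff' measurableSet_Ioo]
      refine Filter.Eventually.of_forall fun r hr => ?_
      have : 0 < r := hα0.trans hr.1
      simp only [Pi.zero_apply]
      positivity
  have hpolar : ∫⁻ r in Set.Ioo α (1 / 2), ∫⁻ θ in Set.Ioo (-Real.pi) Real.pi,
        ENNReal.ofReal r * ENNReal.ofReal (v (r * Complex.exp (θ * Complex.I)) ^ 2)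
      ≤ ENNReal.ofReal M := by
    refine le_trans ?_ hvM
    rw [← Complex.lintegral_comp_polarCoord_symm, polarCoord_target, Measure.volume_eq_prod,
      setLIntegral_prod]
    · simp only [Complex.polarCoord_symm_apply, smul_eq_mul]
      refine le_trans (lintegral_mono_set (t := Set.Ioi 0) ?_) (le_of_eq ?_)
      · intro r hr; exact hα0.trans hr.1
      · refine lintegral_congr fun r => lintegral_congr fun θ => ?_
        rw [Complex.exp_mul_I, ← Complex.ofReal_cos, ← Complex.ofReal_sin]
    · apply Measurable.aemeasurable
      simp only [smul_eq_mul]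
      have h0 : Measurable fun p : ℝ × ℝ => Complex.polarCoord.symm p := by
        simp only [Complex.polarCoord_symm_apply]
        fun_prop
      have h1 : Measurable fun p : ℝ × ℝ => ENNReal.ofReal p.1 := by fun_prop
      have h2 : Measurable fun p : ℝ × ℝ => ENNReal.ofReal (v (Complex.polarCoord.symm p) ^ 2) :=
        ((hvm.comp h0).pow_const 2).ennreal_ofReal
      exact h1.mul h2
  have hle : ENNReal.ofReal (ε ^ 2 / (2 * Real.pi) * L) ≤ ENNReal.ofReal M := by
    rw [← hInt]
    refine le_trans ?_ hpolar
    exact setLIntegral_mono' measurableSet_Ioo hkey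
  have hval : ε ^ 2 / (2 * Real.pi) * L = |M| + 1 := by
    rw [hL]; have := Real.pi_pos; field_simp
  rw [hval] at hle
  rw [ENNReal.ofReal_le_ofReal_iff'] at hle
  rcases hle with h | h
  · have := le_abs_self M; linarith
  · have := abs_nonneg M; linarith

open MeasureTheory in
/-- A path starting on the unit circle that is short inside the disc of radius `3` stays close to
its starting point. -/
lemma norm_sub_le_of_short {w w' : ℝ → ℂ} (hw : ∀ θ, HasDerivAt w (w' θ) θ)
    (hw' : Continuous w') {ε : ℝ} (hε : 0 < ε) (hε1 : ε < 1) {θ₀ : ℝ}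
    (h0 : ‖w θ₀‖ = 1) (hθ₀ : θ₀ ∈ Set.Icc (-Real.pi) Real.pi)
    (hlen : ∫⁻ θ in Set.Ioo (-Real.pi) Real.pi,
      ENNReal.ofReal (if ‖w θ‖ ≤ 3 then ‖w' θ‖ else 0) < ENNReal.ofReal ε) :
    ∀ θ ∈ Set.Icc (-Real.pi) Real.pi, ‖w θ - w θ₀‖ ≤ ε := by
  intro θ₁ hθ₁
  by_contra hcon
  push Not at hcon
  have hwc : Continuous w := continuous_iff_continuousAt.2 fun θ => (hw θ).continuousAt
  have hcomp : IsCompact (Set.Icc (-Real.pi) Real.pi ∩ {θ | ε ≤ ‖w θ - w θ₀‖}) :=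
    isCompact_Icc.inter_right (isClosed_le continuous_const (hwc.sub continuous_const).norm)
  obtain ⟨θ₂, ⟨hθ₂, hθ₂ε⟩, hmin⟩ := hcomp.exists_isMinOn ⟨θ₁, hθ₁, hcon.le⟩
    (f := fun θ => |θ - θ₀|) (by fun_prop)
  have hsub : Set.uIoc θ₀ θ₂ ⊆ Set.Icc (-Real.pi) Real.pi :=
    Set.uIoc_subset_uIcc.trans (Set.uIcc_subset_Icc hθ₀ hθ₂)
  have hclose : ∀ θ ∈ Set.uIoc θ₀ θ₂, θ ≠ θ₂ → ‖w θ‖ ≤ 3 := by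
    intro θ hθ hne
    have hlt : |θ - θ₀| < |θ₂ - θ₀| := by
      rcases le_total θ₀ θ₂ with h | h
      · rw [Set.uIoc_of_le h] at hθ
        rw [abs_of_pos (by linarith [hθ.1]), abs_of_nonneg (by linarith)]
        have := lt_of_le_of_ne hθ.2 hne
        linarith
      · rw [Set.uIoc_of_ge h] at hθ
        rw [abs_of_nonpos (by linarith [hθ.2]), abs_of_nonpos (by linarith)]
        linarith [hθ.1]
    have : ‖w θ - w θ₀‖ < ε := by
      by_contra hge
      push Not at hge
      have : |θ₂ - θ₀| ≤ |θ - θ₀| := hmin ⟨hsub hθ, hge⟩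
      linarith
    calc ‖w θ‖ = ‖(w θ - w θ₀) + w θ₀‖ := by ring_nf
      _ ≤ ‖w θ - w θ₀‖ + ‖w θ₀‖ := norm_add_le _ _
      _ ≤ 3 := by rw [h0]; linarith
  have hftc : ∫ θ in θ₀..θ₂, w' θ = w θ₂ - w θ₀ :=
    intervalIntegral.integral_eq_sub_of_hasDerivAt (fun θ _ => hw θ)
      (hw'.intervalIntegrable _ _)
  have hle : ENNReal.ofReal ‖w θ₂ - w θ₀‖ ≤ ∫⁻ θ in Set.Ioo (-Real.pi) Real.pi,
      ENNReal.ofReal (if ‖w θ‖ ≤ 3 then ‖w' θ‖ else 0) := by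
    rw [← hftc, intervalIntegral.norm_intervalIntegral_eq, ofReal_norm]
    refine (enorm_integral_le_lintegral_enorm _).trans ?_
    calc ∫⁻ θ in Set.uIoc θ₀ θ₂, ‖w' θ‖ₑ
        ≤ ∫⁻ θ in Set.uIoc θ₀ θ₂, ENNReal.ofReal (if ‖w θ‖ ≤ 3 then ‖w' θ‖ else 0) := by
          apply lintegral_mono_ae
          rw [ae_restrict_iff' measurableSet_uIoc]
          have hne : ∀ᵐ θ : ℝ, θ ≠ θ₂ := by
            rw [ae_iff]; simp
          filter_upwards [hne] with θ h1 h2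
          rw [if_pos (hclose θ h2 h1), ofReal_norm]
      _ ≤ ∫⁻ θ in Set.Icc (-Real.pi) Real.pi,
            ENNReal.ofReal (if ‖w θ‖ ≤ 3 then ‖w' θ‖ else 0) := lintegral_mono_set hsub
      _ = _ := by rw [restrict_Ioo_eq_restrict_Icc]
  have := (ENNReal.ofReal_le_ofReal hθ₂ε).trans hle
  exact absurd hlen (not_lt.2 this)

lemma exists_angle {r : ℝ} {z : ℂ} (hz : ‖z‖ = r) :
    ∃ θ ∈ Set.Icc (-Real.pi) Real.pi, (r : ℂ) * Complex.exp (θ * Complex.I) = z := by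
  refine ⟨z.arg, ⟨(Complex.neg_pi_lt_arg z).le, Complex.arg_le_pi z⟩, ?_⟩
  rw [← hz]
  exact Complex.norm_mul_exp_arg_mul_I z

/-- A nonvanishing holomorphic function on a disc that takes every value at most `p` times is almost
constant on a concentric disc of comparable radius. -/
theorem exists_almost_constant (p : ℕ) (ε : ℝ) (hε : 0 < ε) :
    ∃ α : ℝ, 0 < α ∧ α < 1 / 2 ∧ ∀ (c : ℂ) (R : ℝ) (u : ℂ → ℂ), 0 < R →
      DifferentiableOn ℂ u (Metric.ball c R) → (∀ z ∈ Metric.ball c R, u z ≠ 0) →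
      (∀ b : ℂ, ∀ T : Finset ℂ, (∀ z ∈ T, z ∈ Metric.ball c R ∧ u z = b) → T.card ≤ p) →
      ∀ z, ‖z - c‖ ≤ α * R → ‖u z - u c‖ ≤ ε * ‖u c‖ := by
  set ε' := min (ε / 2) (1 / 2) with hε'
  have hε'0 : 0 < ε' := by positivity
  have hε'1 : ε' < 1 := (min_le_right _ _).trans_lt (by norm_num)
  obtain ⟨α, hα0, hα1, hα⟩ := exists_circle_small_length ε' (p * (9 * Real.pi)) hε'0
  refine ⟨α, hα0, hα1, ?_⟩
  -- reduction to the unit disc and to the value one at the centre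
  suffices H : ∀ u : ℂ → ℂ, DifferentiableOn ℂ u (Metric.ball 0 1) →
      (∀ z ∈ Metric.ball (0 : ℂ) 1, u z ≠ 0) → u 0 = 1 →
      (∀ b : ℂ, ∀ T : Finset ℂ, (∀ z ∈ T, z ∈ Metric.ball (0 : ℂ) 1 ∧ u z = b) → T.card ≤ p) →
      ∀ z, ‖z‖ ≤ α → ‖u z - 1‖ ≤ ε by
    intro c R u hR hu hu0 hup z hz
    have hc0 : u c ≠ 0 := hu0 c (Metric.mem_ball_self hR)
    have hmem : ∀ z ∈ Metric.ball (0 : ℂ) 1, c + R * z ∈ Metric.ball c R := by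
      intro z hz
      rw [mem_ball_iff_norm] at hz ⊢
      rw [add_sub_cancel_left, norm_mul, Complex.norm_real, Real.norm_of_nonneg hR.le]
      rw [sub_zero] at hz
      nlinarith
    have := H (fun z => u (c + R * z) / u c) ?_ ?_ ?_ ?_ ((z - c) / R) ?_
    · have hR' : (R : ℂ) ≠ 0 := by exact_mod_cast hR.ne'
      rw [mul_div_cancel₀ _ hR', add_sub_cancel, div_sub_one hc0, norm_div,
        div_le_iff₀ (norm_pos_iff.2 hc0)] at this
      exact this
    · apply DifferentiableOn.div_const
      exact hu.comp (by fun_prop) hmem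
    · intro z hz
      exact div_ne_zero (hu0 _ (hmem z hz)) hc0
    · simp [hc0]
    · intro b T hT
      have hinj : Function.Injective fun z : ℂ => c + R * z := by
        intro x y hxy
        have hR' : (R : ℂ) ≠ 0 := by exact_mod_cast hR.ne'
        simpa [hR'] using hxy
      rw [← Finset.card_image_of_injective T hinj]
      apply hup (b * u c)
      intro w hw
      obtain ⟨z, hz, rfl⟩ := Finset.mem_image.1 hw
      refine ⟨hmem z (hT z hz).1, ?_⟩
      rw [← (hT z hz).2, div_mul_cancel₀ _ hc0]
    · rw [norm_div, Complex.norm_real, Real.norm_of_nonneg hR.le, div_le_iff₀ hR]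
      exact hz
  intro u hu hu0 hu1 hup
  have hopen : IsOpen (Metric.ball (0 : ℂ) 1) := Metric.isOpen_ball
  set S : Set ℂ := Metric.ball (0 : ℂ) 1 ∩ u ⁻¹' Metric.closedBall 0 3 with hS
  have hSm : MeasurableSet S := by
    have : S = Metric.ball (0 : ℂ) 1 \ (Metric.ball (0 : ℂ) 1 ∩ u ⁻¹' (Metric.closedBall 0 3)ᶜ) := by
      ext z; simp [hS]
    rw [this]
    exact hopen.measurableSet.diff
      (hu.continuousOn.isOpen_inter_preimage hopen Metric.isClosed_closedBall.isOpen_compl).measurableSet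
  have harea := lintegral_norm_deriv_sq_le hopen hu hSm Set.inter_subset_left p hup
    (R := 3) (fun z hz => by simpa using hz.2)
  set v : ℂ → ℝ := S.indicator fun z => ‖deriv u z‖ with hv
  have hvm : Measurable v := (measurable_deriv u).norm.indicator hSm
  have hv0 : ∀ z, 0 ≤ v z := fun z => Set.indicator_nonneg (fun _ _ => norm_nonneg _) z
  have hvint : ∫⁻ z, ENNReal.ofReal (v z ^ 2) ≤ ENNReal.ofReal (p * (9 * Real.pi)) := by
    have h1 : ∀ z, ENNReal.ofReal (v z ^ 2)
        = S.indicator (fun z => ENNReal.ofReal (‖deriv u z‖ ^ 2)) z := by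
      intro z
      by_cases hz : z ∈ S <;> simp [hv, hz]
    simp_rw [h1]
    rw [MeasureTheory.lintegral_indicator hSm]
    refine harea.trans (le_of_eq ?_)
    rw [Complex.volume_closedBall, ENNReal.ofReal_mul (by positivity), ENNReal.ofReal_natCast,
      ENNReal.ofReal_mul (by positivity), ← ENNReal.ofReal_pow (by norm_num)]
    norm_num
    congr 2
    rw [← ENNReal.ofReal_coe_nnreal]; rfl
  obtain ⟨r, hr1, hr2, hr⟩ := hα v hvm hv0 hvint
  have hr0 : 0 < r := hα0.trans hr1
  have hcb : Metric.closedBall (0 : ℂ) r ⊆ Metric.ball 0 1 :=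
    Metric.closedBall_subset_ball (by linarith)
  have hγ : ∀ θ : ℝ, (r : ℂ) * Complex.exp (θ * Complex.I) ∈ Metric.sphere (0 : ℂ) r := by
    intro θ
    simp [Complex.norm_exp_ofReal_mul_I, abs_of_pos hr0]
  have hγb : ∀ θ : ℝ, (r : ℂ) * Complex.exp (θ * Complex.I) ∈ Metric.ball (0 : ℂ) 1 :=
    fun θ => hcb (Metric.sphere_subset_closedBall (hγ θ))
  set w : ℝ → ℂ := fun θ => u (r * Complex.exp (θ * Complex.I)) with hw
  set w' : ℝ → ℂ := fun θ => deriv u (r * Complex.exp (θ * Complex.I)) *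
    (r * (Complex.exp (θ * Complex.I) * Complex.I)) with hw'
  have hwd : ∀ θ, HasDerivAt w (w' θ) θ := by
    intro θ
    have h1 : HasDerivAt u (deriv u (r * Complex.exp (θ * Complex.I)))
        (r * Complex.exp (θ * Complex.I)) :=
      (hu.differentiableAt (hopen.mem_nhds (hγb θ))).hasDerivAt
    have h2 : HasDerivAt (fun θ : ℝ => (r : ℂ) * Complex.exp (θ * Complex.I))
        (r * (Complex.exp (θ * Complex.I) * Complex.I)) θ := by
      have h3 : HasDerivAt (fun θ : ℝ => (θ : ℂ) * Complex.I) Complex.I θ := by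
        simpa using (Complex.ofRealCLM.hasDerivAt (x := θ)).mul_const Complex.I
      exact (h3.cexp).const_mul _
    exact h1.comp θ h2
  have hwc : Continuous w := continuous_iff_continuousAt.2 fun θ => (hwd θ).continuousAt
  have hwc' : Continuous w' := by
    apply Continuous.mul
    · exact (hu.deriv hopen).continuousOn.comp_continuous (by fun_prop) hγb
    · fun_prop
  have hdcl : DiffContOnCl ℂ u (Metric.ball 0 r) :=
    hu.diffContOnCl_ball hcb
  have hfr : frontier (Metric.ball (0 : ℂ) r) = Metric.sphere 0 r := frontier_ball 0 hr0.ne'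
  have hcl : closure (Metric.ball (0 : ℂ) r) = Metric.closedBall 0 r := closure_ball 0 hr0.ne'
  obtain ⟨za, hza, hzamax⟩ := Complex.exists_mem_frontier_isMaxOn_norm
    (Metric.isBounded_ball) ⟨0, Metric.mem_ball_self hr0⟩ hdcl
  obtain ⟨zb, hzb, hzbmax⟩ := Complex.exists_mem_frontier_isMaxOn_norm (f := fun z => (u z)⁻¹)
    (Metric.isBounded_ball) ⟨0, Metric.mem_ball_self hr0⟩
    (hdcl.inv fun z hz => hu0 z (hcb (hcl ▸ hz)))
  have h0mem : (0 : ℂ) ∈ closure (Metric.ball (0 : ℂ) r) :=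
    subset_closure (Metric.mem_ball_self hr0)
  have ha1 : 1 ≤ ‖u za‖ := by simpa [hu1] using hzamax h0mem
  have hb1 : ‖u zb‖ ≤ 1 := by
    have := hzbmax h0mem
    have hzb0 : 0 < ‖u zb‖ := by
      rw [norm_pos_iff]
      exact hu0 zb (hcb (hcl ▸ frontier_subset_closure hzb))
    simp [hu1] at this
    exact (one_le_inv₀ hzb0).1 this
  rw [hfr, mem_sphere_zero_iff_norm] at hza hzb
  obtain ⟨θa, hθa, hγa⟩ := exists_angle hza
  obtain ⟨θb, hθb, hγb'⟩ := exists_angle hzb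
  obtain ⟨θ₀, hθ₀, hθ₀1⟩ : ∃ θ₀ ∈ Set.uIcc θb θa, ‖w θ₀‖ = 1 := by
    have := intermediate_value_uIcc (a := θb) (b := θa) (f := fun θ => ‖w θ‖)
      hwc.norm.continuousOn
    have h1 : (1 : ℝ) ∈ Set.uIcc ‖w θb‖ ‖w θa‖ := by
      have e1 : w θb = u zb := by simp only [hw, hγb']
      have e2 : w θa = u za := by simp only [hw, hγa]
      rw [e1, e2, Set.uIcc_of_le (hb1.trans ha1)]
      exact ⟨hb1, ha1⟩
    obtain ⟨θ₀, h2, h3⟩ := this h1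
    exact ⟨θ₀, h2, h3⟩
  have hθ₀' : θ₀ ∈ Set.Icc (-Real.pi) Real.pi := Set.uIcc_subset_Icc hθb hθa hθ₀
  have hshort := norm_sub_le_of_short hwd hwc' hε'0 hε'1 hθ₀1 hθ₀' (by
    refine lt_of_le_of_lt (le_of_eq ?_) hr
    refine MeasureTheory.lintegral_congr fun θ => ?_
    congr 1
    have hnorm : ‖w' θ‖ = r * ‖deriv u (r * Complex.exp (θ * Complex.I))‖ := by
      simp [hw', abs_of_pos hr0, mul_comm]
    by_cases h : ‖w θ‖ ≤ 3
    · have hm : (r : ℂ) * Complex.exp (θ * Complex.I) ∈ S := ⟨hγb θ, by simpa [hw] using h⟩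
      rw [if_pos h, hv, Set.indicator_of_mem hm, hnorm]
    · have hm : (r : ℂ) * Complex.exp (θ * Complex.I) ∉ S := fun hm => h (by simpa [hw] using hm.2)
      rw [if_neg h, hv, Set.indicator_of_notMem hm, mul_zero])
  have hball : ∀ z ∈ Metric.closedBall (0 : ℂ) r, ‖u z - w θ₀‖ ≤ ε' := by
    intro z hz
    refine Complex.norm_le_of_forall_mem_frontier_norm_le (f := fun z => u z - w θ₀)
      Metric.isBounded_ball (hdcl.sub_const _) ?_ (hcl ▸ hz)
    intro z hz
    rw [hfr, mem_sphere_zero_iff_norm] at hz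
    obtain ⟨θ, hθ, rfl⟩ := exists_angle hz
    exact hshort θ hθ
  intro z hz
  have h1 := hball z (by rw [mem_closedBall_zero_iff]; linarith)
  have h2 := hball 0 (by rw [mem_closedBall_zero_iff]; simp; linarith)
  rw [hu1] at h2
  calc ‖u z - 1‖ = ‖(u z - w θ₀) - (1 - w θ₀)‖ := by ring_nf
    _ ≤ ‖u z - w θ₀‖ + ‖1 - w θ₀‖ := norm_sub_le _ _
    _ ≤ ε' + ε' := add_le_add h1 h2
    _ ≤ ε := by have := min_le_left (ε / 2) (1 / 2); linarith

/-- The number of points of `A` in a disc with a smaller open disc removed. -/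
def ringCount (A : Finset ℂ) (u w : ℂ) (r η : ℝ) : ℕ :=
  (A.filter fun x => ‖x - u‖ ≤ r ∧ η ≤ ‖x - w‖).card

/-- Two points are `τ`-near with respect to `A` if they lie well inside a disc with a hole which
contains at most `τ` points of `A`. -/
def RingNear (A : Finset ℂ) (τ : ℝ) (a b : ℂ) : Prop :=
  ∃ (u w : ℂ) (ρ η : ℝ), 0 ≤ η ∧ ‖a - u‖ ≤ ρ ∧ ‖b - u‖ ≤ ρ ∧ 3 * η ≤ ‖a - w‖ ∧ 3 * η ≤ ‖b - w‖ ∧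
    (ringCount A u w (7 * ρ) η : ℝ) ≤ τ

lemma norm_sub_comm_le {a b c : ℂ} {r s : ℝ} (h : ‖a - b‖ ≤ r) (h' : ‖b - c‖ ≤ s) :
    ‖a - c‖ ≤ r + s :=
  (norm_sub_le_norm_sub_add_norm_sub a b c).trans (add_le_add h h')

/-- A point has few near points. -/
theorem card_ringNear_le (A : Finset ℂ) {τ : ℝ} (hτ : 0 ≤ τ) (a : ℂ) :
    ((A.filter fun b => RingNear A τ a b).card : ℝ) ≤ 3 * τ := by
  set S := A.filter fun b => RingNear A τ a b with hS
  rcases S.eq_empty_or_nonempty with hS0 | hSn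
  · rw [hS0]; simpa using hτ
  have hnear : ∀ b : ℂ, b ∈ S → ∃ (w : ℂ) (η : ℝ), 0 ≤ η ∧ 3 * η ≤ ‖a - w‖ ∧ 3 * η ≤ ‖b - w‖ ∧
      ∀ T ⊆ S, (∀ x ∈ T, ‖x - a‖ ≤ 3 * ‖b - a‖) →
        ((T.filter fun x => η ≤ ‖x - w‖).card : ℝ) ≤ τ := by
    intro b hb
    obtain ⟨u, w, ρ, η, hη, h1, h2, h3, h4, h5⟩ := (Finset.mem_filter.1 hb).2
    refine ⟨w, η, hη, h3, h4, fun T hT hTa => le_trans ?_ h5⟩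
    rw [ringCount]
    norm_cast
    apply Finset.card_le_card
    intro x hx
    rw [Finset.mem_filter] at hx ⊢
    refine ⟨(Finset.mem_filter.1 (hT hx.1)).1, ?_, hx.2⟩
    have h6 : ‖b - a‖ ≤ ρ + ρ := norm_sub_comm_le h2 (by rwa [norm_sub_rev])
    have h7 := norm_sub_comm_le (hTa x hx.1) h1
    linarith
  choose! w η hη h3 h4 h5 using hnear
  obtain ⟨a₁, ha₁, hmax⟩ := S.exists_max_image (fun b => ‖b - a‖) hSn
  set S₁ := S.filter fun x => ¬ η a₁ ≤ ‖x - w a₁‖ with hS₁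
  have hsplit : (S.card : ℝ) = (S.filter fun x => η a₁ ≤ ‖x - w a₁‖).card + S₁.card := by
    rw [hS₁]; norm_cast; rw [Finset.card_filter_add_card_filter_not]
  have hout := h5 a₁ ha₁ S subset_rfl fun x hx => by
    have := hmax x hx
    linarith [norm_nonneg (a₁ - a)]
  suffices h : (S₁.card : ℝ) ≤ 2 * τ by linarith
  rcases S₁.eq_empty_or_nonempty with hS0 | hSn₁
  · rw [hS0]; simpa using hτ
  have hS₁S : S₁ ⊆ S := Finset.filter_subset _ _
  have hS₁c : ∀ b ∈ S₁, ∀ x ∈ S₁, ‖x - a‖ ≤ 3 * ‖b - a‖ := by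
    intro b hb x hx
    have hb' := (Finset.mem_filter.1 hb).2
    have hx' := (Finset.mem_filter.1 hx).2
    push Not at hb' hx'
    have e0 := hη a₁ ha₁
    have e1 := h3 a₁ ha₁
    have e2 : ‖x - a‖ ≤ η a₁ + ‖a - w a₁‖ :=
      norm_sub_comm_le hx'.le (by rw [norm_sub_rev])
    have e3 : ‖a - w a₁‖ ≤ ‖b - a‖ + η a₁ :=
      norm_sub_comm_le (by rw [norm_sub_rev]) hb'.le
    linarith
  obtain ⟨a₂, ha₂, hmin⟩ := S₁.exists_min_image η hSn₁
  have hsplit₁ : (S₁.card : ℝ) = (S₁.filter fun x => η a₂ ≤ ‖x - w a₂‖).card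
      + (S₁.filter fun x => ¬ η a₂ ≤ ‖x - w a₂‖).card := by
    norm_cast; rw [Finset.card_filter_add_card_filter_not]
  have hout₁ := h5 a₂ (hS₁S ha₂) S₁ hS₁S (hS₁c a₂ ha₂)
  rcases (S₁.filter fun x => ¬ η a₂ ≤ ‖x - w a₂‖).eq_empty_or_nonempty with hS2 | ⟨b, hb⟩
  · rw [hsplit₁, hS2]; simp; linarith
  obtain ⟨hb1, hb2⟩ := Finset.mem_filter.1 hb
  push Not at hb2
  have hin : ((S₁.filter fun x => ¬ η a₂ ≤ ‖x - w a₂‖).card : ℝ) ≤ τ := by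
    refine le_trans ?_ (h5 b (hS₁S hb1) S₁ hS₁S (hS₁c b hb1))
    norm_cast
    apply Finset.card_le_card
    intro x hx
    rw [Finset.mem_filter] at hx ⊢
    refine ⟨hx.1, ?_⟩
    have hx2 := hx.2
    push Not at hx2
    have e1 := hmin b hb1
    have e2 := h4 b (hS₁S hb1)
    have e3 : ‖b - x‖ ≤ η a₂ + η a₂ := norm_sub_comm_le hb2.le (by rw [norm_sub_rev]; exact hx2.le)
    have e4 : ‖b - w b‖ ≤ _ := norm_sub_comm_le e3 le_rfl
    linarith
  linarith

/-- Separated points in a disc: the packing bound. -/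
lemma exists_packing_bound (K : ℝ) : ∃ N : ℕ, 0 < N ∧ ∀ (r : ℝ) (c : ℂ) (T : Finset ℂ), 0 < r →
    (∀ x ∈ T, ‖x - c‖ ≤ K * r) → (∀ x ∈ T, ∀ y ∈ T, x ≠ y → r ≤ ‖x - y‖) → T.card ≤ N := by
  refine ⟨((Finset.Icc ⌊-(2 * K)⌋ ⌊2 * K⌋) ×ˢ (Finset.Icc ⌊-(2 * K)⌋ ⌊2 * K⌋)).card + 1,
    Nat.succ_pos _, ?_⟩
  intro r c T hr hT hsep
  refine le_trans ?_ (Nat.le_succ _)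
  apply Finset.card_le_card_of_injOn
    (fun x : ℂ => (⌊2 * ((x - c).re / r)⌋, ⌊2 * ((x - c).im / r)⌋))
  · intro x hx
    have h1 := (Complex.abs_re_le_norm (x - c)).trans (hT x hx)
    have h2 := (Complex.abs_im_le_norm (x - c)).trans (hT x hx)
    rw [← div_le_iff₀ hr, ← abs_of_pos hr, ← abs_div, abs_le] at h1 h2
    simp only [Finset.coe_product, Finset.coe_Icc, Set.mem_prod, Set.mem_Icc]
    refine ⟨⟨?_, ?_⟩, ?_, ?_⟩ <;> apply Int.floor_le_floor <;> linarith
  · intro x hx y hy hxy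
    by_contra hne
    have := hsep x hx y hy hne
    simp only [Prod.mk.injEq] at hxy
    have h1 := Int.abs_sub_lt_one_of_floor_eq_floor hxy.1
    have h2 := Int.abs_sub_lt_one_of_floor_eq_floor hxy.2
    have e1 : 2 * ((x - c).re / r) - 2 * ((y - c).re / r) = 2 * (x - y).re / r := by
      simp; field_simp; ring
    have e2 : 2 * ((x - c).im / r) - 2 * ((y - c).im / r) = 2 * (x - y).im / r := by
      simp; field_simp; ring
    rw [e1, abs_div, abs_of_pos hr, div_lt_one hr, abs_mul, abs_two] at h1
    rw [e2, abs_div, abs_of_pos hr, div_lt_one hr, abs_mul, abs_two] at h2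
    have := Complex.norm_le_abs_re_add_abs_im (x - y)
    linarith

/-- Repeatedly taking a closest pair and removing the points around it. -/
lemma exists_greedy_pairs : ∃ N : ℕ, ∀ P : Finset ℂ, ∃ l : List (ℂ × ℂ),
    (∀ a ∈ l, a.1 ∈ P ∧ a.2 ∈ P ∧ a.1 ≠ a.2) ∧
    l.Pairwise (fun a b => ‖a.1 - a.2‖ ≤ ‖b.1 - b.2‖ ∧ 200 * ‖a.1 - a.2‖ < ‖b.1 - a.1‖ ∧
      200 * ‖a.1 - a.2‖ < ‖b.2 - a.1‖) ∧ P.card ≤ N * l.length + 1 := by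
  obtain ⟨N, hN, hpack⟩ := exists_packing_bound 200
  refine ⟨N, fun P => ?_⟩
  induction P using Finset.strongInduction with
  | H P ih =>
    by_cases hP : P.card ≤ 1
    · exact ⟨[], by simp, by simp, by simpa using hP⟩
    push Not at hP
    obtain ⟨x, hx, y, hy, hxy⟩ := Finset.one_lt_card.1 hP
    have hoff : P.offDiag.Nonempty := ⟨(x, y), by simp [hx, hy, hxy]⟩
    obtain ⟨⟨p, q⟩, hpq, hmin⟩ := P.offDiag.exists_min_image (fun a => ‖a.1 - a.2‖) hoff
    simp only [Finset.mem_offDiag] at hpq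
    obtain ⟨hp, hq, hne⟩ := hpq
    have hr : 0 < ‖p - q‖ := norm_pos_iff.2 (sub_ne_zero.2 hne)
    set P' := P.filter fun z => ¬ ‖z - p‖ ≤ 200 * ‖p - q‖ with hP'
    have hlt : P' ⊂ P := by
      refine Finset.filter_ssubset.2 ⟨p, hp, ?_⟩
      simp
    obtain ⟨l, hl1, hl2, hl3⟩ := ih P' hlt
    have hsep : ∀ x ∈ P, ∀ y ∈ P, x ≠ y → ‖p - q‖ ≤ ‖x - y‖ := fun x hx y hy hxy =>
      hmin (x, y) (by simp [hx, hy, hxy])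
    refine ⟨(p, q) :: l, ?_, ?_, ?_⟩
    · intro a ha
      rcases List.mem_cons.1 ha with rfl | ha
      · exact ⟨hp, hq, hne⟩
      · exact ⟨hlt.1 (hl1 a ha).1, hlt.1 (hl1 a ha).2.1, (hl1 a ha).2.2⟩
    · rw [List.pairwise_cons]
      refine ⟨fun b hb => ?_, hl2⟩
      obtain ⟨h1, h2, h3⟩ := hl1 b hb
      exact ⟨hsep _ (hlt.1 h1) _ (hlt.1 h2) h3, not_le.1 (Finset.mem_filter.1 h1).2,
        not_le.1 (Finset.mem_filter.1 h2).2⟩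
    · have h1 : (P.filter fun z => ‖z - p‖ ≤ 200 * ‖p - q‖).card ≤ N := by
        apply hpack _ p _ hr
        · intro x hx; exact (Finset.mem_filter.1 hx).2
        · intro x hx y hy hxy
          exact hsep x (Finset.mem_filter.1 hx).1 y (Finset.mem_filter.1 hy).1 hxy
      have h2 := Finset.card_filter_add_card_filter_not (s := P)
        (fun z => ‖z - p‖ ≤ 200 * ‖p - q‖)
      rw [← hP'] at h2
      rw [List.length_cons, mul_add, mul_one]
      omega

/-- Among the points of a finite planar set one can choose a positive proportion of disjoint pairs,
each in a disc with a hole, with pairwise disjoint discs with holes. -/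
theorem exists_forest_pairs : ∃ N : ℕ, ∀ P : Finset ℂ, 2 ≤ P.card →
    ∃ (n : ℕ) (J : Finset (Fin n)) (p q w : Fin n → ℂ) (η : Fin n → ℝ), P.card ≤ N * J.card ∧
      (∀ j ∈ J, p j ∈ P ∧ q j ∈ P ∧ p j ≠ q j ∧ 0 ≤ η j ∧ 4 * η j ≤ ‖p j - w j‖ ∧
        4 * η j ≤ ‖q j - w j‖ ∧ w j ∈ P ∧ η j ≤ 2 * ‖p j - q j‖) ∧
      ∀ i ∈ J, ∀ j ∈ J, i ≠ j → ∀ x : ℂ, ¬ (‖x - p i‖ ≤ 8 * ‖p i - q i‖ ∧ η i / 2 ≤ ‖x - w i‖ ∧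
        ‖x - p j‖ ≤ 8 * ‖p j - q j‖ ∧ η j / 2 ≤ ‖x - w j‖) := by
  obtain ⟨N, hN⟩ := exists_greedy_pairs
  refine ⟨4 * N, fun P hP => ?_⟩
  obtain ⟨l, hl1, hl2, hl3⟩ := hN P
  set n := l.length with hn
  set p : Fin n → ℂ := fun i => (l.get i).1 with hp
  set q : Fin n → ℂ := fun i => (l.get i).2 with hq
  set ρ : Fin n → ℝ := fun i => ‖p i - q i‖ with hρ
  have hmem : ∀ i, p i ∈ P ∧ q i ∈ P ∧ p i ≠ q i := fun i => hl1 _ (List.get_mem l i)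
  have hρ0 : ∀ i, 0 < ρ i := fun i => norm_pos_iff.2 (sub_ne_zero.2 (hmem i).2.2)
  have hpair : ∀ i j : Fin n, i < j →
      ρ i ≤ ρ j ∧ 200 * ρ i < ‖p j - p i‖ ∧ 200 * ρ i < ‖q j - p i‖ :=
    fun i j hij => List.pairwise_iff_get.1 hl2 i j hij
  -- the parent of a node
  set C : Fin n → Finset (Fin n) := fun i => Finset.univ.filter fun j => i < j ∧ ‖p i - p j‖ ≤ 10 * ρ j
    with hC
  set par : Fin n → Fin n → Prop := fun i j => j ∈ C i ∧ ∀ k ∈ C i, j ≤ k with hpar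
  have hparlt : ∀ i j, par i j → i < j ∧ ‖p i - p j‖ ≤ 10 * ρ j ∧ 20 * ρ i < ρ j := by
    intro i j h
    have h1 := (Finset.mem_filter.1 h.1).2
    refine ⟨h1.1, h1.2, ?_⟩
    have := (hpair i j h1.1).2.1
    rw [norm_sub_rev] at this
    linarith
  have hparuniq : ∀ i j k, par i j → par i k → j = k := fun i j k h1 h2 =>
    le_antisymm (h1.2 k h2.1) (h2.2 j h1.1)
  have hdesc : ∀ i j, Relation.ReflTransGen par i j → ‖p i - p j‖ ≤ 11 * ρ j ∧ ρ i ≤ ρ j := by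
    intro i j h
    induction h with
    | refl => simpa using (hρ0 i).le
    | @tail b c _ h2 ih =>
      have h6 := hρ0 b
      obtain ⟨-, h4, h5⟩ := hparlt _ _ h2
      refine ⟨(norm_sub_comm_le ih.1 h4).trans ?_, ?_⟩
      · linarith
      · linarith [ih.2]
  -- overlapping discs belong to nodes related in the tree
  have hanc : ∀ i j, i < j → ‖p i - p j‖ ≤ 8 * ρ i + 8 * ρ j → Relation.ReflTransGen par i j := by
    intro i j hij hclose
    have h1 := (hpair i j hij).2.1
    rw [norm_sub_rev] at h1
    have key : ∀ m : ℕ, ∀ k : Fin n, k ≤ j → (j : ℕ) - k = m → Relation.ReflTransGen par i k →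
        Relation.ReflTransGen par i j := by
      intro m
      induction m using Nat.strong_induction_on with
      | _ m ih =>
        intro k hkj hm hik
        rcases eq_or_lt_of_le hkj with rfl | hlt
        · exact hik
        have h2 := (hpair k j hlt).2.1
        obtain ⟨h3, h3'⟩ := hdesc i k hik
        rw [norm_sub_rev] at h3
        have h4 := norm_sub_comm_le h3 hclose
        rw [norm_sub_rev] at h2
        have h5 : j ∈ C k := Finset.mem_filter.2 ⟨Finset.mem_univ _, hlt, by
          linarith [hρ0 j, hρ0 k]⟩
        set m' := (C k).min' ⟨j, h5⟩ with hm'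
        have h6 : par k m' := ⟨Finset.min'_mem _ _, fun k' hk' => Finset.min'_le _ _ hk'⟩
        have h7 : m' ≤ j := Finset.min'_le _ _ h5
        have h8 := (hparlt k m' h6).1
        refine ih ((j : ℕ) - m') ?_ m' h7 rfl (hik.tail h6)
        have h9 : (k : ℕ) < m' := h8
        have h10 : (m' : ℕ) ≤ j := h7
        omega
    exact key _ i hij.le rfl Relation.ReflTransGen.refl
  set ch : Fin n → Finset (Fin n) := fun j => Finset.univ.filter fun i => par i j with hch
  set J : Finset (Fin n) := Finset.univ.filter fun j => (ch j).card ≤ 1 with hJ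
  have hcount : n ≤ 2 * J.card := by
    have h1 : ∑ j, (ch j).card ≤ n := by
      have : ∑ j, (ch j).card = ((Finset.univ : Finset (Fin n)).biUnion ch).card := by
        rw [Finset.card_biUnion]
        intro j _ k _ hjk
        refine Finset.disjoint_left.2 fun i hi hi' => ?_
        exact hjk (hparuniq i j k (Finset.mem_filter.1 hi).2 (Finset.mem_filter.1 hi').2)
      rw [this]
      exact (Finset.card_le_univ _).trans (by simp)
    have h2 : 2 * (Finset.univ.filter fun j => ¬ (ch j).card ≤ 1).card ≤ ∑ j, (ch j).card := by
      calc _ = ∑ j ∈ Finset.univ.filter fun j => ¬ (ch j).card ≤ 1, 2 := by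
            rw [Finset.sum_const, smul_eq_mul, mul_comm]
        _ ≤ ∑ j ∈ Finset.univ.filter fun j => ¬ (ch j).card ≤ 1, (ch j).card := by
            apply Finset.sum_le_sum
            intro j hj
            have := (Finset.mem_filter.1 hj).2
            omega
        _ ≤ _ := Finset.sum_le_sum_of_subset (Finset.filter_subset _ _)
    have h3 := Finset.card_filter_add_card_filter_not (s := (Finset.univ : Finset (Fin n)))
      (fun j => (ch j).card ≤ 1)
    rw [Finset.card_univ, Fintype.card_fin] at h3
    have : J.card = (Finset.univ.filter fun j => (ch j).card ≤ 1).card := rfl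
    omega
  have hhole : ∀ j, ∃ (w : ℂ) (η : ℝ), w ∈ P ∧ 0 ≤ η ∧ 4 * η ≤ ‖p j - w‖ ∧ 4 * η ≤ ‖q j - w‖ ∧
      η ≤ 2 * ρ j ∧ (j ∈ J → ∀ c, par c j → w = p c ∧ η = 40 * ρ c) := by
    intro j
    by_cases hc : ∃ c, par c j
    · obtain ⟨c, hc⟩ := hc
      obtain ⟨h1, h2, h3⟩ := hparlt c j hc
      have h4 := hpair c j h1
      have h5 := hρ0 c
      refine ⟨p c, 40 * ρ c, (hmem c).1, by linarith, by linarith [h4.2.1], by linarith [h4.2.2],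
        by linarith, fun hj c' hc' => ?_⟩
      have := Finset.card_le_one.1 (Finset.mem_filter.1 hj).2 c
        (Finset.mem_filter.2 ⟨Finset.mem_univ _, hc⟩) c'
        (Finset.mem_filter.2 ⟨Finset.mem_univ _, hc'⟩)
      rw [this]
      exact ⟨rfl, rfl⟩
    · push Not at hc
      exact ⟨p j, 0, (hmem j).1, le_rfl, by simp, by simp, by linarith [hρ0 j],
        fun _ c hc' => absurd hc' (hc c)⟩
  choose w η hwP hη0 hpη hqη hηρ hhole using hhole
  refine ⟨n, J, p, q, w, η, ?_, fun j _ => ⟨(hmem j).1, (hmem j).2.1, (hmem j).2.2, hη0 j, hpη j,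
    hqη j, hwP j, hηρ j⟩, ?_⟩
  · have : N * n ≤ N * (2 * J.card) := Nat.mul_le_mul_left _ hcount
    nlinarith
  have hdisj : ∀ i ∈ J, ∀ j ∈ J, i < j → ∀ x : ℂ, ¬ (‖x - p i‖ ≤ 8 * ρ i ∧
      ‖x - p j‖ ≤ 8 * ρ j ∧ η j / 2 ≤ ‖x - w j‖) := by
    rintro i hi j hj hij x ⟨h1, h2, h3⟩
    rw [norm_sub_rev] at h1
    have h4 := hanc i j hij (norm_sub_comm_le h1 h2)
    rcases Relation.ReflTransGen.cases_tail h4 with h5 | ⟨c, hic, hcj⟩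
    · exact hij.ne' h5
    obtain ⟨e1, e2⟩ := hhole j hj c hcj
    obtain ⟨e3, e4⟩ := hdesc i c hic
    rw [norm_sub_rev] at h1
    have e5 := norm_sub_comm_le h1 e3
    rw [e1, e2] at h3
    have := hρ0 c
    linarith
  intro i hi j hj hij x ⟨h1, h2, h3, h4⟩
  rcases lt_or_gt_of_ne hij with h | h
  · exact hdisj i hi j hj h x ⟨h1, h3, h4⟩
  · exact hdisj j hj i hi h x ⟨h3, h1, h2⟩

lemma hasStrictFDerivAt_mvPolynomial {n : ℕ} (f : MvPolynomial (Fin n) ℂ) (v : Fin n → ℂ) :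
    HasStrictFDerivAt (fun v : Fin n → ℂ => eval v f)
      (∑ i, eval v (pderiv i f) • (ContinuousLinearMap.proj i : (Fin n → ℂ) →L[ℂ] ℂ)) v := by
  induction f using MvPolynomial.induction_on with
  | C a =>
    convert! hasStrictFDerivAt_const (𝕜 := ℂ) a v using 1
    · ext v; simp
    · ext w; simp
  | add p q hp hq =>
    convert! hp.add hq using 1
    · ext v; simp
    · ext w; simp [add_mul, Finset.sum_add_distrib]
  | mul_X p i hp =>
    have h1 : HasStrictFDerivAt (fun v : Fin n → ℂ => v i)
      (ContinuousLinearMap.proj i : (Fin n → ℂ) →L[ℂ] ℂ) v :=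
      (ContinuousLinearMap.proj i : (Fin n → ℂ) →L[ℂ] ℂ).hasStrictFDerivAt
    convert! hp.mul h1 using 1
    · ext v; simp
    · ext w
      simp only [Derivation.leibniz, pderiv_X, smul_eq_mul, map_add, map_mul, eval_X,
        Pi.single_apply, sum_apply, smul_apply,
        ContinuousLinearMap.proj_apply, add_apply, apply_ite (eval v),
        map_zero, mul_ite, mul_one, mul_zero, add_mul, ite_mul, zero_mul, Finset.sum_add_distrib,
        Finset.sum_ite_eq, Finset.mem_univ, if_true, Finset.mul_sum, mul_assoc]

lemma hasDerivAt_eval_curve {n : ℕ} (f : MvPolynomial (Fin n) ℂ) {v : ℂ → Fin n → ℂ}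
    {v' : Fin n → ℂ} {z : ℂ} (hv : ∀ i, HasDerivAt (fun z => v z i) (v' i) z) :
    HasDerivAt (fun z => eval (v z) f) (∑ i, eval (v z) (pderiv i f) * v' i) z := by
  have h1 : HasDerivAt v v' z := hasDerivAt_pi.2 hv
  have h2 := (hasStrictFDerivAt_mvPolynomial f (v z)).hasFDerivAt.comp_hasDerivAt z h1
  convert! h2 using 1
  simp

lemma hasStrictFDerivAt_eval_pair (f : MvPolynomial (Fin 2) ℂ) (u : ℂ × ℂ) :
    HasStrictFDerivAt (fun u : ℂ × ℂ => eval ![u.2, u.1] f)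
      (eval ![u.2, u.1] (pderiv 0 f) • ContinuousLinearMap.snd ℂ ℂ ℂ
        + eval ![u.2, u.1] (pderiv 1 f) • ContinuousLinearMap.fst ℂ ℂ ℂ) u := by
  have h1 : HasStrictFDerivAt (fun u : ℂ × ℂ => ![u.2, u.1])
      (ContinuousLinearMap.pi ![ContinuousLinearMap.snd ℂ ℂ ℂ, ContinuousLinearMap.fst ℂ ℂ ℂ]) u := by
    rw [hasStrictFDerivAt_pi']
    intro i
    fin_cases i
    · exact hasStrictFDerivAt_snd
    · exact hasStrictFDerivAt_fst
  convert! (hasStrictFDerivAt_mvPolynomial f _).comp u h1 using 1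
  ext <;> simp [Fin.sum_univ_two]

/-- Near a point of the curve `f = 0` where `∂f/∂y ≠ 0` the curve is a graph over the `x`-axis. -/
lemma exists_local_graph (f : MvPolynomial (Fin 2) ℂ) {x₀ y₀ : ℂ} (h0 : eval ![y₀, x₀] f = 0)
    (hy : eval ![y₀, x₀] (pderiv 0 f) ≠ 0) :
    ∃ ψ : ℂ → ℂ, ContinuousAt ψ x₀ ∧ DifferentiableAt ℂ ψ x₀ ∧ ψ x₀ = y₀ ∧
      (∀ᶠ u in nhds (x₀, y₀), eval ![u.2, u.1] f = 0 ↔ ψ u.1 = u.2) ∧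
      ∀ᶠ x in nhds x₀, eval ![ψ x, x] f = 0 := by
  have hd := hasStrictFDerivAt_eval_pair f (x₀, y₀)
  simp only at hd
  set L := eval ![y₀, x₀] (pderiv 0 f) • ContinuousLinearMap.snd ℂ ℂ ℂ
        + eval ![y₀, x₀] (pderiv 1 f) • ContinuousLinearMap.fst ℂ ℂ ℂ with hL
  have hinv : (L ∘L .inr ℂ ℂ ℂ).IsInvertible := by
    refine ⟨ContinuousLinearEquiv.unitsEquivAut ℂ (Units.mk0 _ hy), ?_⟩
    ext
    simp [hL]
  refine ⟨hd.implicitFunctionOfProdDomain hinv, ?_, ?_, ?_, ?_, ?_⟩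
  · exact (hd.hasStrictFDerivAt_implicitFunctionOfProdDomain hinv).continuousAt
  · exact (hd.hasStrictFDerivAt_implicitFunctionOfProdDomain hinv).differentiableAt
  · exact (hd.eventually_apply_eq_iff_implicitFunctionOfProdDomain hinv).self_of_nhds.1 rfl
  · simpa [h0] using hd.eventually_apply_eq_iff_implicitFunctionOfProdDomain hinv
  · simpa [h0] using hd.eventually_apply_implicitFunctionOfProdDomain hinv

/-- `S` contains the singular values of the projection of the curve `f = 0` to the `x`-axis, and
the `x`-coordinates of the points where the curve is vertical or has a pole. -/
structure IsSingularBound (f : MvPolynomial (Fin 2) ℂ) (S : Finset ℂ) : Prop where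
  deriv_ne : ∀ x ∉ S, ∀ y, eval ![y, x] f = 0 →
    eval ![y, x] (pderiv 0 f) ≠ 0 ∧ eval ![y, x] (pderiv 1 f) ≠ 0
  lead_ne : ∀ x ∉ S, eval (fun _ => x) (finSuccEquiv ℂ 1 f).leadingCoeff ≠ 0

lemma eval_pair_eq (f : MvPolynomial (Fin 2) ℂ) (x y : ℂ) :
    eval ![y, x] f = Polynomial.eval y (Polynomial.map (eval fun _ => x) (finSuccEquiv ℂ 1 f)) := by
  rw [← eval_finSuccEquiv]
  congr 1
  congr 1
  ext i; fin_cases i <;> rfl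

section Covering

variable {f : MvPolynomial (Fin 2) ℂ} {S : Finset ℂ}

/-- The part of the curve `f = 0` over the complement of `S`, as a space. -/
def CurveOver (f : MvPolynomial (Fin 2) ℂ) (S : Finset ℂ) : Type :=
  {u : {x : ℂ // x ∉ S} × ℂ // eval ![u.2, u.1.1] f = 0}

instance : TopologicalSpace (CurveOver f S) :=
  inferInstanceAs (TopologicalSpace {u : {x : ℂ // x ∉ S} × ℂ // eval ![u.2, u.1.1] f = 0})

instance : T2Space (CurveOver f S) :=
  inferInstanceAs (T2Space {u : {x : ℂ // x ∉ S} × ℂ // eval ![u.2, u.1.1] f = 0})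

/-- The projection of the curve to the `x`-axis. -/
def CurveOver.proj (u : CurveOver f S) : {x : ℂ // x ∉ S} := u.1.1

lemma CurveOver.continuous_proj : Continuous (CurveOver.proj : CurveOver f S → _) :=
  continuous_fst.comp continuous_subtype_val

lemma continuous_eval_pair (f : MvPolynomial (Fin 2) ℂ) :
    Continuous fun u : ℂ × ℂ => eval ![u.2, u.1] f :=
  continuous_iff_continuousAt.2 fun u => (hasStrictFDerivAt_eval_pair f u).continuousAt

lemma IsSingularBound.isClosedMap_proj (hS : IsSingularBound f S) :
    IsClosedMap (CurveOver.proj : CurveOver f S → _) := by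
  have hcl : IsClosed {u : {x : ℂ // x ∉ S} × ℂ | eval ![u.2, u.1.1] f = 0} := by
    have h1 : Continuous fun u : {x : ℂ // x ∉ S} × ℂ => ((u.1.1, u.2) : ℂ × ℂ) :=
      (continuous_subtype_val.comp continuous_fst).prodMk continuous_snd
    exact IsClosed.preimage h1 (isClosed_singleton.preimage (continuous_eval_pair f) :
      IsClosed ((fun u : ℂ × ℂ => eval ![u.2, u.1] f) ⁻¹' {0}))
  have hemb : Topology.IsClosedEmbedding
      (Subtype.val : CurveOver f S → {x : ℂ // x ∉ S} × ℂ) := hcl.isClosedEmbedding_subtypeVal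
  have : LocallyCompactSpace {x : ℂ // x ∉ S} := by
    have : IsOpen {x : ℂ | x ∉ S} := S.finite_toSet.isClosed.isOpen_compl
    exact this.locallyCompactSpace
  have hprop : IsProperMap (CurveOver.proj : CurveOver f S → _) := by
    rw [isProperMap_iff_isCompact_preimage]
    refine ⟨CurveOver.continuous_proj, fun K hK => ?_⟩
    set g := finSuccEquiv ℂ 1 f with hg
    set bd : {x : ℂ // x ∉ S} → ℝ := fun x =>
      (∑ i ∈ Finset.range g.natDegree, ‖eval (fun _ => x.1) (g.coeff i)‖) /
        ‖eval (fun _ => x.1) g.leadingCoeff‖ + 1 with hbd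
    have hcont : ∀ p : MvPolynomial (Fin 1) ℂ,
        Continuous fun x : {x : ℂ // x ∉ S} => eval (fun _ => x.1) p := by
      intro p
      exact (MvPolynomial.continuous_eval p).comp (by fun_prop)
    have hbdc : Continuous bd := by
      apply Continuous.add _ continuous_const
      apply Continuous.div
      · exact continuous_finsetSum _ fun i _ => (hcont _).norm
      · exact (hcont _).norm
      · intro x
        exact norm_ne_zero_iff.2 (hS.lead_ne x.1 x.2)
    obtain ⟨M, hM⟩ := (hK.image hbdc).bddAbove
    have hroot : ∀ u : CurveOver f S, ‖u.1.2‖ ≤ bd u.1.1 := by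
      intro u
      have h0 := u.2
      rw [eval_pair_eq] at h0
      have hl := hS.lead_ne u.1.1.1 u.1.1.2
      set P := Polynomial.map (eval fun _ => u.1.1.1) g with hP
      have hdeg : P.natDegree = g.natDegree := Polynomial.natDegree_map_of_leadingCoeff_ne_zero _ hl
      have hlead : P.leadingCoeff = eval (fun _ => u.1.1.1) g.leadingCoeff :=
        Polynomial.leadingCoeff_map_of_leadingCoeff_ne_zero _ hl
      have hPne : P ≠ 0 := by
        intro h
        rw [h] at hlead
        exact hl (by simpa using hlead.symm)
      have h1 := (Polynomial.IsRoot.norm_lt_cauchyBound hPne h0).le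
      have h2 : ‖u.1.2‖ ≤ (P.cauchyBound : ℝ) := by exact_mod_cast h1
      refine h2.trans ?_
      rw [Polynomial.cauchyBound, hbd]
      push_cast
      rw [hlead, hdeg]
      gcongr
      have : (Finset.range g.natDegree).sup (fun x => ‖P.coeff x‖₊) ≤
          ∑ i ∈ Finset.range g.natDegree, ‖P.coeff i‖₊ :=
        Finset.sup_le fun i hi => Finset.single_le_sum (f := fun i => ‖P.coeff i‖₊) (fun _ _ => zero_le) hi
      have h3 : (((Finset.range g.natDegree).sup fun x => ‖P.coeff x‖₊ : NNReal) : ℝ) ≤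
          ∑ i ∈ Finset.range g.natDegree, ‖P.coeff i‖ := by
        have h4 := NNReal.coe_le_coe.2 this
        rwa [NNReal.coe_sum] at h4
      simpa [hP, Polynomial.coeff_map] using h3
    have hsub : CurveOver.proj ⁻¹' K =
        (Subtype.val : CurveOver f S → {x : ℂ // x ∉ S} × ℂ) ⁻¹' (K ×ˢ Metric.closedBall 0 M) := by
      ext u
      simp only [Set.mem_preimage, CurveOver.proj]
      refine ⟨fun h => ⟨h, ?_⟩, fun h => h.1⟩
      rw [mem_closedBall_zero_iff]
      exact (hroot u).trans (hM ⟨_, h, rfl⟩)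
    rw [hsub]
    exact hemb.isCompact_preimage (hK.prod (isCompact_closedBall 0 M))
  exact hprop.isClosedMap

lemma IsSingularBound.isOpenMap_proj (hS : IsSingularBound f S) :
    IsOpenMap (CurveOver.proj : CurveOver f S → _) := by
  apply IsOpenMap.of_nhds_le
  intro u U hU
  obtain ⟨ψ, hψc, -, hψ0, -, hψ⟩ := exists_local_graph f u.2 (hS.deriv_ne _ u.1.1.2 _ u.2).1
  rw [Filter.mem_map] at hU
  obtain ⟨V, hV, hVU⟩ := (mem_nhds_subtype _ u _).1 hU
  have h1 : Filter.Tendsto (fun x : {x : ℂ // x ∉ S} => x.1) (nhds u.1.1) (nhds u.1.1.1) :=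
    continuous_subtype_val.continuousAt
  have h2 : Filter.Tendsto (fun x : {x : ℂ // x ∉ S} => (x, ψ x.1)) (nhds u.1.1) (nhds u.1) := by
    have h3 : Filter.Tendsto (fun x : {x : ℂ // x ∉ S} => ψ x.1) (nhds u.1.1) (nhds u.1.2) := by
      have h4 : Filter.Tendsto ψ (nhds u.1.1.1) (nhds u.1.2) := by
        simpa [ContinuousAt, hψ0] using hψc
      exact h4.comp h1
    exact Filter.tendsto_id.prodMk_nhds h3
  filter_upwards [h1.eventually hψ, h2 hV] with x hx hxV
  exact hVU (show (⟨(x, ψ x.1), hx⟩ : CurveOver f S).1 ∈ V from hxV)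

lemma IsSingularBound.isLocalHomeomorph_proj (hS : IsSingularBound f S) :
    IsLocalHomeomorph (CurveOver.proj : CurveOver f S → _) := by
  rw [isLocalHomeomorph_iff_isOpenEmbedding_restrict]
  intro u
  obtain ⟨ψ, -, -, -, hψ, -⟩ := exists_local_graph f u.2 (hS.deriv_ne _ u.1.1.2 _ u.2).1
  have h1 : Filter.Tendsto (fun w : CurveOver f S => (w.1.1.1, w.1.2)) (nhds u)
      (nhds (u.1.1.1, u.1.2)) :=
    ((continuous_subtype_val.comp (continuous_fst.comp continuous_subtype_val)).prodMk
      (continuous_snd.comp continuous_subtype_val)).continuousAt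
  obtain ⟨U, hUsub, hUo, huU⟩ := mem_nhds_iff.1 (h1.eventually hψ)
  refine ⟨U, hUo.mem_nhds huU, .of_continuous_injective_isOpenMap
    (CurveOver.continuous_proj.comp continuous_subtype_val) ?_
    (hS.isOpenMap_proj.comp hUo.isOpenMap_subtype_val)⟩
  intro a b hab
  have ha := (hUsub a.2).1 a.1.2
  have hb := (hUsub b.2).1 b.1.2
  have hab' : a.1.1.1 = b.1.1.1 := hab
  apply Subtype.ext
  apply Subtype.ext
  refine Prod.ext hab' ?_
  rw [← ha, ← hb]
  simp only [hab']

lemma IsSingularBound.map_ne_zero (hS : IsSingularBound f S) {x : ℂ} (hx : x ∉ S) :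
    Polynomial.map (eval fun _ => x) (finSuccEquiv ℂ 1 f) ≠ 0 := by
  intro h
  have hl := hS.lead_ne x hx
  have h2 := Polynomial.leadingCoeff_map_of_leadingCoeff_ne_zero (eval fun _ => x) hl
  rw [h] at h2
  exact hl (by simpa using h2.symm)

lemma IsSingularBound.isCoveringMap_proj (hS : IsSingularBound f S) :
    IsCoveringMap (CurveOver.proj : CurveOver f S → _) := by
  rw [isCoveringMap_iff_isCoveringMapOn_univ]
  refine IsClosedMap.isCoveringMapOn_of_isLocalHomeomorphOn hS.isClosedMap_proj ?_
    hS.isLocalHomeomorph_proj.isLocalHomeomorphOn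
  intro x _
  have hfin := Polynomial.finite_setOfPred_isRoot (hS.map_ne_zero x.2)
  refine Set.Finite.of_finite_image (f := fun w : CurveOver f S => w.1.2) (hfin.subset ?_) ?_
  · rintro _ ⟨w, rfl, rfl⟩
    have := w.2
    rw [eval_pair_eq] at this
    exact this
  · intro a ha b hb hab
    exact Subtype.ext (Prod.ext (ha.trans hb.symm) hab)

/-- Branches of an algebraic curve over a convex parameter domain. -/
lemma IsSingularBound.exists_branch (hS : IsSingularBound f S) {Ω : Set ℂ} (hΩ : IsOpen Ω)
    (hc : Convex ℝ Ω) {e : ℂ → ℂ} (he : DifferentiableOn ℂ e Ω) (heS : ∀ ζ ∈ Ω, e ζ ∉ S)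
    {ζ₀ y₀ : ℂ} (hζ : ζ₀ ∈ Ω) (h0 : eval ![y₀, e ζ₀] f = 0) :
    ∃ Y : ℂ → ℂ, DifferentiableOn ℂ Y Ω ∧ Y ζ₀ = y₀ ∧ ∀ ζ ∈ Ω, eval ![Y ζ, e ζ] f = 0 := by
  have : ContractibleSpace Ω := hc.contractibleSpace ⟨ζ₀, hζ⟩
  have : LocallyPathConnectedSpace Ω := hΩ.locallyPathConnectedSpace
  let g : C(Ω, {x : ℂ // x ∉ S}) := ⟨fun ζ => ⟨e ζ.1, heS _ ζ.2⟩,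
    (he.continuousOn.domRestrict).subtype_mk _⟩
  obtain ⟨G, ⟨hG0, hG⟩, -⟩ := hS.isCoveringMap_proj.existsUnique_continuousMap_lifts g ⟨ζ₀, hζ⟩
    ⟨(⟨e ζ₀, heS _ hζ⟩, y₀), h0⟩ rfl
  have hfst : ∀ ζ : Ω, (G ζ).1.1.1 = e ζ.1 := fun ζ =>
    congrArg Subtype.val (congrFun hG ζ)
  let Y : ℂ → ℂ := fun ζ => if h : ζ ∈ Ω then (G ⟨ζ, h⟩).1.2 else 0
  have hY : ∀ ζ : Ω, Y ζ.1 = (G ζ).1.2 := fun ζ => by simp [Y]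
  have hz : ∀ ζ ∈ Ω, eval ![Y ζ, e ζ] f = 0 := by
    intro ζ hζ
    have := (G ⟨ζ, hζ⟩).2
    rwa [hfst, ← hY] at this
  have hYc : ContinuousOn Y Ω := by
    rw [continuousOn_iff_continuous_domRestrict]
    have : Ω.domRestrict Y = fun ζ => (G ζ).1.2 := funext hY
    rw [this]
    exact (continuous_snd.comp continuous_subtype_val).comp G.continuous
  refine ⟨Y, ?_, ?_, hz⟩
  · intro ζ hζ
    apply DifferentiableAt.differentiableWithinAt
    obtain ⟨ψ, -, hψd, hψ0, hψ, -⟩ :=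
      exists_local_graph f (hz ζ hζ) (hS.deriv_ne _ (heS ζ hζ) _ (hz ζ hζ)).1
    have hea : DifferentiableAt ℂ e ζ := he.differentiableAt (hΩ.mem_nhds hζ)
    have h1 : Filter.Tendsto (fun ξ => (e ξ, Y ξ)) (nhds ζ) (nhds (e ζ, Y ζ)) :=
      (hea.continuousAt.prodMk (hYc.continuousAt (hΩ.mem_nhds hζ)))
    have h2 : Y =ᶠ[nhds ζ] fun ξ => ψ (e ξ) := by
      filter_upwards [h1.eventually hψ, hΩ.mem_nhds hζ] with ξ h hξ
      exact (h.1 (hz ξ hξ)).symm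
    exact (DifferentiableAt.comp ζ hψd hea).congr_of_eventuallyEq h2
  · have := hY ⟨ζ₀, hζ⟩
    rw [this, hG0]

/-- Two branches that agree at one point agree. -/
lemma IsSingularBound.branch_unique (hS : IsSingularBound f S) {Ω : Set ℂ}
    (hc : IsPreconnected Ω) {e : ℂ → ℂ} (he : ContinuousOn e Ω) (heS : ∀ ζ ∈ Ω, e ζ ∉ S)
    {Y₁ Y₂ : ℂ → ℂ} (h₁ : ContinuousOn Y₁ Ω) (h₂ : ContinuousOn Y₂ Ω)
    (hz₁ : ∀ ζ ∈ Ω, eval ![Y₁ ζ, e ζ] f = 0) (hz₂ : ∀ ζ ∈ Ω, eval ![Y₂ ζ, e ζ] f = 0)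
    {ζ₀ : ℂ} (hζ : ζ₀ ∈ Ω) (h0 : Y₁ ζ₀ = Y₂ ζ₀) : ∀ ζ ∈ Ω, Y₁ ζ = Y₂ ζ := by
  have : PreconnectedSpace Ω := isPreconnected_iff_preconnectedSpace.1 hc
  have hlift : ∀ (Y : ℂ → ℂ) (hY : ContinuousOn Y Ω) (hz : ∀ ζ ∈ Ω, eval ![Y ζ, e ζ] f = 0),
      Continuous (fun ζ : Ω => (⟨(⟨e ζ.1, heS _ ζ.2⟩, Y ζ.1), hz _ ζ.2⟩ : CurveOver f S)) := by
    intro Y hY hz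
    exact (((he.domRestrict).subtype_mk _).prodMk hY.domRestrict).subtype_mk _
  have := hS.isCoveringMap_proj.eq_of_comp_eq (hlift Y₁ h₁ hz₁) (hlift Y₂ h₂ hz₂) rfl ⟨ζ₀, hζ⟩
    (Subtype.ext (Prod.ext rfl h0))
  intro ζ hζ
  exact congrArg (fun w : CurveOver f S => w.1.2) (congrFun this ⟨ζ, hζ⟩)

end Covering

lemma totalDegree_pderiv_le {n : ℕ} (f : MvPolynomial (Fin n) ℂ) (i : Fin n) :
    (pderiv i f).totalDegree ≤ f.totalDegree - 1 := by
  conv_lhs => rw [f.as_sum, map_sum]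
  refine totalDegree_finsetSum_le fun s hs => ?_
  rw [pderiv_monomial]
  by_cases h : s i = 0
  · simp [h]
  · refine (totalDegree_monomial_le _ _).trans ?_
    have h1 := le_totalDegree hs
    have h2 : (s - Finsupp.single i 1) + Finsupp.single i 1 = s := by
      apply tsub_add_cancel_of_le
      rw [Finsupp.single_le_iff]
      omega
    have h3 : ((s - Finsupp.single i 1).sum fun _ e => e) + 1 = s.sum fun _ e => e := by
      conv_rhs => rw [← h2]
      rw [Finsupp.sum_add_index' (by simp) (by simp)]
      simp
    change ((s - Finsupp.single i 1).sum fun _ e => e) ≤ _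
    omega

lemma not_dvd_of_totalDegree_lt {n : ℕ} {f g : MvPolynomial (Fin n) ℂ} (hg : g ≠ 0)
    (h : g.totalDegree < f.totalDegree) : ¬ f ∣ g := fun hd =>
  absurd (totalDegree_le_of_dvd_of_isDomain hd hg) (not_le.2 h)

lemma exists_finset_of_card_le {α : Type*} (s : Set α) (B : ℕ)
    (h : ∀ T : Finset α, (∀ x ∈ T, x ∈ s) → T.card ≤ B) :
    ∃ T : Finset α, T.card ≤ B ∧ ∀ x, x ∈ T ↔ x ∈ s := by
  have hfin : s.Finite := by
    by_contra hinf
    obtain ⟨t, ht, hc⟩ := Set.Infinite.exists_subset_card_eq (s := s) hinf (B + 1)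
    have := h t fun x hx => ht hx
    omega
  exact ⟨hfin.toFinset, h _ (by simp), by simp⟩

lemma card_zeros_one_var_le (g : MvPolynomial (Fin 1) ℂ) (hg : g ≠ 0) (T : Finset ℂ)
    (hT : ∀ x ∈ T, eval (fun _ => x) g = 0) : T.card ≤ g.totalDegree := by
  have h := card_zeros_le g hg le_rfl (fun _ => T)
  simp only [codimOne, mul_zero, zero_add, Finset.univ_eq_empty, Finset.prod_empty, mul_one] at h
  refine le_trans ?_ h
  refine Finset.card_le_card_of_injOn (fun x _ => x) ?_ ?_
  · intro x hx
    simp only [Finset.coe_filter, Fintype.mem_piFinset, Set.mem_ofPred_eq]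
    exact ⟨fun _ => hx, hT x hx⟩
  · intro x _ y _ hxy
    exact congrFun hxy 0

lemma exists_isSingularBound (δ : ℕ) : ∃ K, ∀ f : MvPolynomial (Fin 2) ℂ, Irreducible f →
    f.totalDegree ≤ δ → pderiv 0 f ≠ 0 → pderiv 1 f ≠ 0 →
    ∃ S : Finset ℂ, S.card ≤ K ∧ S.Nonempty ∧ IsSingularBound f S := by
  obtain ⟨B, hB⟩ := exists_bezout_bound δ
  refine ⟨B + B + δ + 1, fun f hf hδ h0 h1 => ?_⟩
  have key : ∀ i, pderiv i f ≠ 0 → ∃ T : Finset (Fin 2 → ℂ), T.card ≤ B ∧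
      ∀ x, x ∈ T ↔ eval x f = 0 ∧ eval x (pderiv i f) = 0 := by
    intro i hi
    have h2 := totalDegree_pderiv_le f i
    have h3 := one_le_totalDegree_of_irreducible hf
    exact exists_finset_of_card_le {x | eval x f = 0 ∧ eval x (pderiv i f) = 0} B fun T hT =>
      hB f _ hf (not_dvd_of_totalDegree_lt hi (by omega)) hδ (by omega) T hT
  obtain ⟨T0, hT0, hm0⟩ := key 0 h0
  obtain ⟨T1, hT1, hm1⟩ := key 1 h1
  have hlead : (finSuccEquiv ℂ 1 f).leadingCoeff ≠ 0 := by
    rw [Ne, Polynomial.leadingCoeff_eq_zero, EmbeddingLike.map_eq_zero_iff]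
    exact hf.ne_zero
  obtain ⟨L, hL, hmL⟩ := exists_finset_of_card_le
    {x : ℂ | eval (fun _ => x) (finSuccEquiv ℂ 1 f).leadingCoeff = 0} δ fun T hT =>
      (card_zeros_one_var_le _ hlead T hT).trans
        ((totalDegree_coeff_finSuccEquiv_le f _).trans hδ)
  refine ⟨insert 0 (T0.image (fun v => v 1) ∪ T1.image (fun v => v 1) ∪ L), ?_, by simp, ?_, ?_⟩
  · refine (Finset.card_insert_le _ _).trans ?_
    have a1 := Finset.card_union_le (T0.image (fun v => v 1) ∪ T1.image (fun v => v 1)) L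
    have a2 := Finset.card_union_le (T0.image (fun v => v 1)) (T1.image (fun v => v 1))
    have a3 := Finset.card_image_le (s := T0) (f := fun v => v 1)
    have a4 := Finset.card_image_le (s := T1) (f := fun v => v 1)
    omega
  · intro x hx y hy
    simp only [Finset.mem_insert, Finset.mem_union, Finset.mem_image, not_or, not_exists,
      not_and] at hx
    refine ⟨fun h => hx.2.1.1 ![y, x] ((hm0 _).2 ⟨hy, h⟩) rfl,
      fun h => hx.2.1.2 ![y, x] ((hm1 _).2 ⟨hy, h⟩) rfl⟩
  · intro x hx
    simp only [Finset.mem_insert, Finset.mem_union, not_or] at hx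
    exact fun h => hx.2.2 ((hmL x).2 h)

/-- A branch of the curve `f = 0` over the open set `U`. -/
structure IsBranch (f : MvPolynomial (Fin 2) ℂ) (U : Set ℂ) (Y : ℂ → ℂ) : Prop where
  diff : DifferentiableOn ℂ Y U
  zero : ∀ z ∈ U, eval ![Y z, z] f = 0

lemma IsBranch.deriv_eq {f : MvPolynomial (Fin 2) ℂ} {U : Set ℂ} {Y : ℂ → ℂ} (hU : IsOpen U)
    (hY : IsBranch f U Y) {z : ℂ} (hz : z ∈ U) :
    eval ![Y z, z] (pderiv 0 f) * deriv Y z + eval ![Y z, z] (pderiv 1 f) = 0 := by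
  have h1 : HasDerivAt Y (deriv Y z) z := (hY.diff.differentiableAt (hU.mem_nhds hz)).hasDerivAt
  have h2 := hasDerivAt_eval_curve f (v := fun z => ![Y z, z]) (v' := ![deriv Y z, 1]) (z := z)
    (by
      intro i
      fin_cases i
      · exact h1
      · exact hasDerivAt_id z)
  have h3 : (fun z => eval ![Y z, z] f) =ᶠ[nhds z] fun _ => 0 := by
    filter_upwards [hU.mem_nhds hz] with w hw using hY.zero w hw
  have h4 := h2.unique ((hasDerivAt_const z (0 : ℂ)).congr_of_eventuallyEq h3)
  simpa [Fin.sum_univ_two] using h4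

lemma IsBranch.deriv_ne_zero {f : MvPolynomial (Fin 2) ℂ} {U : Set ℂ} {Y : ℂ → ℂ} {S : Finset ℂ}
    (hS : IsSingularBound f S) (hU : IsOpen U) (hY : IsBranch f U Y) {z : ℂ} (hz : z ∈ U)
    (hzS : z ∉ S) : deriv Y z ≠ 0 := by
  intro h
  have h1 := hY.deriv_eq hU hz
  rw [h, mul_zero, zero_add] at h1
  exact (hS.deriv_ne z hzS _ (hY.zero z hz)).2 h1

lemma exists_slope_bound (δ : ℕ) (ε : ℝ) (hε : 0 < ε) : ∃ α : ℝ, 0 < α ∧ α < 1 / 2 ∧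
    ∀ (f : MvPolynomial (Fin 2) ℂ) (S : Finset ℂ) (c : ℂ) (R : ℝ) (Y : ℂ → ℂ), Irreducible f →
      f.totalDegree ≤ δ → IsSingularBound f S → 0 < R → (∀ z ∈ Metric.ball c R, z ∉ S) →
      IsBranch f (Metric.ball c R) Y → ∀ z, ‖z - c‖ ≤ α * R →
      ‖deriv Y z - deriv Y c‖ ≤ ε * ‖deriv Y c‖ := by
  obtain ⟨B, hB⟩ := exists_bezout_bound δ
  obtain ⟨α, hα, hα', H⟩ := exists_almost_constant B ε hε
  refine ⟨α, hα, hα', fun f S c R Y hf hδ hS hR hRS hY z hz => ?_⟩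
  have hdeg := one_le_totalDegree_of_irreducible hf
  by_cases hb : ∃ b : ℂ, pderiv 1 f + C b * pderiv 0 f = 0
  · obtain ⟨b, hb⟩ := hb
    have hconst : ∀ w ∈ Metric.ball c R, deriv Y w = b := by
      intro w hw
      have h1 := hY.deriv_eq Metric.isOpen_ball hw
      have h2 := congrArg (eval ![Y w, w]) hb
      simp only [map_add, map_mul, eval_C, map_zero] at h2
      have h3 := (hS.deriv_ne w (hRS w hw) _ (hY.zero w hw)).1
      apply mul_left_cancel₀ h3
      linear_combination h1 - h2
    have hzR : z ∈ Metric.ball c R := by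
      rw [mem_ball_iff_norm]
      nlinarith
    rw [hconst z hzR, hconst c (Metric.mem_ball_self hR), sub_self, norm_zero]
    positivity
  · push Not at hb
    refine H c R (deriv Y) hR (hY.diff.deriv Metric.isOpen_ball) ?_ ?_ z hz
    · exact fun w hw => hY.deriv_ne_zero hS Metric.isOpen_ball hw (hRS w hw)
    · intro b T hT
      have hd : (pderiv 1 f + C b * pderiv 0 f).totalDegree ≤ f.totalDegree - 1 := by
        refine (totalDegree_add _ _).trans (max_le (totalDegree_pderiv_le f 1) ?_)
        refine (totalDegree_mul _ _).trans ?_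
        rw [totalDegree_C, zero_add]
        exact totalDegree_pderiv_le f 0
      have h1 := hB f _ hf (not_dvd_of_totalDegree_lt (hb b) (by omega)) hδ (by omega)
        (T.image fun w => ![Y w, w]) (by
          intro x hx
          obtain ⟨w, hw, rfl⟩ := Finset.mem_image.1 hx
          obtain ⟨hwR, hwb⟩ := hT w hw
          refine ⟨hY.zero w hwR, ?_⟩
          have h1 := hY.deriv_eq Metric.isOpen_ball hwR
          rw [hwb] at h1
          simp only [map_add, map_mul, eval_C]
          linear_combination h1)
      rwa [Finset.card_image_of_injective] at h1
      intro a b hab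
      exact congrFun hab 1

lemma IsBranch.mono {f : MvPolynomial (Fin 2) ℂ} {U V : Set ℂ} {Y : ℂ → ℂ}
    (hY : IsBranch f U Y) (h : V ⊆ U) : IsBranch f V Y :=
  ⟨hY.diff.mono h, fun z hz => hY.zero z (h hz)⟩

/-- A function whose derivative is almost constant is almost affine. -/
lemma norm_sub_affine_le {Y : ℂ → ℂ} {c : ℂ} {R r ε : ℝ} (hY : DifferentiableOn ℂ Y (Metric.ball c R))
    (hr : r < R)
    (h : ∀ z, ‖z - c‖ ≤ r → ‖deriv Y z - deriv Y c‖ ≤ ε * ‖deriv Y c‖) {z w : ℂ}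
    (hz : ‖z - c‖ ≤ r) (hw : ‖w - c‖ ≤ r) :
    ‖Y z - Y w - deriv Y c * (z - w)‖ ≤ ε * ‖deriv Y c‖ * ‖z - w‖ := by
  have hsub : ∀ x ∈ Metric.closedBall c r, x ∈ Metric.ball c R := fun x hx =>
    Metric.closedBall_subset_ball hr hx
  have key := (convex_closedBall c r).norm_image_sub_le_of_norm_hasDerivWithin_le
    (f := fun x => Y x - deriv Y c * x) (f' := fun x => deriv Y x - deriv Y c)
    (C := ε * ‖deriv Y c‖) (x := w) (y := z) (by
      intro x hx
      have h1 : HasDerivAt Y (deriv Y x) x :=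
        (hY.differentiableAt (Metric.isOpen_ball.mem_nhds (hsub x hx))).hasDerivAt
      have h2 := h1.sub ((hasDerivAt_id x).const_mul (deriv Y c))
      rw [mul_one] at h2
      exact h2.hasDerivWithinAt) (by
      intro x hx
      exact h x (mem_closedBall_iff_norm.1 hx))
    (mem_closedBall_iff_norm.2 hw) (mem_closedBall_iff_norm.2 hz)
  convert! key using 2
  ring

/-- The logarithmic derivative of the slope of a branch is controlled by the distance to the
singular set. -/
lemma exists_log_slope_bound (δ : ℕ) : ∃ M : ℝ, 0 < M ∧
    ∀ (f : MvPolynomial (Fin 2) ℂ) (S : Finset ℂ) (c : ℂ) (R : ℝ) (Y : ℂ → ℂ), Irreducible f →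
      f.totalDegree ≤ δ → IsSingularBound f S → 0 < R → (∀ z ∈ Metric.ball c R, z ∉ S) →
      IsBranch f (Metric.ball c R) Y → R * ‖deriv (deriv Y) c‖ ≤ M * ‖deriv Y c‖ := by
  obtain ⟨α, hα, hα', H⟩ := exists_slope_bound δ 1 one_pos
  refine ⟨α⁻¹, inv_pos.2 hα, fun f S c R Y hf hδ hS hR hRS hY => ?_⟩
  have h1 := H f S c R Y hf hδ hS hR hRS hY
  have hαR : 0 < α * R := by positivity
  have hlt : α * R < R := by nlinarith
  have hd : DifferentiableOn ℂ (fun z => deriv Y z - deriv Y c) (Metric.ball c R) :=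
    (hY.diff.deriv Metric.isOpen_ball).sub_const _
  have hcl : DiffContOnCl ℂ (fun z => deriv Y z - deriv Y c) (Metric.ball c (α * R)) := by
    apply DifferentiableOn.diffContOnCl
    rw [closure_ball c hαR.ne']
    exact hd.mono (Metric.closedBall_subset_ball hlt)
  have h2 := Complex.norm_deriv_le_of_forall_mem_sphere_norm_le (f := fun z => deriv Y z - deriv Y c)
    hαR hcl (C := ‖deriv Y c‖) (by
      intro z hz
      have := h1 z (mem_sphere_iff_norm.1 hz).le
      simpa using this)
  rw [deriv_sub_const, le_div_iff₀ hαR] at h2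
  rw [inv_mul_eq_div, le_div_iff₀ hα]
  linarith

/-- The open vertical strip `s₀ < Re w < s₁`. -/
def vertStrip (s₀ s₁ : ℝ) : Set ℂ := {w | s₀ < w.re ∧ w.re < s₁}

lemma isOpen_vertStrip (s₀ s₁ : ℝ) : IsOpen (vertStrip s₀ s₁) :=
  (isOpen_lt continuous_const Complex.continuous_re).inter
    (isOpen_lt Complex.continuous_re continuous_const)

lemma convex_vertStrip (s₀ s₁ : ℝ) : Convex ℝ (vertStrip s₀ s₁) :=
  (convex_halfSpace_re_gt s₀).inter (convex_halfSpace_re_lt s₁)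

/-- A bounded holomorphic function with period `2πi` on a vertical strip is exponentially close to
its mean value away from the boundary. -/
lemma norm_integral_sub_le {k : ℂ → ℂ} {s₀ s₁ C : ℝ} (hk : DifferentiableOn ℂ k (vertStrip s₀ s₁))
    (hper : ∀ w ∈ vertStrip s₀ s₁, k (w + 2 * Real.pi * Complex.I) = k w)
    (hb : ∀ w ∈ vertStrip s₀ s₁, ‖k w‖ ≤ C) {w : ℂ} {a a' : ℝ} (ha : s₀ < a) (haw : a + 1 ≤ w.re)
    (haw' : w.re + 1 ≤ a') (ha' : a' < s₁) :
    ‖(∫ y : ℝ in (w.im - Real.pi)..(w.im + Real.pi), k (a' + y * Complex.I)) - 2 * Real.pi * k w‖ ≤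
      2 * Real.pi * (4 * C * (Real.exp (-(a' - w.re)) + Real.exp (-(w.re - a)))) := by
  have hpi := Real.pi_pos
  have hwS : w ∈ vertStrip s₀ s₁ := ⟨by linarith, by linarith⟩
  have hC : 0 ≤ C := (norm_nonneg _).trans (hb w hwS)
  set E : ℂ → ℂ := fun ξ => 1 - Complex.exp (w - ξ) with hE
  have hEd : Differentiable ℂ E := by fun_prop
  have hE0 : E w = 0 := by simp [hE]
  have hE' : HasDerivAt E 1 w := by
    have h1 : HasDerivAt (fun ξ : ℂ => w - ξ) (-1) w := by
      simpa using (hasDerivAt_id w).const_sub w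
    have h2 := (h1.cexp).const_sub 1
    simpa using h2
  have hEne : ∀ ξ : ℂ, ξ ≠ w → |ξ.im - w.im| ≤ Real.pi → E ξ ≠ 0 := by
    intro ξ hne him h0
    have h1 : Complex.exp (w - ξ) = 1 := by
      have : 1 - Complex.exp (w - ξ) = 0 := h0
      linear_combination -this
    obtain ⟨n, hn⟩ := Complex.exp_eq_one_iff.1 h1
    have h2 : w.im - ξ.im = n * (2 * Real.pi) := by
      have := congrArg Complex.im hn
      simpa using this
    have h3 : |(n : ℝ)| * 2 ≤ 1 := by
      have h4 : |(n : ℝ) * (2 * Real.pi)| ≤ Real.pi := by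
        rw [← h2, abs_sub_comm]; exact him
      rw [abs_mul, abs_of_pos (by positivity : 0 < 2 * Real.pi)] at h4
      nlinarith
    have h5 : n = 0 := by
      have h6 : |n| * 2 ≤ 1 := by exact_mod_cast h3
      have : |n| = 0 := by
        have := abs_nonneg n
        omega
      exact abs_eq_zero.1 this
    rw [h5] at hn
    apply hne
    have : w - ξ = 0 := by simpa using hn
    exact (sub_eq_zero.1 this).symm
  have hdE : ∀ ξ : ℂ, |ξ.im - w.im| ≤ Real.pi → dslope E w ξ ≠ 0 := by
    intro ξ him
    by_cases h : ξ = w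
    · rw [h, dslope_same, hE'.deriv]; exact one_ne_zero
    · rw [dslope_of_ne _ h, slope_def_field, hE0, sub_zero]
      exact div_ne_zero (hEne ξ h him) (sub_ne_zero.2 h)
  set Φ : ℂ → ℂ := fun ξ => dslope k w ξ / dslope E w ξ with hΦ
  have hΦeq : ∀ ξ, ξ ≠ w → Φ ξ = (k ξ - k w) / E ξ := by
    intro ξ h
    have h' : ξ - w ≠ 0 := sub_ne_zero.2 h
    rw [hΦ]
    simp only
    rw [dslope_of_ne _ h, dslope_of_ne _ h, slope_def_field, slope_def_field, hE0, sub_zero,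
      div_div_div_cancel_right₀ h']
  have hdk : DifferentiableOn ℂ (dslope k w) (vertStrip s₀ s₁) :=
    (Complex.differentiableOn_dslope ((isOpen_vertStrip _ _).mem_nhds hwS)).2 hk
  have hdEd : DifferentiableOn ℂ (dslope E w) Set.univ :=
    (Complex.differentiableOn_dslope Filter.univ_mem).2 hEd.differentiableOn
  have hΦd : DifferentiableOn ℂ Φ (vertStrip s₀ s₁ ∩ {ξ | |ξ.im - w.im| ≤ Real.pi}) :=
    (hdk.mono Set.inter_subset_left).div (hdEd.mono (Set.subset_univ _)) fun ξ hξ => hdE ξ hξ.2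
  set z1 : ℂ := ⟨a, w.im - Real.pi⟩ with hz1
  set z2 : ℂ := ⟨a', w.im + Real.pi⟩ with hz2
  have hrect : (Set.uIcc z1.re z2.re ×ℂ Set.uIcc z1.im z2.im) ⊆
      vertStrip s₀ s₁ ∩ {ξ | |ξ.im - w.im| ≤ Real.pi} := by
    intro ξ hξ
    obtain ⟨h1, h2⟩ := Complex.mem_reProdIm.1 hξ
    rw [Set.uIcc_of_le (by simp only [hz1, hz2]; linarith)] at h1 h2
    simp only [hz1, hz2, Set.mem_Icc] at h1 h2
    have h3 : |ξ.im - w.im| ≤ Real.pi := abs_le.2 ⟨by linarith, by linarith⟩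
    exact ⟨⟨by linarith, by linarith⟩, h3⟩
  have hsub2 : Set.Ioo (min z1.re z2.re) (max z1.re z2.re) ×ℂ
      Set.Ioo (min z1.im z2.im) (max z1.im z2.im) ⊆ Set.uIcc z1.re z2.re ×ℂ Set.uIcc z1.im z2.im := by
    intro ξ hξ
    obtain ⟨h1, h2⟩ := Complex.mem_reProdIm.1 hξ
    exact Complex.mem_reProdIm.2 ⟨Set.Ioo_subset_Icc_self h1, Set.Ioo_subset_Icc_self h2⟩
  have hInt := Complex.integral_boundary_rect_eq_zero_of_continuousOn_of_differentiableOn Φ z1 z2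
    (hΦd.continuousOn.mono hrect) (hΦd.mono (hsub2.trans hrect))
  have hhor : (∫ x : ℝ in z1.re..z2.re, Φ (x + z1.im * Complex.I)) =
      ∫ x : ℝ in z1.re..z2.re, Φ (x + z2.im * Complex.I) := by
    apply intervalIntegral.integral_congr
    intro x hx
    rw [Set.uIcc_of_le (by simp only [hz1, hz2]; linarith)] at hx
    simp only [hz1, hz2, Set.mem_Icc] at hx
    simp only [hz1, hz2]
    have e1 : (x : ℂ) + ((w.im + Real.pi : ℝ) : ℂ) * Complex.I =
        (x + ((w.im - Real.pi : ℝ) : ℂ) * Complex.I) + 2 * Real.pi * Complex.I := by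
      push_cast; ring
    have n1 : (x : ℂ) + ((w.im + Real.pi : ℝ) : ℂ) * Complex.I ≠ w := by
      intro h
      have := congrArg Complex.im h
      simp at this
    have n2 : (x : ℂ) + ((w.im - Real.pi : ℝ) : ℂ) * Complex.I ≠ w := by
      intro h
      have := congrArg Complex.im h
      simp at this
    rw [hΦeq _ n1, hΦeq _ n2, e1, hper]
    · congr 1
      simp only [hE]
      conv_rhs => rw [← sub_sub, Complex.exp_periodic.sub_eq]
    · constructor <;> simp <;> linarith
  rw [hhor, sub_self, zero_add, ← smul_sub, smul_eq_zero] at hInt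
  have hLR : (∫ y : ℝ in (w.im - Real.pi)..(w.im + Real.pi), Φ (a' + y * Complex.I)) =
      ∫ y : ℝ in (w.im - Real.pi)..(w.im + Real.pi), Φ (a + y * Complex.I) :=
    sub_eq_zero.1 (hInt.resolve_left Complex.I_ne_zero)
  have hmemR : ∀ y ∈ Set.uIcc (w.im - Real.pi) (w.im + Real.pi),
      ((a' : ℂ) + y * Complex.I) ∈ Set.uIcc z1.re z2.re ×ℂ Set.uIcc z1.im z2.im := by
    intro y hy
    rw [Complex.mem_reProdIm]
    simpa [hz1, hz2] using hy
  have hmemL : ∀ y ∈ Set.uIcc (w.im - Real.pi) (w.im + Real.pi),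
      ((a : ℂ) + y * Complex.I) ∈ Set.uIcc z1.re z2.re ×ℂ Set.uIcc z1.im z2.im := by
    intro y hy
    rw [Complex.mem_reProdIm]
    simpa [hz1, hz2] using hy
  have hconv : ∀ b : ℝ, Continuous fun y : ℝ => ((b : ℂ) + y * Complex.I) := fun b => by fun_prop
  have hiΦ : IntervalIntegrable (fun y : ℝ => Φ (a' + y * Complex.I)) MeasureTheory.volume
      (w.im - Real.pi) (w.im + Real.pi) :=
    (hΦd.continuousOn.comp (hconv a').continuousOn fun y hy => hrect (hmemR y hy)).intervalIntegrable
  have hik : IntervalIntegrable (fun y : ℝ => k (a' + y * Complex.I)) MeasureTheory.volume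
      (w.im - Real.pi) (w.im + Real.pi) :=
    (hk.continuousOn.comp (hconv a').continuousOn
      fun y hy => (hrect (hmemR y hy)).1).intervalIntegrable
  have hnorm : ∀ (b : ℝ) (y : ℝ), ‖Complex.exp (w - ((b : ℂ) + y * Complex.I))‖ =
      Real.exp (w.re - b) := by
    intro b y
    rw [Complex.norm_exp]
    simp
  have hkk : ∀ ξ ∈ vertStrip s₀ s₁, ‖k ξ - k w‖ ≤ 2 * C := by
    intro ξ hξ
    calc ‖k ξ - k w‖ ≤ ‖k ξ‖ + ‖k w‖ := norm_sub_le _ _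
      _ ≤ 2 * C := by linarith [hb ξ hξ, hb w hwS]
  have hexp1 : 2 ≤ Real.exp 1 := by
    have := Real.add_one_le_exp (1 : ℝ)
    linarith
  have hL : ‖∫ y : ℝ in (w.im - Real.pi)..(w.im + Real.pi), Φ (a + y * Complex.I)‖ ≤
      (4 * C * Real.exp (-(w.re - a))) * |(w.im + Real.pi) - (w.im - Real.pi)| := by
    apply intervalIntegral.norm_integral_le_of_norm_le_const
    intro y hy
    have hmem := hrect (hmemL y (Set.uIoc_subset_uIcc hy))
    set ξ : ℂ := (a : ℂ) + y * Complex.I with hξ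
    have hne : ξ ≠ w := by
      intro h
      have := congrArg Complex.re h
      simp [hξ] at this
      linarith
    rw [hΦeq _ hne, norm_div]
    have h1 := hnorm a y
    rw [← hξ] at h1
    have h2 : 2 ≤ Real.exp (w.re - a) := hexp1.trans (Real.exp_le_exp.2 (by linarith))
    have h3 : Real.exp (w.re - a) / 2 ≤ ‖E ξ‖ := by
      have h4 := norm_sub_norm_le (Complex.exp (w - ξ)) 1
      rw [h1, norm_one, norm_sub_rev] at h4
      have h5 : ‖E ξ‖ = ‖1 - Complex.exp (w - ξ)‖ := rfl
      rw [h5]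
      linarith
    have h4 : 0 < Real.exp (w.re - a) / 2 := by positivity
    calc ‖k ξ - k w‖ / ‖E ξ‖ ≤ 2 * C / (Real.exp (w.re - a) / 2) :=
          div_le_div₀ (by positivity) (hkk ξ hmem.1) h4 h3
      _ = 4 * C * Real.exp (-(w.re - a)) := by
          rw [Real.exp_neg]; field_simp; ring
  have hR : ‖∫ y : ℝ in (w.im - Real.pi)..(w.im + Real.pi),
      ((k (a' + y * Complex.I) - k w) - Φ (a' + y * Complex.I))‖ ≤
      (4 * C * Real.exp (-(a' - w.re))) * |(w.im + Real.pi) - (w.im - Real.pi)| := by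
    apply intervalIntegral.norm_integral_le_of_norm_le_const
    intro y hy
    have hmem := hrect (hmemR y (Set.uIoc_subset_uIcc hy))
    set ξ : ℂ := (a' : ℂ) + y * Complex.I with hξ
    have hne : ξ ≠ w := by
      intro h
      have := congrArg Complex.re h
      simp [hξ] at this
      linarith
    have hEξ := hEne ξ hne hmem.2
    have e1 : (k ξ - k w) - Φ ξ = - ((k ξ - k w) * Complex.exp (w - ξ) / E ξ) := by
      rw [hΦeq _ hne]
      field_simp
      simp only [hE]
      ring
    rw [e1, norm_neg, norm_div, norm_mul]
    have h1 := hnorm a' y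
    rw [← hξ] at h1
    have h2 : Real.exp (w.re - a') ≤ 1 / 2 := by
      calc Real.exp (w.re - a') ≤ Real.exp (-1) := Real.exp_le_exp.2 (by linarith)
        _ = (Real.exp 1)⁻¹ := Real.exp_neg 1
        _ ≤ 2⁻¹ := inv_anti₀ (by norm_num) hexp1
        _ = 1 / 2 := by norm_num
    have h3 : 1 / 2 ≤ ‖E ξ‖ := by
      have h4 := norm_sub_norm_le 1 (Complex.exp (w - ξ))
      rw [h1, norm_one] at h4
      have h5 : ‖E ξ‖ = ‖1 - Complex.exp (w - ξ)‖ := rfl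
      rw [h5]
      linarith
    rw [h1]
    calc ‖k ξ - k w‖ * Real.exp (w.re - a') / ‖E ξ‖
        ≤ 2 * C * Real.exp (w.re - a') / (1 / 2) :=
          div_le_div₀ (by positivity) (by gcongr; exact hkk ξ hmem.1) (by norm_num) h3
      _ = 4 * C * Real.exp (-(a' - w.re)) := by
          rw [neg_sub]; ring
  have habs : |(w.im + Real.pi) - (w.im - Real.pi)| = 2 * Real.pi := by
    rw [abs_of_pos] <;> linarith
  rw [habs] at hL hR
  have hsplit : (∫ y : ℝ in (w.im - Real.pi)..(w.im + Real.pi), k (a' + y * Complex.I)) -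
      2 * Real.pi * k w =
      (∫ y : ℝ in (w.im - Real.pi)..(w.im + Real.pi),
        ((k (a' + y * Complex.I) - k w) - Φ (a' + y * Complex.I))) +
      ∫ y : ℝ in (w.im - Real.pi)..(w.im + Real.pi), Φ (a + y * Complex.I) := by
    rw [intervalIntegral.integral_sub (hik.sub intervalIntegrable_const) hiΦ, hLR,
      intervalIntegral.integral_sub hik intervalIntegrable_const, intervalIntegral.integral_const,
      sub_add_cancel]
    congr 1
    rw [show (w.im + Real.pi) - (w.im - Real.pi) = 2 * Real.pi by ring, Complex.real_smul]
    push_cast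
    ring
  rw [hsplit]
  refine (norm_add_le _ _).trans ?_
  nlinarith [hL, hR]

lemma exists_holomorphic_log {U : Set ℂ} (hU : IsOpen U) (hc : Convex ℝ U) (hne : U.Nonempty)
    {g : ℂ → ℂ} (hg : DifferentiableOn ℂ g U) (h0 : ∀ z ∈ U, g z ≠ 0) :
    ∃ h : ℂ → ℂ, DifferentiableOn ℂ h U ∧ ∀ z ∈ U, Complex.exp (h z) = g z := by
  have hsc : IsSimplyConnected U := by
    have : ContractibleSpace U := hc.contractibleSpace hne
    exact (inferInstance : SimplyConnectedSpace U)
  obtain ⟨h, hcont, hexp⟩ := Complex.exists_continuousOn_eqOn_exp_comp hsc hU hg.continuousOn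
    (by rintro ⟨z, hz, hz0⟩; exact h0 z hz hz0)
  have hexp' : ∀ z ∈ U, Complex.exp (h z) = g z := hexp
  refine ⟨h, fun z hz => ?_, hexp'⟩
  apply DifferentiableAt.differentiableWithinAt
  have hca : ContinuousAt h z := hcont.continuousAt (hU.mem_nhds hz)
  have hev : ∀ᶠ w in nhds z, ‖h w - h z‖ < 3 := by
    have := Metric.tendsto_nhds.1 hca 3 (by norm_num)
    simpa [dist_eq_norm] using this
  have heq : h =ᶠ[nhds z] fun w => h z + Complex.log (g w / g z) := by
    filter_upwards [hev, hU.mem_nhds hz] with w hw hwU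
    rw [← hexp' w hwU, ← hexp' z hz, ← Complex.exp_sub, Complex.log_exp]
    · ring
    · have := (Complex.abs_im_le_norm (h w - h z)).trans_lt hw
      have h3 := Real.pi_gt_three
      linarith [(abs_lt.1 this).1]
    · have := (Complex.abs_im_le_norm (h w - h z)).trans_lt hw
      have h3 := Real.pi_gt_three
      linarith [(abs_lt.1 this).2]
  refine DifferentiableAt.congr_of_eventuallyEq ?_ heq
  have hgz : DifferentiableAt ℂ g z := hg.differentiableAt (hU.mem_nhds hz)
  refine (DifferentiableAt.clog (hgz.div_const _) ?_).const_add _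
  rw [div_self (h0 z hz)]
  exact Complex.one_mem_slitPlane

lemma norm_sub_le_of_horizontal {F : ℂ → ℂ} {θ p q : ℝ} (hpq : p ≤ q)
    (hF : ∀ t ∈ Set.Icc p q, DifferentiableAt ℂ F (t + θ * Complex.I)) {B B' : ℝ → ℝ}
    (hB : ∀ t, HasDerivAt B (B' t) t)
    (hb : ∀ t ∈ Set.Icc p q, ‖deriv F (t + θ * Complex.I)‖ ≤ B' t) :
    ‖F (q + θ * Complex.I) - F (p + θ * Complex.I)‖ ≤ B q - B p := by
  have hd : ∀ t ∈ Set.Icc p q, HasDerivAt (fun t : ℝ => F (t + θ * Complex.I))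
      (deriv F (t + θ * Complex.I)) t := by
    intro t ht
    have h1 : HasDerivAt (fun t : ℂ => t + θ * Complex.I) 1 (t : ℂ) :=
      (hasDerivAt_id _).add_const _
    have h2 := ((hF t ht).hasDerivAt.comp (t : ℂ) h1).comp_ofReal
    simpa using h2
  have key := image_norm_le_of_norm_deriv_right_le_deriv_boundary
    (f := fun t : ℝ => F (t + θ * Complex.I) - F (p + θ * Complex.I))
    (f' := fun t : ℝ => deriv F (t + θ * Complex.I)) (a := p) (b := q)
    (B := fun t => B t - B p) (B' := B')
    (fun t ht => ((hd t ht).sub_const _).continuousAt.continuousWithinAt)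
    (fun t ht => ((hd t (Set.Ico_subset_Icc_self ht)).sub_const _).hasDerivWithinAt)
    (by simp) (fun t => (hB t).sub_const _) (fun t ht => hb t (Set.Ico_subset_Icc_self ht))
  exact key ⟨hpq, le_rfl⟩

lemma norm_sub_le_of_vertical {F : ℂ → ℂ} {s M b θ θ' : ℝ} (hθ : |θ| ≤ b) (hθ' : |θ'| ≤ b)
    (hF : ∀ y, |y| ≤ b → DifferentiableAt ℂ F (s + y * Complex.I))
    (hb : ∀ y, |y| ≤ b → ‖deriv F (s + y * Complex.I)‖ ≤ M) :
    ‖F (s + θ * Complex.I) - F (s + θ' * Complex.I)‖ ≤ M * |θ - θ'| := by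
  have hd : ∀ y ∈ Set.Icc (-b) b, HasDerivWithinAt (fun y : ℝ => F (s + y * Complex.I))
      (deriv F (s + y * Complex.I) * Complex.I) (Set.Icc (-b) b) y := by
    intro y hy
    have h1 : HasDerivAt (fun t : ℂ => s + t * Complex.I) Complex.I (y : ℂ) := by
      simpa using ((hasDerivAt_id (y : ℂ)).mul_const Complex.I).const_add (s : ℂ)
    have h2 := ((hF y (abs_le.2 hy)).hasDerivAt.comp (y : ℂ) h1).comp_ofReal
    exact h2.hasDerivWithinAt
  have := (convex_Icc (-b) b).norm_image_sub_le_of_norm_hasDerivWithin_le hd (C := M)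
    (by
      intro y hy
      rw [norm_mul, Complex.norm_I, mul_one]
      exact hb y (abs_le.2 hy)) (abs_le.1 hθ') (abs_le.1 hθ)
  simpa using this

lemma deriv_periodic {G : ℂ → ℂ} {s₀ s₁ : ℝ} {c : ℂ}
    (hper : ∀ w ∈ vertStrip s₀ s₁, G (w + c) = G w) :
    ∀ w ∈ vertStrip s₀ s₁, deriv G (w + c) = deriv G w := by
  intro w hw
  rw [← deriv_comp_add_const]
  apply Filter.EventuallyEq.deriv_eq
  filter_upwards [(isOpen_vertStrip s₀ s₁).mem_nhds hw] with x hx using hper x hx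

/-- A nonvanishing periodic function on a strip with bounded logarithmic derivative behaves like
an exponential away from the boundary of the strip. -/
lemma exists_periodic_log_asymptotics {H : ℂ → ℂ} {s₀ s₁ C L : ℝ} (hL : 2 ≤ L)
    (hs : s₀ + 2 * L ≤ s₁) (hH : DifferentiableOn ℂ H (vertStrip s₀ s₁))
    (hper : ∀ w ∈ vertStrip s₀ s₁, H (w + 2 * Real.pi * Complex.I) = H w)
    (hne : ∀ w ∈ vertStrip s₀ s₁, H w ≠ 0)
    (hb : ∀ w ∈ vertStrip s₀ s₁, ‖deriv H w‖ ≤ C * ‖H w‖) (hη : 120 * C * Real.exp (-L) ≤ 1) :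
    ∃ m : ℤ, |(m : ℝ)| ≤ C ∧ ∃ κ : ℂ, κ ≠ 0 ∧ ∀ σ θ : ℝ, s₀ + L ≤ σ → σ ≤ s₁ - L →
      |θ| ≤ Real.pi → ‖H (σ + θ * Complex.I) - κ * Complex.exp (m * (σ + θ * Complex.I))‖ ≤
        2 * (120 * C * Real.exp (-L)) * (‖κ‖ * Real.exp (m * σ)) := by
  have hpi := Real.pi_pos
  have hpi4 := Real.pi_le_four
  have hopen := isOpen_vertStrip s₀ s₁
  have hmem : ∀ σ θ : ℝ, s₀ < σ → σ < s₁ → ((σ : ℂ) + θ * Complex.I) ∈ vertStrip s₀ s₁ := by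
    intro σ θ h1 h2
    exact ⟨by simpa using h1, by simpa using h2⟩
  have hnemp : (vertStrip s₀ s₁).Nonempty := ⟨_, hmem (s₀ + L) 0 (by linarith) (by linarith)⟩
  obtain ⟨h, hhd, hexp⟩ := exists_holomorphic_log hopen (convex_vertStrip s₀ s₁) hnemp hH hne
  have hha : ∀ w ∈ vertStrip s₀ s₁, DifferentiableAt ℂ h w := fun w hw =>
    hhd.differentiableAt (hopen.mem_nhds hw)
  have hdH : ∀ w ∈ vertStrip s₀ s₁, deriv H w = H w * deriv h w := by
    intro w hw
    have h1 : H =ᶠ[nhds w] fun w => Complex.exp (h w) := by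
      filter_upwards [hopen.mem_nhds hw] with x hx using (hexp x hx).symm
    rw [h1.deriv_eq, ((hha w hw).hasDerivAt.cexp).deriv, hexp w hw]
  have hk : DifferentiableOn ℂ (deriv h) (vertStrip s₀ s₁) := hhd.deriv hopen
  have hkb : ∀ w ∈ vertStrip s₀ s₁, ‖deriv h w‖ ≤ C := by
    intro w hw
    have h1 := hb w hw
    rw [hdH w hw, norm_mul, mul_comm] at h1
    exact le_of_mul_le_mul_right h1 (norm_pos_iff.2 (hne w hw))
  have hC : 0 ≤ C := (norm_nonneg _).trans (hkb _ hnemp.some_mem)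
  have hmemper : ∀ w ∈ vertStrip s₀ s₁, w + 2 * Real.pi * Complex.I ∈ vertStrip s₀ s₁ := by
    intro w hw
    exact ⟨by simpa using hw.1, by simpa using hw.2⟩
  have hkper : ∀ w ∈ vertStrip s₀ s₁, deriv h (w + 2 * Real.pi * Complex.I) = deriv h w := by
    intro w hw
    have h1 := deriv_periodic hper w hw
    rw [hdH w hw, hdH _ (hmemper w hw), hper w hw] at h1
    exact mul_left_cancel₀ (hne w hw) h1
  obtain ⟨w₀, hw₀⟩ := hnemp
  have hconst : ∀ w ∈ vertStrip s₀ s₁, h (w + 2 * Real.pi * Complex.I) - h w =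
      h (w₀ + 2 * Real.pi * Complex.I) - h w₀ := by
    intro w hw
    have := (convex_vertStrip s₀ s₁).norm_image_sub_le_of_norm_hasDerivWithin_le
      (f := fun w => h (w + 2 * Real.pi * Complex.I) - h w) (f' := fun _ => 0) (C := 0)
      (x := w₀) (y := w) (by
        intro x hx
        have h1 := (HasDerivAt.comp_add_const x _ (hha _ (hmemper x hx)).hasDerivAt).sub
          (hha x hx).hasDerivAt
        rw [hkper x hx, sub_self] at h1
        exact h1.hasDerivWithinAt) (by simp) hw₀ hw
    simpa [sub_eq_zero] using this
  obtain ⟨m, hm⟩ : ∃ m : ℤ, h (w₀ + 2 * Real.pi * Complex.I) - h w₀ =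
      m * (2 * Real.pi * Complex.I) := by
    rw [← Complex.exp_eq_one_iff, Complex.exp_sub, hexp _ (hmemper _ hw₀), hexp _ hw₀, hper _ hw₀,
      div_self (hne _ hw₀)]
  have hInt : ∀ a' θ : ℝ, s₀ < a' → a' < s₁ →
      (∫ y : ℝ in (θ - Real.pi)..(θ + Real.pi), deriv h (a' + y * Complex.I)) =
        2 * Real.pi * m := by
    intro a' θ h1 h2
    have hcont : Continuous fun y : ℝ => ((a' : ℂ) + y * Complex.I) := by fun_prop
    have hFTC := intervalIntegral.integral_eq_sub_of_hasDerivAt (a := θ - Real.pi)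
      (b := θ + Real.pi) (f := fun y : ℝ => -Complex.I * h (a' + y * Complex.I))
      (f' := fun y : ℝ => deriv h (a' + y * Complex.I)) (by
        intro y _
        have e1 : HasDerivAt (fun t : ℂ => a' + t * Complex.I) Complex.I (y : ℂ) := by
          simpa using ((hasDerivAt_id (y : ℂ)).mul_const Complex.I).const_add (a' : ℂ)
        have e2 := (((hha _ (hmem a' y h1 h2)).hasDerivAt.comp (y : ℂ) e1).comp_ofReal).const_mul
          (-Complex.I)
        convert! e2 using 1
        linear_combination (deriv h (a' + y * Complex.I)) * Complex.I_mul_I)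
      ((hk.continuousOn.comp hcont.continuousOn fun y _ => hmem a' y h1 h2).intervalIntegrable)
    rw [hFTC]
    have e3 : (a' : ℂ) + ((θ + Real.pi : ℝ) : ℂ) * Complex.I =
        (a' + ((θ - Real.pi : ℝ) : ℂ) * Complex.I) + 2 * Real.pi * Complex.I := by
      push_cast; ring
    have e4 := hconst _ (hmem a' (θ - Real.pi) h1 h2)
    rw [hm] at e4
    rw [e3, ← mul_sub, e4]
    linear_combination (-(2 : ℂ) * Real.pi * m) * Complex.I_mul_I
  have hmC : |(m : ℝ)| ≤ C := by
    have h1 := intervalIntegral.norm_integral_le_of_norm_le_const (a := 0 - Real.pi)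
      (b := 0 + Real.pi) (C := C) (f := fun y : ℝ => deriv h ((s₀ + L : ℝ) + y * Complex.I))
      (fun y _ => hkb _ (hmem (s₀ + L) y (by linarith) (by linarith)))
    rw [hInt (s₀ + L) 0 (by linarith) (by linarith),
      show (0 + Real.pi) - (0 - Real.pi) = 2 * Real.pi by ring,
      abs_of_pos (by positivity : 0 < 2 * Real.pi)] at h1
    have h2 : ‖(2 * Real.pi * m : ℂ)‖ = 2 * Real.pi * |(m : ℝ)| := by
      rw [norm_mul, norm_mul, Complex.norm_real, Complex.norm_intCast]
      simp [abs_of_pos hpi]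
    rw [h2] at h1
    nlinarith
  have hexp1 : Real.exp 1 ≤ 3 := by
    have := Real.exp_one_lt_d9
    linarith
  have hdec : ∀ σ θ : ℝ, s₀ + L ≤ σ → σ ≤ s₁ - L → ‖deriv h (σ + θ * Complex.I) - m‖ ≤
      12 * C * (Real.exp (σ - s₁) + Real.exp (-(σ - s₀))) := by
    intro σ θ h1 h2
    have h3 := norm_integral_sub_le hk hkper hkb (w := σ + θ * Complex.I) (a := s₀ + 1)
      (a' := s₁ - 1) (by linarith) (by simp; linarith) (by simp; linarith) (by linarith)
    rw [hInt _ _ (by linarith) (by linarith), ← mul_sub, norm_mul, norm_sub_rev] at h3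
    have h4 : ‖(2 * Real.pi : ℂ)‖ = 2 * Real.pi := by
      rw [norm_mul, Complex.norm_real]
      simp [abs_of_pos hpi]
    rw [h4] at h3
    have h5 := le_of_mul_le_mul_left h3 (by positivity)
    refine h5.trans ?_
    have h6 : (σ + θ * Complex.I : ℂ).re = σ := by simp
    rw [h6]
    have h7 : Real.exp (-(s₁ - 1 - σ)) = Real.exp 1 * Real.exp (σ - s₁) := by
      rw [← Real.exp_add]; congr 1; ring
    have h8 : Real.exp (-(σ - (s₀ + 1))) = Real.exp 1 * Real.exp (-(σ - s₀)) := by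
      rw [← Real.exp_add]; congr 1; ring
    rw [h7, h8]
    have h9 : Real.exp 1 * (Real.exp (σ - s₁) + Real.exp (-(σ - s₀))) ≤
        3 * (Real.exp (σ - s₁) + Real.exp (-(σ - s₀))) := by gcongr
    nlinarith
  set j : ℂ → ℂ := fun w => h w - m * w with hj
  have hja : ∀ w ∈ vertStrip s₀ s₁, HasDerivAt j (deriv h w - m) w := by
    intro w hw
    have h1 := (hha w hw).hasDerivAt.sub ((hasDerivAt_id w).const_mul (m : ℂ))
    rw [mul_one] at h1
    exact h1
  set p := s₀ + L with hp
  have hjb : ∀ σ θ : ℝ, p ≤ σ → σ ≤ s₁ - L → |θ| ≤ Real.pi →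
      ‖j (σ + θ * Complex.I) - j (p + (0 : ℝ) * Complex.I)‖ ≤ 120 * C * Real.exp (-L) := by
    intro σ θ h1 h2 h3
    have hor := norm_sub_le_of_horizontal (F := j) (θ := θ) h1
      (fun t ht => (hja _ (hmem t θ (by linarith [ht.1]) (by linarith [ht.2]))).differentiableAt)
      (B := fun t => 12 * C * (Real.exp (t - s₁) - Real.exp (-(t - s₀))))
      (B' := fun t => 12 * C * (Real.exp (t - s₁) + Real.exp (-(t - s₀))))
      (by
        intro t
        have d1 : HasDerivAt (fun t => Real.exp (t - s₁)) (Real.exp (t - s₁)) t := by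
          simpa using ((hasDerivAt_id t).sub_const s₁).exp
        have d2 : HasDerivAt (fun t => Real.exp (-(t - s₀))) (-Real.exp (-(t - s₀))) t := by
          simpa using ((hasDerivAt_id t).sub_const s₀).neg.exp
        have := (d1.sub d2).const_mul (12 * C)
        rw [sub_neg_eq_add] at this
        exact this)
      (by
        intro t ht
        rw [(hja _ (hmem t θ (by linarith [ht.1]) (by linarith [ht.2]))).deriv]
        exact hdec t θ ht.1 (ht.2.trans h2))
    have ver := norm_sub_le_of_vertical (F := j) (s := p) (b := Real.pi)
      (M := 24 * C * Real.exp (-L)) (θ := θ) (θ' := 0) h3 (by simpa using hpi.le)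
      (fun y _ => (hja _ (hmem p y (by linarith) (by linarith))).differentiableAt) (by
        intro y _
        rw [(hja _ (hmem p y (by linarith) (by linarith))).deriv]
        refine (hdec p y le_rfl (by linarith)).trans ?_
        have e1 : Real.exp (p - s₁) ≤ Real.exp (-L) := Real.exp_le_exp.2 (by linarith)
        have e2 : Real.exp (-(p - s₀)) ≤ Real.exp (-L) := Real.exp_le_exp.2 (by linarith)
        nlinarith)
    have e1 : Real.exp (σ - s₁) ≤ Real.exp (-L) := Real.exp_le_exp.2 (by linarith)
    have e2 : Real.exp (-(p - s₀)) ≤ Real.exp (-L) := Real.exp_le_exp.2 (by linarith)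
    have e3 := Real.exp_pos (p - s₁)
    have e4 := Real.exp_pos (-(σ - s₀))
    have hor' : ‖j (σ + θ * Complex.I) - j (p + θ * Complex.I)‖ ≤ 24 * C * Real.exp (-L) := by
      refine hor.trans ?_
      rw [← mul_sub, mul_assoc, mul_assoc, show (24 : ℝ) = 12 * 2 by norm_num, mul_assoc]
      refine mul_le_mul_of_nonneg_left ?_ (by norm_num)
      rw [mul_left_comm]
      refine mul_le_mul_of_nonneg_left ?_ hC
      linarith
    have ver' : ‖j (p + θ * Complex.I) - j (p + (0 : ℝ) * Complex.I)‖ ≤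
        24 * C * Real.exp (-L) * 4 := by
      refine ver.trans ?_
      rw [sub_zero]
      exact mul_le_mul_of_nonneg_left (h3.trans hpi4) (by positivity)
    calc _ ≤ ‖j (σ + θ * Complex.I) - j (p + θ * Complex.I)‖ +
          ‖j (p + θ * Complex.I) - j (p + (0 : ℝ) * Complex.I)‖ := norm_sub_le_norm_sub_add_norm_sub _ _ _
      _ ≤ _ := by linarith
  refine ⟨m, hmC, Complex.exp (j (p + (0 : ℝ) * Complex.I)), Complex.exp_ne_zero _, ?_⟩
  intro σ θ h1 h2 h3
  have h4 := hjb σ θ h1 h2 h3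
  set w : ℂ := σ + θ * Complex.I with hw
  have hwS : w ∈ vertStrip s₀ s₁ := hmem σ θ (by linarith) (by linarith)
  set jp := j (p + (0 : ℝ) * Complex.I)
  have h5 : H w = Complex.exp jp * Complex.exp (m * w) * Complex.exp (j w - jp) := by
    rw [← hexp w hwS, ← Complex.exp_add, ← Complex.exp_add]
    congr 1
    simp only [hj]
    ring
  rw [h5, ← mul_sub_one, norm_mul, norm_mul, mul_comm]
  have h6 : ‖Complex.exp (m * w)‖ = Real.exp (m * σ) := by
    rw [Complex.norm_exp]
    congr 1
    simp [hw]
  rw [h6]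
  refine mul_le_mul_of_nonneg_right ?_ (by positivity)
  refine (Complex.norm_exp_sub_one_le (h4.trans hη)).trans ?_
  linarith

/-- A periodic function on a strip whose derivative is nonvanishing with bounded logarithmic
derivative behaves like a translated nonconstant exponential. -/
lemma ring_asymptotics (C : ℝ) (hC : 0 ≤ C) : ∃ L : ℝ, 2 ≤ L ∧ ∀ (s₀ s₁ : ℝ) (G : ℂ → ℂ),
    s₀ + 2 * L ≤ s₁ → DifferentiableOn ℂ G (vertStrip s₀ s₁) →
    (∀ w ∈ vertStrip s₀ s₁, G (w + 2 * Real.pi * Complex.I) = G w) →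
    (∀ w ∈ vertStrip s₀ s₁, deriv G w ≠ 0) →
    (∀ w ∈ vertStrip s₀ s₁, ‖deriv (deriv G) w‖ ≤ C * ‖deriv G w‖) →
    ∃ m : ℤ, m ≠ 0 ∧ ∃ c₀ : ℂ, ∃ κ : ℝ, 0 < κ ∧ ∀ σ θ : ℝ, s₀ + L ≤ σ → σ ≤ s₁ - L →
      |θ| ≤ Real.pi → κ * Real.exp (m * σ) / 2 ≤ ‖G (σ + θ * Complex.I) - c₀‖ ∧
        ‖G (σ + θ * Complex.I) - c₀‖ ≤ 2 * (κ * Real.exp (m * σ)) := by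
  have hpi := Real.pi_pos
  have hpi4 := Real.pi_le_four
  obtain ⟨L, hL2, hL⟩ : ∃ L : ℝ, 2 ≤ L ∧ 120 * C * Real.exp (-L) * (8 * (1 + 4 * C)) ≤ 1 := by
    have h1 : Filter.Tendsto (fun L : ℝ => 120 * C * Real.exp (-L) * (8 * (1 + 4 * C)))
        Filter.atTop (nhds (120 * C * 0 * (8 * (1 + 4 * C)))) :=
      (Real.tendsto_exp_neg_atTop_nhds_zero.const_mul _).mul_const _
    have h2 := (h1.eventually_le_const (by norm_num : 120 * C * 0 * (8 * (1 + 4 * C)) < 1)).and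
      (Filter.eventually_ge_atTop 2)
    obtain ⟨L, h3, h4⟩ := h2.exists
    exact ⟨L, h4, h3⟩
  refine ⟨L, hL2, ?_⟩
  intro s₀ s₁ G hs hG hper hne hb
  set η := 120 * C * Real.exp (-L) with hηdef
  have hη0 : 0 ≤ η := by positivity
  have hη8 : η ≤ 1 / 8 := by nlinarith
  have hopen := isOpen_vertStrip s₀ s₁
  have hmem : ∀ σ θ : ℝ, s₀ < σ → σ < s₁ → ((σ : ℂ) + θ * Complex.I) ∈ vertStrip s₀ s₁ := by
    intro σ θ h1 h2
    exact ⟨by simpa using h1, by simpa using h2⟩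
  have hGa : ∀ w ∈ vertStrip s₀ s₁, DifferentiableAt ℂ G w := fun w hw =>
    hG.differentiableAt (hopen.mem_nhds hw)
  obtain ⟨m, hm, κ, hκ, hasym⟩ := exists_periodic_log_asymptotics hL2 hs (hG.deriv hopen)
    (deriv_periodic hper) hne hb (by linarith)
  have hκ' := norm_pos_iff.2 hκ
  have hm0 : m ≠ 0 := by
    rintro rfl
    have hR : ∀ w ∈ vertStrip s₀ s₁, HasDerivAt (fun w => G w - κ * w) (deriv G w - κ) w := by
      intro w hw
      have h1 := (hGa w hw).hasDerivAt.sub ((hasDerivAt_id w).const_mul κ)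
      rw [mul_one] at h1
      exact h1
    have ver := norm_sub_le_of_vertical (F := fun w => G w - κ * w) (s := s₀ + L) (b := Real.pi)
      (M := 2 * η * ‖κ‖) (θ := Real.pi) (θ' := -Real.pi) (by rw [abs_of_pos hpi])
      (by rw [abs_neg, abs_of_pos hpi])
      (fun y _ => (hR _ (hmem (s₀ + L) y (by linarith) (by linarith))).differentiableAt) (by
        intro y hy
        rw [(hR _ (hmem (s₀ + L) y (by linarith) (by linarith))).deriv]
        simpa using hasym (s₀ + L) y le_rfl (by linarith) hy)
    have e1 : ((s₀ + L : ℝ) : ℂ) + (Real.pi : ℝ) * Complex.I =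
        (((s₀ + L : ℝ) : ℂ) + ((-Real.pi : ℝ) : ℂ) * Complex.I) + 2 * Real.pi * Complex.I := by
      push_cast; ring
    have e2 := hper _ (hmem (s₀ + L) (-Real.pi) (by linarith) (by linarith))
    rw [e1, e2] at ver
    have e3 : ∀ g x : ℂ, g - κ * (x + 2 * Real.pi * Complex.I) - (g - κ * x) =
        -(κ * (2 * Real.pi * Complex.I)) := by intros; ring
    rw [e3, norm_neg, norm_mul, norm_mul, norm_mul, Complex.norm_I, Complex.norm_real] at ver
    simp only [Complex.norm_ofNat, Real.norm_eq_abs, abs_of_pos hpi, mul_one, sub_neg_eq_add] at ver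
    rw [abs_of_pos (by positivity)] at ver
    have : ‖κ‖ * (2 * Real.pi) * (1 - 2 * η) ≤ 0 := by nlinarith
    have : 0 < ‖κ‖ * (2 * Real.pi) * (1 - 2 * η) := by
      apply mul_pos (by positivity); linarith
    linarith
  have hmR : (m : ℝ) ≠ 0 := by exact_mod_cast hm0
  have hmC : (m : ℂ) ≠ 0 := by exact_mod_cast hm0
  have hm1 : 1 ≤ |(m : ℝ)| := by
    rw [← Int.cast_abs]
    exact_mod_cast Int.one_le_abs hm0
  set Q : ℂ → ℂ := fun w => G w - κ * Complex.exp (m * w) / m with hQ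
  have hQa : ∀ w ∈ vertStrip s₀ s₁, HasDerivAt Q (deriv G w - κ * Complex.exp (m * w)) w := by
    intro w hw
    have h1 : HasDerivAt (fun w : ℂ => (m : ℂ) * w) m w := by
      simpa using (hasDerivAt_id w).const_mul (m : ℂ)
    have h2 := (hGa w hw).hasDerivAt.sub ((h1.cexp.const_mul κ).div_const (m : ℂ))
    convert! h2 using 1
    field_simp
  have hQb : ∀ σ θ : ℝ, s₀ + L ≤ σ → σ ≤ s₁ - L → |θ| ≤ Real.pi →
      ‖deriv Q (σ + θ * Complex.I)‖ ≤ 2 * η * ‖κ‖ * Real.exp (m * σ) := by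
    intro σ θ h1 h2 h3
    rw [(hQa _ (hmem σ θ (by linarith) (by linarith))).deriv]
    refine (hasym σ θ h1 h2 h3).trans (le_of_eq (by ring))
  have hB : ∀ t, HasDerivAt (fun t : ℝ => 2 * η * ‖κ‖ * (Real.exp (m * t) / m))
      (2 * η * ‖κ‖ * Real.exp (m * t)) t := by
    intro t
    have h1 : HasDerivAt (fun t : ℝ => (m : ℝ) * t) m t := by
      simpa using (hasDerivAt_id t).const_mul (m : ℝ)
    have h2 := (h1.exp.div_const (m : ℝ)).const_mul (2 * η * ‖κ‖)
    convert! h2 using 1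
    field_simp
  obtain ⟨p, hp1, hp2, hp⟩ : ∃ p : ℝ, s₀ + L ≤ p ∧ p ≤ s₁ - L ∧ ∀ σ θ : ℝ, s₀ + L ≤ σ →
      σ ≤ s₁ - L → |θ| ≤ Real.pi → (m : ℝ) * p ≤ m * σ ∧
      ‖Q (σ + θ * Complex.I) - Q (p + θ * Complex.I)‖ ≤
        2 * η * ‖κ‖ * (Real.exp (m * σ) / |(m : ℝ)|) := by
    rcases lt_or_gt_of_ne hmR with hneg | hpos
    · refine ⟨s₁ - L, by linarith, le_rfl, fun σ θ h1 h2 h3 => ⟨by nlinarith, ?_⟩⟩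
      rw [norm_sub_rev]
      refine (norm_sub_le_of_horizontal h2 (fun t ht => (hQa _ (hmem t θ (by linarith [ht.1])
        (by linarith [ht.2]))).differentiableAt) hB
        (fun t ht => hQb t θ (h1.trans ht.1) ht.2 h3)).trans ?_
      rw [abs_of_neg hneg, div_neg, mul_neg]
      have : 2 * η * ‖κ‖ * (Real.exp (m * (s₁ - L)) / m) ≤ 0 :=
        mul_nonpos_of_nonneg_of_nonpos (by positivity)
          (div_nonpos_of_nonneg_of_nonpos (by positivity) hneg.le)
      linarith
    · refine ⟨s₀ + L, le_rfl, by linarith, fun σ θ h1 h2 h3 => ⟨by nlinarith, ?_⟩⟩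
      refine (norm_sub_le_of_horizontal h1 (fun t ht => (hQa _ (hmem t θ (by linarith [ht.1])
        (by linarith [ht.2]))).differentiableAt) hB
        (fun t ht => hQb t θ ht.1 (ht.2.trans h2) h3)).trans ?_
      rw [abs_of_pos hpos]
      have : 0 ≤ 2 * η * ‖κ‖ * (Real.exp (m * (s₀ + L)) / m) := by positivity
      linarith
  refine ⟨m, hm0, Q (p + (0 : ℝ) * Complex.I), ‖κ‖ / |(m : ℝ)|, by positivity, ?_⟩
  intro σ θ h1 h2 h3
  obtain ⟨hmp, hor⟩ := hp σ θ h1 h2 h3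
  have ver := norm_sub_le_of_vertical (F := Q) (s := p) (b := Real.pi)
    (M := 2 * η * ‖κ‖ * Real.exp (m * p)) (θ := θ) (θ' := 0) h3 (by simpa using hpi.le)
    (fun y _ => (hQa _ (hmem p y (by linarith) (by linarith))).differentiableAt)
    (fun y hy => hQb p y hp1 hp2 hy)
  rw [sub_zero] at ver
  set E := Real.exp (m * σ) with hE
  have hEpos : 0 < E := Real.exp_pos _
  have hver : ‖Q (p + θ * Complex.I) - Q (p + (0 : ℝ) * Complex.I)‖ ≤ 2 * η * ‖κ‖ * E * 4 := by
    refine ver.trans ?_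
    have : Real.exp (m * p) ≤ E := Real.exp_le_exp.2 hmp
    gcongr
    exact h3.trans hpi4
  set c₀ := Q (p + (0 : ℝ) * Complex.I)
  set w : ℂ := σ + θ * Complex.I with hw
  have htot : ‖Q w - c₀‖ ≤ ‖κ‖ / |(m : ℝ)| * E / 2 := by
    refine (norm_sub_le_norm_sub_add_norm_sub _ (Q (p + θ * Complex.I)) _).trans ?_
    have e1 : 2 * η * ‖κ‖ * (E / |(m : ℝ)|) + 2 * η * ‖κ‖ * E * 4 =
        ‖κ‖ / |(m : ℝ)| * E * (2 * η * (1 + 4 * |(m : ℝ)|)) := by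
      field_simp
    have e2 : 2 * η * (1 + 4 * |(m : ℝ)|) ≤ 1 / 2 := by nlinarith
    calc _ ≤ 2 * η * ‖κ‖ * (E / |(m : ℝ)|) + 2 * η * ‖κ‖ * E * 4 := add_le_add hor hver
      _ = _ := e1
      _ ≤ ‖κ‖ / |(m : ℝ)| * E * (1 / 2) := by gcongr
      _ = _ := by ring
  have hmain : ‖κ * Complex.exp (m * w) / m‖ = ‖κ‖ / |(m : ℝ)| * E := by
    rw [norm_div, norm_mul, Complex.norm_exp, Complex.norm_intCast]
    have : ((m : ℂ) * w).re = m * σ := by simp [hw]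
    rw [this]
    ring
  have hdec : G w - c₀ = κ * Complex.exp (m * w) / m + (Q w - c₀) := by
    simp only [hQ]; ring
  rw [hdec]
  constructor
  · have := norm_sub_le_norm_add (κ * Complex.exp (m * w) / m) (Q w - c₀)
    linarith
  · have := norm_add_le (κ * Complex.exp (m * w) / m) (Q w - c₀)
    have : 0 ≤ ‖κ‖ / |(m : ℝ)| * E := by positivity
    linarith

lemma card_fibre_le_of_map_ne_zero {f : MvPolynomial (Fin 2) ℂ} {δ : ℕ} (hδ : f.totalDegree ≤ δ)
    {x : ℂ} (hx : Polynomial.map (eval fun _ => x) (finSuccEquiv ℂ 1 f) ≠ 0) (T : Finset ℂ)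
    (hT : ∀ y ∈ T, eval ![y, x] f = 0) : T.card ≤ δ := by
  have h1 : T ⊆ (Polynomial.map (eval fun _ => x) (finSuccEquiv ℂ 1 f)).roots.toFinset := by
    intro y hy
    rw [Multiset.mem_toFinset, Polynomial.mem_roots hx, Polynomial.IsRoot, ← eval_pair_eq]
    exact hT y hy
  calc T.card ≤ _ := Finset.card_le_card h1
    _ ≤ _ := Multiset.toFinset_card_le _
    _ ≤ _ := Polynomial.card_roots' _
    _ ≤ _ := Polynomial.natDegree_map_le
    _ = _ := natDegree_finSuccEquiv f
    _ ≤ _ := degreeOf_le_totalDegree f 0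
    _ ≤ δ := hδ

section Strip

variable {f : MvPolynomial (Fin 2) ℂ} {S : Finset ℂ} {z : ℂ} {t₀ t₁ : ℝ} {Y : ℂ → ℂ}

lemma notMem_of_strip_far
    (hfar : ∀ ζ ∈ vertStrip t₀ t₁, ∀ s ∈ S, Real.exp ζ.re / 2 ≤ ‖z + Complex.exp ζ - s‖) :
    ∀ ζ ∈ vertStrip t₀ t₁, z + Complex.exp ζ ∉ S := by
  intro ζ hζ hs
  have := hfar ζ hζ _ hs
  rw [sub_self, norm_zero] at this
  linarith [Real.exp_pos ζ.re]

lemma exists_strip_deriv_bound (δ : ℕ) : ∃ M : ℝ, 0 < M ∧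
    ∀ (f : MvPolynomial (Fin 2) ℂ) (S : Finset ℂ) (z : ℂ) (t₀ t₁ : ℝ) (Y : ℂ → ℂ), Irreducible f →
      f.totalDegree ≤ δ → IsSingularBound f S →
      (∀ ζ ∈ vertStrip t₀ t₁, ∀ s ∈ S, Real.exp ζ.re / 2 ≤ ‖z + Complex.exp ζ - s‖) →
      DifferentiableOn ℂ Y (vertStrip t₀ t₁) →
      (∀ ζ ∈ vertStrip t₀ t₁, eval ![Y ζ, z + Complex.exp ζ] f = 0) →
      ∀ ζ ∈ vertStrip t₀ t₁, deriv Y ζ ≠ 0 ∧ ‖deriv (deriv Y) ζ‖ ≤ M * ‖deriv Y ζ‖ := by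
  obtain ⟨M, hM, H⟩ := exists_log_slope_bound δ
  refine ⟨2 * M + 1, by positivity, ?_⟩
  intro f S z t₀ t₁ Y hf hδ hS hfar hYd hY ζ hζ
  have hS' := notMem_of_strip_far hfar
  set E := Real.exp ζ.re with hE
  have hEpos : 0 < E := Real.exp_pos _
  have hnE : ‖Complex.exp ζ‖ = E := Complex.norm_exp ζ
  set x := z + Complex.exp ζ with hx
  have hball : ∀ w ∈ Metric.ball x (E / 2), w ∉ S := by
    intro w hw hwS
    have h1 := hfar ζ hζ w hwS
    rw [mem_ball_iff_norm, norm_sub_rev] at hw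
    linarith
  obtain ⟨y, hyd, hy0, hyz⟩ := hS.exists_branch Metric.isOpen_ball (convex_ball x (E / 2))
    (e := fun w => w) differentiableOn_id hball (ζ₀ := x) (y₀ := Y ζ)
    (Metric.mem_ball_self (by positivity)) (hY ζ hζ)
  have hbr : IsBranch f (Metric.ball x (E / 2)) y := ⟨hyd, hyz⟩
  have hec : Continuous fun ζ : ℂ => z + Complex.exp ζ := by fun_prop
  obtain ⟨ρ, hρ, hρsub⟩ := Metric.mem_nhds_iff.1 (Filter.inter_mem
    ((isOpen_vertStrip t₀ t₁).mem_nhds hζ)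
    (hec.continuousAt.preimage_mem_nhds (Metric.ball_mem_nhds x (by positivity : 0 < E / 2))))
  have hloc : ∀ w ∈ Metric.ball ζ ρ, Y w = y (z + Complex.exp w) := by
    refine hS.branch_unique (convex_ball ζ ρ).isPreconnected (e := fun w => z + Complex.exp w)
      hec.continuousOn (fun w hw => hS' w (hρsub hw).1)
      (hYd.continuousOn.mono fun w hw => (hρsub hw).1)
      (hyd.continuousOn.comp hec.continuousOn fun w hw => (hρsub hw).2)
      (fun w hw => hY w (hρsub hw).1) (fun w hw => hyz _ (hρsub hw).2)
      (Metric.mem_ball_self hρ) hy0.symm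
  have he : ∀ w : ℂ, HasDerivAt (fun w => z + Complex.exp w) (Complex.exp w) w := fun w =>
    (Complex.hasDerivAt_exp w).const_add z
  have hyat : ∀ w ∈ Metric.ball ζ ρ, DifferentiableAt ℂ y (z + Complex.exp w) := fun w hw =>
    hyd.differentiableAt (Metric.isOpen_ball.mem_nhds (hρsub hw).2)
  have hd1 : ∀ w ∈ Metric.ball ζ ρ, deriv Y w = deriv y (z + Complex.exp w) * Complex.exp w := by
    intro w hw
    have h1 : Y =ᶠ[nhds w] fun w => y (z + Complex.exp w) := by
      filter_upwards [Metric.isOpen_ball.mem_nhds hw] with v hv using hloc v hv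
    rw [h1.deriv_eq]
    exact ((hyat w hw).hasDerivAt.comp w (he w)).deriv
  have hd2 : deriv (deriv Y) ζ = deriv (deriv y) x * Complex.exp ζ * Complex.exp ζ +
      deriv y x * Complex.exp ζ := by
    have h1 : deriv Y =ᶠ[nhds ζ] fun w => deriv y (z + Complex.exp w) * Complex.exp w := by
      filter_upwards [Metric.ball_mem_nhds ζ hρ] with v hv using hd1 v hv
    rw [h1.deriv_eq]
    have h2 : DifferentiableAt ℂ (deriv y) (z + Complex.exp ζ) :=
      (hyd.deriv Metric.isOpen_ball).differentiableAt
        (Metric.isOpen_ball.mem_nhds (hρsub (Metric.mem_ball_self hρ)).2)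
    exact ((h2.hasDerivAt.comp ζ (he ζ)).mul (Complex.hasDerivAt_exp ζ)).deriv
  have hxb : x ∈ Metric.ball x (E / 2) := Metric.mem_ball_self (by positivity)
  have hd1' := hd1 ζ (Metric.mem_ball_self hρ)
  have hyne := hbr.deriv_ne_zero hS Metric.isOpen_ball hxb (hball x hxb)
  refine ⟨by rw [hd1']; exact mul_ne_zero hyne (Complex.exp_ne_zero _), ?_⟩
  have hH := H f S x (E / 2) y hf hδ hS (by positivity) hball hbr
  rw [hd2, hd1', norm_mul, hnE]
  refine (norm_add_le _ _).trans ?_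
  rw [norm_mul, norm_mul, norm_mul, hnE]
  have : E * (E / 2 * ‖deriv (deriv y) x‖) ≤ E * (M * ‖deriv y x‖) := by gcongr
  rw [← hx]
  nlinarith

lemma IsSingularBound.exists_strip_period {δ : ℕ} (hδ : f.totalDegree ≤ δ)
    (hS : IsSingularBound f S)
    (heS : ∀ ζ ∈ vertStrip t₀ t₁, z + Complex.exp ζ ∉ S) (ht : t₀ < t₁)
    (hYd : DifferentiableOn ℂ Y (vertStrip t₀ t₁))
    (hY : ∀ ζ ∈ vertStrip t₀ t₁, eval ![Y ζ, z + Complex.exp ζ] f = 0) :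
    ∃ b : ℕ, 0 < b ∧ b ≤ δ ∧ ∀ ζ ∈ vertStrip t₀ t₁,
      Y (ζ + b * (2 * Real.pi * Complex.I)) = Y ζ := by
  have hmem : ∀ (k : ℕ), ∀ ζ ∈ vertStrip t₀ t₁,
      ζ + k * (2 * Real.pi * Complex.I) ∈ vertStrip t₀ t₁ := by
    intro k ζ hζ
    exact ⟨by simpa using hζ.1, by simpa using hζ.2⟩
  have hexp : ∀ (k : ℕ) (ζ : ℂ), Complex.exp (ζ + k * (2 * Real.pi * Complex.I)) =
      Complex.exp ζ := fun k ζ => Complex.exp_periodic.nat_mul k ζ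
  set ζ₀ : ℂ := (((t₀ + t₁) / 2 : ℝ) : ℂ)
  have hζ₀ : ζ₀ ∈ vertStrip t₀ t₁ := by
    constructor <;> simp only [ζ₀, Complex.ofReal_re] <;> linarith
  have hval : ∀ k : ℕ, ∀ ζ ∈ vertStrip t₀ t₁,
      eval ![Y (ζ + k * (2 * Real.pi * Complex.I)), z + Complex.exp ζ] f = 0 := by
    intro k ζ hζ
    have := hY _ (hmem k ζ hζ)
    rwa [hexp] at this
  have hcard := card_fibre_le_of_map_ne_zero hδ (hS.map_ne_zero (heS ζ₀ hζ₀))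
    ((Finset.range (δ + 1)).image fun k : ℕ => Y (ζ₀ + k * (2 * Real.pi * Complex.I)))
    (by
      intro y hy
      obtain ⟨k, -, rfl⟩ := Finset.mem_image.1 hy
      exact hval k ζ₀ hζ₀)
  obtain ⟨i, hi, j, hj, hij, heq⟩ := Finset.exists_ne_map_eq_of_card_lt_of_maps_to
    (lt_of_le_of_lt hcard (by simp : δ < (Finset.range (δ + 1)).card))
    (fun k hk => Finset.mem_coe.2 (Finset.mem_image_of_mem _ hk))
  wlog hlt : i < j generalizing i j
  · exact this j hj i hi hij.symm heq.symm (lt_of_le_of_ne (not_lt.1 hlt) hij.symm)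
  have hcont : ∀ k : ℕ, ContinuousOn (fun ζ => Y (ζ + k * (2 * Real.pi * Complex.I)))
      (vertStrip t₀ t₁) := fun k =>
    hYd.continuousOn.comp (by fun_prop) fun ζ hζ => hmem k ζ hζ
  have huniq := hS.branch_unique (convex_vertStrip t₀ t₁).isPreconnected
    (e := fun ζ => z + Complex.exp ζ) (by fun_prop) heS (hcont i) (hcont j) (hval i) (hval j)
    hζ₀ heq
  have hj' := Finset.mem_range.1 hj
  refine ⟨j - i, by omega, by omega, fun ζ hζ => ?_⟩
  have hm : ζ - i * (2 * Real.pi * Complex.I) ∈ vertStrip t₀ t₁ :=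
    ⟨by simpa using hζ.1, by simpa using hζ.2⟩
  have h1 := huniq _ hm
  simp only [sub_add_cancel] at h1
  rw [h1, Nat.cast_sub hlt.le]
  congr 1
  ring

end Strip

/-- On an annulus free of singular points, a branch of an algebraic curve behaves like a translated
power function. -/
lemma exists_annulus_asymptotics (δ : ℕ) : ∃ L : ℝ, 0 < L ∧
    ∀ (f : MvPolynomial (Fin 2) ℂ) (S : Finset ℂ) (z : ℂ) (t₀ t₁ : ℝ) (Y : ℂ → ℂ), Irreducible f →
      f.totalDegree ≤ δ → IsSingularBound f S →
      (∀ ζ ∈ vertStrip t₀ t₁, ∀ s ∈ S, Real.exp ζ.re / 2 ≤ ‖z + Complex.exp ζ - s‖) →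
      DifferentiableOn ℂ Y (vertStrip t₀ t₁) →
      (∀ ζ ∈ vertStrip t₀ t₁, eval ![Y ζ, z + Complex.exp ζ] f = 0) → t₀ + 2 * L ≤ t₁ →
      ∃ μ : ℝ, 1 ≤ |μ| * δ ∧ ∃ c₀ : ℂ, ∃ κ : ℝ, 0 < κ ∧ ∀ ζ : ℂ, t₀ + L ≤ ζ.re → ζ.re ≤ t₁ - L →
        |ζ.im| ≤ Real.pi → κ * Real.exp (μ * ζ.re) / 2 ≤ ‖Y ζ - c₀‖ ∧
          ‖Y ζ - c₀‖ ≤ 2 * (κ * Real.exp (μ * ζ.re)) := by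
  obtain ⟨M, hM, H⟩ := exists_strip_deriv_bound δ
  obtain ⟨L, hL, HL⟩ := ring_asymptotics (δ * M) (by positivity)
  refine ⟨(δ + 1) * L, by positivity, ?_⟩
  intro f S z t₀ t₁ Y hf hδ hS hfar hYd hY ht
  have hLpos : 0 < (δ + 1) * L := by positivity
  obtain ⟨b, hb0, hbδ, hper⟩ := hS.exists_strip_period hδ (notMem_of_strip_far hfar)
    (by linarith) hYd hY
  have hbR : (0 : ℝ) < b := by exact_mod_cast hb0
  have hb1 : (1 : ℝ) ≤ b := by exact_mod_cast hb0
  have hbC : (b : ℂ) ≠ 0 := by exact_mod_cast hb0.ne'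
  have hbδR : (b : ℝ) ≤ δ := by exact_mod_cast hbδ
  have hbL : (b : ℝ) * L ≤ (δ + 1) * L := by gcongr; linarith
  have hmem : ∀ w ∈ vertStrip (t₀ / b) (t₁ / b), (b : ℂ) * w ∈ vertStrip t₀ t₁ := by
    intro w hw
    obtain ⟨h1, h2⟩ := hw
    rw [div_lt_iff₀ hbR] at h1
    rw [lt_div_iff₀ hbR] at h2
    exact ⟨by simpa [mul_comm] using h1, by simpa [mul_comm] using h2⟩
  have hG1 : deriv (fun w : ℂ => Y (b * w)) = fun w => (b : ℂ) * deriv Y (b * w) := by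
    ext w; simpa using deriv_comp_mul_left (b : ℂ) Y w
  have hG2 : ∀ w, deriv (fun w : ℂ => (b : ℂ) * deriv Y (b * w)) w =
      b * (b * deriv (deriv Y) (b * w)) := by
    intro w
    rw [deriv_const_mul_field]
    congr 1
    simpa using deriv_comp_mul_left (b : ℂ) (deriv Y) w
  obtain ⟨m, hm0, c₀, κ, hκ, hasym⟩ := HL (t₀ / b) (t₁ / b) (fun w => Y (b * w))
    (by
      rw [← sub_nonneg, show t₁ / b - (t₀ / b + 2 * L) = (t₁ - (t₀ + 2 * (b * L))) / b by
        field_simp]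
      apply div_nonneg _ hbR.le
      linarith)
    (hYd.comp (by fun_prop) hmem)
    (by
      intro w hw
      rw [← hper _ (hmem w hw)]
      congr 1
      ring)
    (by
      intro w hw
      rw [hG1]
      exact mul_ne_zero hbC (H f S z t₀ t₁ Y hf hδ hS hfar hYd hY _ (hmem w hw)).1)
    (by
      intro w hw
      rw [hG1, hG2, norm_mul, norm_mul, norm_mul, Complex.norm_natCast]
      have h1 := (H f S z t₀ t₁ Y hf hδ hS hfar hYd hY _ (hmem w hw)).2
      calc (b : ℝ) * (b * ‖deriv (deriv Y) (b * w)‖) ≤ δ * (b * (M * ‖deriv Y (b * w)‖)) := by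
            gcongr
        _ = _ := by ring)
  have hm1 : 1 ≤ |(m : ℝ)| := by
    rw [← Int.cast_abs]
    exact_mod_cast Int.one_le_abs hm0
  refine ⟨m / b, ?_, c₀, κ, hκ, ?_⟩
  · rw [abs_div, abs_of_pos hbR, div_mul_eq_mul_div, le_div_iff₀ hbR]
    nlinarith
  · intro ζ h1 h2 h3
    have h4 := hasym (ζ.re / b) (ζ.im / b)
      (by rw [← sub_nonneg, show ζ.re / b - (t₀ / b + L) = (ζ.re - (t₀ + b * L)) / b by field_simp]
          apply div_nonneg _ hbR.le; linarith)
      (by rw [← sub_nonneg, show t₁ / b - L - ζ.re / b = (t₁ - b * L - ζ.re) / b by field_simp]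
          apply div_nonneg _ hbR.le; linarith)
      (by rw [abs_div, abs_of_pos hbR]; exact (div_le_self (abs_nonneg _) hb1).trans h3)
    have h5 : (b : ℂ) * (((ζ.re / b : ℝ) : ℂ) + ((ζ.im / b : ℝ) : ℂ) * Complex.I) = ζ := by
      push_cast
      rw [mul_add, mul_div_cancel₀ _ hbC, ← mul_assoc, mul_div_cancel₀ _ hbC, Complex.re_add_im]
    rw [h5, show (m : ℝ) * (ζ.re / b) = m / b * ζ.re by ring] at h4
    exact h4

lemma ringCount_eq (A : Finset ℂ) (u w : ℂ) (r η : ℝ) (p : ℂ → Prop) {_ : DecidablePred p}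
    (h : ∀ x, p x ↔ ‖x - u‖ ≤ r ∧ η ≤ ‖x - w‖) : ringCount A u w r η = (A.filter p).card := by
  unfold ringCount
  congr 1
  ext x
  simp [h]

lemma RingNear.mono {A : Finset ℂ} {τ τ' : ℝ} (h : τ ≤ τ') {a b : ℂ} (hab : RingNear A τ a b) :
    RingNear A τ' a b := by
  obtain ⟨u, w, ρ, η, h1, h2, h3, h4, h5, h6⟩ := hab
  exact ⟨u, w, ρ, η, h1, h2, h3, h4, h5, h6.trans h⟩

/-- Among regions of bounded overlap in two finite sets, one is light in both. -/
lemma exists_light_index {ι : Type*} (J : Finset ι) (hJ : J.Nonempty) {A B : Finset ℂ}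
    (hA : A.Nonempty) (hB : B.Nonempty) (X Y : ι → ℂ → Prop) (K : ℕ)
    (hX : ∀ x, (J.filter fun j => X j x).card ≤ K) (hY : ∀ y, (J.filter fun j => Y j y).card ≤ K) :
    ∃ j ∈ J, (A.filter (X j)).card * J.card ≤ 2 * K * A.card ∧
      (B.filter (Y j)).card * J.card ≤ 2 * K * B.card := by
  have hsum : ∀ (D : Finset ℂ) (Z : ι → ℂ → Prop), (∀ x, (J.filter fun j => Z j x).card ≤ K) →
      ∑ j ∈ J, (D.filter (Z j)).card ≤ D.card * K := by
    intro D Z hZ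
    calc ∑ j ∈ J, (D.filter (Z j)).card = ∑ x ∈ D, (J.filter fun j => Z j x).card := by
          simp only [Finset.card_filter]
          exact Finset.sum_comm
      _ ≤ ∑ x ∈ D, K := Finset.sum_le_sum fun x _ => hZ x
      _ = _ := by simp
  have hApos := hA.card_pos
  have hBpos := hB.card_pos
  obtain ⟨j, hj, hle⟩ := Finset.exists_le_of_sum_le hJ
    (f := fun j => ((A.filter (X j)).card * B.card + (B.filter (Y j)).card * A.card) * J.card)
    (g := fun _ => 2 * K * (A.card * B.card)) (by
      rw [← Finset.sum_mul, Finset.sum_add_distrib, ← Finset.sum_mul, ← Finset.sum_mul,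
        Finset.sum_const, smul_eq_mul, mul_comm J.card]
      refine Nat.mul_le_mul_right _ ?_
      have h1 := Nat.mul_le_mul_right B.card (hsum A X hX)
      have h2 := Nat.mul_le_mul_right A.card (hsum B Y hY)
      nlinarith)
  refine ⟨j, hj, ?_, ?_⟩
  · refine Nat.le_of_mul_le_mul_right (c := B.card) ?_ hBpos
    nlinarith [Nat.zero_le ((B.filter (Y j)).card * A.card * J.card)]
  · refine Nat.le_of_mul_le_mul_right (c := A.card) ?_ hApos
    nlinarith [Nat.zero_le ((A.filter (X j)).card * B.card * J.card)]

lemma exists_separated_subset {α : Type*} (T : Finset α) (R : α → α → Prop) (hr : ∀ a, R a a)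
    (hs : ∀ a b, R a b → R b a) : ∃ T' ⊆ T, (∀ a ∈ T', ∀ b ∈ T', a ≠ b → ¬ R a b) ∧
      ∀ a ∈ T, ∃ b ∈ T', R a b := by
  obtain ⟨Sep, hSep⟩ : ∃ Sep : Finset α → Prop, ∀ U, Sep U ↔ ∀ a ∈ U, ∀ b ∈ U, a ≠ b → ¬ R a b :=
    ⟨_, fun _ => Iff.rfl⟩
  obtain ⟨T', hT', hmax⟩ := Finset.exists_max_image (T.powerset.filter Sep) Finset.card
    ⟨∅, by simp [hSep]⟩
  rw [Finset.mem_filter, Finset.mem_powerset, hSep] at hT'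
  refine ⟨T', hT'.1, hT'.2, fun a ha => ?_⟩
  by_contra! hcon
  have haT : a ∉ T' := fun h => hcon a h (hr a)
  have := hmax (insert a T') (by
    rw [Finset.mem_filter, Finset.mem_powerset, hSep]
    refine ⟨Finset.insert_subset ha hT'.1, ?_⟩
    intro b hb c hc hbc
    rcases Finset.mem_insert.1 hb with rfl | hb' <;> rcases Finset.mem_insert.1 hc with rfl | hc'
    · exact absurd rfl hbc
    · exact hcon c hc'
    · exact fun h => hcon b hb' (hs _ _ h)
    · exact hT'.2 b hb' c hc' hbc)
  rw [Finset.card_insert_of_notMem haT] at this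
  omega

lemma card_le_mul_of_cover {α β : Type*} (T : Finset α) (T' : Finset β) (R : α → β → Prop) (N : ℕ)
    (hc : ∀ a ∈ T, ∃ b ∈ T', R a b) (hN : ∀ b ∈ T', (T.filter fun a => R a b).card ≤ N) :
    T.card ≤ N * T'.card := by
  have hsub : T ⊆ T'.biUnion fun b => T.filter fun a => R a b := by
    intro a ha
    obtain ⟨b, hb, hab⟩ := hc a ha
    exact Finset.mem_biUnion.2 ⟨b, hb, Finset.mem_filter.2 ⟨ha, hab⟩⟩
  rw [mul_comm]
  exact (Finset.card_le_card hsub).trans (Finset.card_biUnion_le_card_mul _ _ _ hN)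

lemma exists_large_fibre {α β : Type*} (s : Finset α) (t : Finset β) (g : α → β)
    (hg : ∀ a ∈ s, g a ∈ t) (ht : t.Nonempty) :
    ∃ y ∈ t, ∃ s' ⊆ s, (∀ a ∈ s', g a = y) ∧ s.card ≤ t.card * s'.card := by
  obtain ⟨y, hy, h⟩ := Finset.exists_max_image t (fun y => (s.filter fun a => g a = y).card) ht
  refine ⟨y, hy, s.filter fun a => g a = y, Finset.filter_subset _ _,
    fun a ha => (Finset.mem_filter.1 ha).2, ?_⟩
  rw [mul_comm]
  exact card_le_mul_of_cover s t (fun a b => g a = b) _ (fun a ha => ⟨g a, hg a ha, rfl⟩) h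

lemma exists_alternating_pairs {α : Type*} (T : Finset α) (t : α → ℝ) (ht : Set.InjOn t T) :
    ∃ (m : ℕ) (a b : Fin m → α), T.card ≤ 2 * m + 1 ∧ (∀ i, a i ∈ T ∧ b i ∈ T ∧ t (a i) < t (b i)) ∧
      ∀ i j, i < j → t (b i) < t (a j) := by
  set n := T.card
  have hcard : (T.image t).card = n := Finset.card_image_of_injOn ht
  set e := (T.image t).orderEmbOfFin hcard
  have he : ∀ i, ∃ x ∈ T, t x = e i := fun i =>
    Finset.mem_image.1 ((T.image t).orderEmbOfFin_mem hcard i)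
  choose x hxT hx using he
  refine ⟨n / 2, fun i => x ⟨2 * i, by omega⟩, fun i => x ⟨2 * i + 1, by omega⟩, by omega, ?_, ?_⟩
  · intro i
    refine ⟨hxT _, hxT _, ?_⟩
    rw [hx, hx]
    exact e.strictMono (Fin.mk_lt_mk.2 (by omega))
  · intro i j hij
    simp only [hx]
    apply e.strictMono
    rw [Fin.mk_lt_mk]
    have : (i : ℕ) < j := hij
    omega

lemma mul_exp_lt_exp {u v : ℝ} (h : 84 ≤ v - u) : 84 * Real.exp u < Real.exp v := by
  have h1 := Real.add_one_le_exp (v - u)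
  have h2 : Real.exp v = Real.exp (v - u) * Real.exp u := by rw [← Real.exp_add]; congr 1; ring
  rw [h2]
  have := Real.exp_pos u
  nlinarith

/-- A light pair among points organised along concentric rings. -/
lemma exists_ring_pair {A B : Finset ℂ} (hA : A.Nonempty) (hB : B.Nonempty) (T : Finset (ℂ × ℂ))
    (z c₀ : ℂ) (t : ℂ × ℂ → ℝ) (Λ μ κ : ℝ) (hΛ : 84 ≤ Λ) (hμ : 84 ≤ |μ| * Λ) (hκ : 0 < κ)
    (hsep : ∀ p ∈ T, ∀ q ∈ T, p ≠ q → Λ < |t p - t q|) (hx : ∀ p ∈ T, ‖p.1 - z‖ = Real.exp (t p))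
    (hy : ∀ p ∈ T, κ * Real.exp (μ * t p) / 2 ≤ ‖p.2 - c₀‖ ∧
      ‖p.2 - c₀‖ ≤ 2 * (κ * Real.exp (μ * t p))) (hT : 3 ≤ T.card) :
    ∃ p ∈ T, ∃ q ∈ T, p ≠ q ∧ RingNear A (6 * A.card / T.card) p.1 q.1 ∧
      RingNear B (6 * B.card / T.card) p.2 q.2 := by
  have hinj : Set.InjOn t T := by
    intro p hp q hq hpq
    by_contra hne
    have := hsep p hp q hq hne
    rw [hpq, sub_self, abs_zero] at this
    linarith
  obtain ⟨m, a, b, hm, hab, hord⟩ := exists_alternating_pairs T t hinj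
  have hgap : ∀ p ∈ T, ∀ q ∈ T, t p < t q → Λ < t q - t p := by
    intro p hp q hq hpq
    have := hsep q hq p hp (by rintro rfl; exact lt_irrefl _ hpq)
    rwa [abs_of_pos (by linarith)] at this
  have hgap' : ∀ i j, i < j → Λ < t (a j) - t (b i) := fun i j hij =>
    hgap _ (hab i).2.1 _ (hab j).1 (hord i j hij)
  have hμne : μ ≠ 0 := by
    rintro rfl
    norm_num at hμ
  obtain ⟨lo, hi, hlo, hhi, hloq, hhiq, hdis⟩ : ∃ lo hi : Fin m → ℝ,
      (∀ i, lo i ≤ μ * t (a i)) ∧ (∀ i, μ * t (a i) ≤ hi i) ∧ (∀ i, lo i ≤ μ * t (b i)) ∧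
      (∀ i, μ * t (b i) ≤ hi i) ∧
      ∀ i j, i < j → 84 ≤ lo j - hi i ∨ 84 ≤ lo i - hi j := by
    rcases lt_or_gt_of_ne hμne with hneg | hpos
    · rw [abs_of_neg hneg] at hμ
      refine ⟨fun i => μ * t (b i), fun i => μ * t (a i), ?_, fun i => le_rfl, fun i => le_rfl, ?_, ?_⟩
      · intro i; nlinarith [(hab i).2.2]
      · intro i; nlinarith [(hab i).2.2]
      · intro i j hij
        right
        nlinarith [hgap' i j hij]
    · rw [abs_of_pos hpos] at hμ
      refine ⟨fun i => μ * t (a i), fun i => μ * t (b i), fun i => le_rfl, ?_, ?_, fun i => le_rfl, ?_⟩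
      · intro i; nlinarith [(hab i).2.2]
      · intro i; nlinarith [(hab i).2.2]
      · intro i j hij
        left
        nlinarith [hgap' i j hij]
  set X : Fin m → ℂ → Prop := fun i x =>
    ‖x - z‖ ≤ 7 * Real.exp (t (b i)) ∧ Real.exp (t (a i)) / 3 ≤ ‖x - z‖
  set Y : Fin m → ℂ → Prop := fun i y =>
    ‖y - c₀‖ ≤ 7 * (2 * (κ * Real.exp (hi i))) ∧ κ * Real.exp (lo i) / 6 ≤ ‖y - c₀‖
  have huniq : ∀ (Z : Fin m → ℂ → Prop), (∀ i j, i < j → ∀ x, Z i x → ¬ Z j x) →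
      ∀ x, ((Finset.univ : Finset (Fin m)).filter fun j => Z j x).card ≤ 1 := by
    intro Z hZ x
    rw [Finset.card_le_one]
    intro i hi j hj
    rw [Finset.mem_filter] at hi hj
    rcases lt_trichotomy i j with h | h | h
    · exact absurd hj.2 (hZ i j h x hi.2)
    · exact h
    · exact absurd hi.2 (hZ j i h x hj.2)
  have hm1 : 0 < m := by omega
  obtain ⟨j, -, hjA, hjB⟩ := exists_light_index (Finset.univ : Finset (Fin m))
    ⟨⟨0, hm1⟩, Finset.mem_univ _⟩ hA hB X Y 1
    (huniq X (by
      intro i j hij x h1 h2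
      have := mul_exp_lt_exp (u := t (b i)) (v := t (a j)) (by linarith [hgap' i j hij])
      have := Real.exp_pos (t (b i))
      linarith [h1.1, h2.2]))
    (huniq Y (by
      intro i j hij x h1 h2
      rcases hdis i j hij with h | h
      · have h3 := mul_lt_mul_of_pos_left (mul_exp_lt_exp h) hκ
        linarith [h1.1, h2.2]
      · have h3 := mul_lt_mul_of_pos_left (mul_exp_lt_exp h) hκ
        linarith [h2.1, h1.2]))
  rw [Finset.card_univ, Fintype.card_fin] at hjA hjB
  have hTm : T.card ≤ 3 * m := by omega
  have hTpos : (0 : ℝ) < T.card := by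
    have : 0 < T.card := by omega
    exact_mod_cast this
  have hconv : ∀ (c d : ℕ), c * m ≤ 2 * 1 * d → (c : ℝ) ≤ 6 * d / T.card := by
    intro c d h
    rw [le_div_iff₀ hTpos]
    have : c * T.card ≤ 6 * d := by nlinarith
    exact_mod_cast this
  obtain ⟨haT, hbT, hlt⟩ := hab j
  refine ⟨a j, haT, b j, hbT, by rintro h; rw [h] at hlt; exact lt_irrefl _ hlt, ?_, ?_⟩
  · have hle : Real.exp (t (a j)) ≤ Real.exp (t (b j)) := Real.exp_le_exp.2 hlt.le
    refine ⟨z, z, Real.exp (t (b j)), Real.exp (t (a j)) / 3, by positivity, ?_, ?_, ?_, ?_,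
      hconv _ _ (by
        convert! hjA using 2; exact ringCount_eq A _ _ _ _ (X j) fun _ => Iff.rfl)⟩
    · rw [hx _ haT]; exact hle
    · rw [hx _ hbT]
    · rw [hx _ haT]; linarith
    · rw [hx _ hbT]; linarith
  · have e1 := mul_le_mul_of_nonneg_left (Real.exp_le_exp.2 (hlo j)) hκ.le
    have e2 := mul_le_mul_of_nonneg_left (Real.exp_le_exp.2 (hhi j)) hκ.le
    have e3 := mul_le_mul_of_nonneg_left (Real.exp_le_exp.2 (hloq j)) hκ.le
    have e4 := mul_le_mul_of_nonneg_left (Real.exp_le_exp.2 (hhiq j)) hκ.le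
    have f1 := hy _ haT
    have f2 := hy _ hbT
    refine ⟨c₀, c₀, 2 * (κ * Real.exp (hi j)), κ * Real.exp (lo j) / 6, by positivity, ?_, ?_, ?_, ?_,
      hconv _ _ (by
        convert! hjB using 2; exact ringCount_eq B _ _ _ _ (Y j) fun _ => Iff.rfl)⟩ <;> linarith [f1.1, f1.2, f2.1, f2.2]

/-- Points of a curve in the annulus between two circles, all enclosing the same singular points,
lie on few branches over the annulus, and one branch contains a light pair. -/
lemma exists_annulus_pair (δ : ℕ) : ∃ Λ : ℝ, 0 < Λ ∧
    ∀ (f : MvPolynomial (Fin 2) ℂ) (S : Finset ℂ), Irreducible f → f.totalDegree ≤ δ →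
      IsSingularBound f S → ∀ (A B : Finset ℂ), A.Nonempty → B.Nonempty →
      ∀ (T : Finset (ℂ × ℂ)) (z : ℂ), z ∈ S →
      (∀ p ∈ T, p.1 ∉ S ∧ eval ![p.2, p.1] f = 0) →
      (∀ p ∈ T, ∀ q ∈ T, ∀ s ∈ S, ‖s - z‖ < ‖p.1 - z‖ → ‖s - z‖ < ‖q.1 - z‖) →
      (∀ p ∈ T, ∀ q ∈ T, p ≠ q → Λ < |Real.log ‖p.1 - z‖ - Real.log ‖q.1 - z‖|) →
      2 * δ + 3 ≤ T.card →
      ∃ p ∈ T, ∃ q ∈ T, p ≠ q ∧ RingNear A (6 * δ * A.card / (T.card - 2)) p.1 q.1 ∧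
        RingNear B (6 * δ * B.card / (T.card - 2)) p.2 q.2 := by
  obtain ⟨L, hL, H⟩ := exists_annulus_asymptotics δ
  refine ⟨L + 2 + 84 * (δ + 1), by positivity, ?_⟩
  set Λ := L + 2 + 84 * ((δ : ℝ) + 1) with hΛ
  have hΛ84 : 84 * ((δ : ℝ) + 1) ≤ Λ := by linarith
  intro f S hf hδ hS A B hA hB T z hz hT hnest hsep hcard
  set t : ℂ × ℂ → ℝ := fun p => Real.log ‖p.1 - z‖ with ht
  have hpos : ∀ p ∈ T, 0 < ‖p.1 - z‖ := by
    intro p hp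
    rw [norm_pos_iff, sub_ne_zero]
    rintro h
    exact (hT p hp).1 (h ▸ hz)
  have hexp : ∀ p ∈ T, ‖p.1 - z‖ = Real.exp (t p) := fun p hp => (Real.exp_log (hpos p hp)).symm
  have hTne : T.Nonempty := Finset.card_pos.1 (by omega)
  obtain ⟨p₀, hp₀, hmin⟩ := Finset.exists_min_image T t hTne
  obtain ⟨p₁, hp₁, hmax⟩ := Finset.exists_max_image T t hTne
  obtain ⟨T', hT', hT'card⟩ : ∃ T' : Finset (ℂ × ℂ), T' = (T.erase p₀).erase p₁ ∧
      T.card - 2 ≤ T'.card := by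
    refine ⟨_, rfl, ?_⟩
    have h1 := Finset.pred_card_le_card_erase (s := T) (a := p₀)
    have h2 := Finset.pred_card_le_card_erase (s := T.erase p₀) (a := p₁)
    omega
  have hT'mem : ∀ p ∈ T', p ∈ T ∧ t p₀ + Λ < t p ∧ t p < t p₁ - Λ := by
    intro p hp
    rw [hT', Finset.mem_erase, Finset.mem_erase] at hp
    obtain ⟨h1, h2, h3⟩ := hp
    refine ⟨h3, ?_, ?_⟩
    · have := hsep p h3 p₀ hp₀ h2
      rw [abs_of_nonneg (sub_nonneg.2 (hmin p h3))] at this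
      simp only [ht]; linarith
    · have := hsep p₁ hp₁ p h3 (Ne.symm h1)
      rw [abs_of_nonneg (sub_nonneg.2 (hmax p h3))] at this
      simp only [ht]; linarith
  set t₀ := t p₀ + 1 with ht₀
  set t₁ := t p₁ - 1 with ht₁
  have hfar : ∀ ζ ∈ vertStrip t₀ t₁, ∀ s ∈ S,
      Real.exp ζ.re / 2 ≤ ‖z + Complex.exp ζ - s‖ := by
    intro ζ hζ s hs
    have hE : ‖Complex.exp ζ‖ = Real.exp ζ.re := Complex.norm_exp ζ
    have he1 : 2 ≤ Real.exp 1 := by linarith [Real.add_one_le_exp 1]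
    by_cases hlt : ‖s - z‖ < ‖p₀.1 - z‖
    · rw [hexp p₀ hp₀] at hlt
      have h1 : Real.exp (t p₀) * Real.exp 1 < Real.exp ζ.re := by
        rw [← Real.exp_add]; exact Real.exp_lt_exp.2 hζ.1
      have h2 := norm_sub_norm_le (Complex.exp ζ) (s - z)
      rw [hE, show Complex.exp ζ - (s - z) = z + Complex.exp ζ - s by ring] at h2
      nlinarith [Real.exp_pos (t p₀)]
    · have hge : ¬ ‖s - z‖ < ‖p₁.1 - z‖ := fun h => hlt (hnest p₁ hp₁ p₀ hp₀ s hs h)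
      rw [not_lt, hexp p₁ hp₁] at hge
      have h1 : Real.exp ζ.re * Real.exp 1 < Real.exp (t p₁) := by
        rw [← Real.exp_add]
        apply Real.exp_lt_exp.2
        linarith [hζ.2]
      have h2 := norm_sub_norm_le (s - z) (Complex.exp ζ)
      rw [hE, norm_sub_rev (s - z), show Complex.exp ζ - (s - z) = z + Complex.exp ζ - s by ring] at h2
      nlinarith [Real.exp_pos ζ.re]
  have heS := notMem_of_strip_far hfar
  have hζ : ∀ p ∈ T', (Complex.log (p.1 - z)).re = t p ∧ z + Complex.exp (Complex.log (p.1 - z)) = p.1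
      ∧ Complex.log (p.1 - z) ∈ vertStrip t₀ t₁ := by
    intro p hp
    obtain ⟨h1, h2, h3⟩ := hT'mem p hp
    have hre : (Complex.log (p.1 - z)).re = t p := Complex.log_re _
    refine ⟨hre, ?_, ?_, ?_⟩
    · rw [Complex.exp_log (norm_pos_iff.1 (hpos p h1))]; ring
    · rw [hre]; linarith
    · rw [hre]; linarith
  have hbr : ∀ p ∈ T', ∃ Y : ℂ → ℂ, DifferentiableOn ℂ Y (vertStrip t₀ t₁) ∧
      Y (Complex.log (p.1 - z)) = p.2 ∧
      ∀ ζ ∈ vertStrip t₀ t₁, eval ![Y ζ, z + Complex.exp ζ] f = 0 := by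
    intro p hp
    obtain ⟨h1, h2, h3⟩ := hζ p hp
    refine hS.exists_branch (isOpen_vertStrip t₀ t₁) (convex_vertStrip t₀ t₁)
      (e := fun ζ => z + Complex.exp ζ) (by fun_prop) heS h3 ?_
    simp only [h2]
    exact (hT p (hT'mem p hp).1).2
  have hbr' : ∀ p, ∃ Y : ℂ → ℂ, p ∈ T' → DifferentiableOn ℂ Y (vertStrip t₀ t₁) ∧
      Y (Complex.log (p.1 - z)) = p.2 ∧
      ∀ ζ ∈ vertStrip t₀ t₁, eval ![Y ζ, z + Complex.exp ζ] f = 0 := by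
    intro p
    by_cases hp : p ∈ T'
    · obtain ⟨Y, hY⟩ := hbr p hp
      exact ⟨Y, fun _ => hY⟩
    · exact ⟨0, fun h => absurd h hp⟩
  choose Y hY using hbr'
  have hT'ne : T'.Nonempty := Finset.card_pos.1 (by omega)
  obtain ⟨q₀, hq₀⟩ := hT'ne
  set ζ₀ := Complex.log (q₀.1 - z) with hζ₀
  have hζ₀S : ζ₀ ∈ vertStrip t₀ t₁ := (hζ q₀ hq₀).2.2
  obtain ⟨y, hy, T₃, hT₃T', hT₃y, hfib⟩ := exists_large_fibre T' (T'.image fun p => Y p ζ₀) (fun p => Y p ζ₀)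
    (fun p hp => Finset.mem_image_of_mem _ hp) ⟨_, Finset.mem_image_of_mem _ hq₀⟩
  have himg : (T'.image fun p => Y p ζ₀).card ≤ δ := by
    refine card_fibre_le_of_map_ne_zero hδ (hS.map_ne_zero (heS ζ₀ hζ₀S)) _ ?_
    intro w hw
    obtain ⟨p, hp, rfl⟩ := Finset.mem_image.1 hw
    exact (hY p hp).2.2 ζ₀ hζ₀S
  have hT₃card : T'.card ≤ δ * T₃.card := hfib.trans (Nat.mul_le_mul_right _ himg)
  have hT₃3 : 3 ≤ T₃.card := by
    by_contra hlt
    have : T₃.card ≤ 2 := by omega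
    have : δ * T₃.card ≤ δ * 2 := Nat.mul_le_mul_left _ this
    omega
  obtain ⟨q, hq, rfl⟩ := Finset.mem_image.1 hy
  have hYq := hY q hq
  have hval : ∀ p ∈ T₃, Y q (Complex.log (p.1 - z)) = p.2 := by
    intro p hp
    have hpT := hT₃T' hp
    have hYp := hY p hpT
    rw [← hYp.2.1]
    refine (hS.branch_unique (convex_vertStrip t₀ t₁).isPreconnected
      (e := fun ζ => z + Complex.exp ζ) (by fun_prop) heS hYp.1.continuousOn hYq.1.continuousOn
      hYp.2.2 hYq.2.2 hζ₀S (hT₃y p hp) _ (hζ p hpT).2.2).symm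
  have hqT := hT'mem q hq
  obtain ⟨μ, hμ, c₀, κ, hκ, hasym⟩ := H f S z t₀ t₁ (Y q) hf hδ hS hfar hYq.1 hYq.2.2
    (by linarith [hqT.2.1, hqT.2.2])
  obtain ⟨p, hp, p', hp', hne, hXX, hYY⟩ := exists_ring_pair hA hB T₃ z c₀ t Λ μ κ
    (by nlinarith [Nat.cast_nonneg (α := ℝ) δ])
    (by nlinarith [abs_nonneg μ, mul_le_mul_of_nonneg_left hΛ84 (abs_nonneg μ)]) hκ
    (fun p hp q hq hpq => hsep p (hT'mem p (hT₃T' hp)).1 q (hT'mem q (hT₃T' hq)).1 hpq)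
    (fun p hp => hexp p (hT'mem p (hT₃T' hp)).1)
    (by
      intro p hp
      have h1 := hT'mem p (hT₃T' hp)
      have h2 := hζ p (hT₃T' hp)
      have := hasym (Complex.log (p.1 - z)) (by rw [h2.1]; linarith [h1.2.1])
        (by rw [h2.1]; linarith [h1.2.2]) (by rw [Complex.log_im]; exact Complex.abs_arg_le_pi _)
      rwa [h2.1, hval p hp] at this) hT₃3
  have hT3R : (0 : ℝ) < T₃.card := by
    have : 0 < T₃.card := by omega
    exact_mod_cast this
  have hTR : (T.card : ℝ) - 2 ≤ δ * T₃.card := by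
    have : T.card ≤ δ * T₃.card + 2 := by omega
    have : (T.card : ℝ) ≤ δ * T₃.card + 2 := by exact_mod_cast this
    linarith
  have hTpos : (0 : ℝ) < T.card - 2 := by
    have : (3 : ℝ) ≤ T.card := by exact_mod_cast (by omega : 3 ≤ T.card)
    linarith
  have hmono : ∀ n : ℕ, (6 * n / T₃.card : ℝ) ≤ 6 * δ * n / (T.card - 2) := by
    intro n
    rw [div_le_div_iff₀ hT3R hTpos]
    calc (6 * n : ℝ) * (T.card - 2) ≤ 6 * n * (δ * T₃.card) := by gcongr
      _ = _ := by ring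
  exact ⟨p, (hT'mem p (hT₃T' hp)).1, p', (hT'mem p' (hT₃T' hp')).1, hne,
    hXX.mono (hmono _), hYY.mono (hmono _)⟩

/-- The pair lemma for points which are far apart relative to their distance to the
singular points. -/
lemma exists_sparse_pair (δ K : ℕ) (β : ℝ) (hβ : 0 < β) : ∃ C : ℕ,
    ∀ (f : MvPolynomial (Fin 2) ℂ) (S : Finset ℂ), Irreducible f → f.totalDegree ≤ δ →
      IsSingularBound f S → S.card ≤ K → S.Nonempty → ∀ (A B : Finset ℂ) (P : Finset (ℂ × ℂ)),
      (∀ p ∈ P, p.1 ∈ A ∧ p.2 ∈ B ∧ p.1 ∉ S ∧ eval ![p.2, p.1] f = 0) →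
      (∀ p ∈ P, ∀ q ∈ P, p ≠ q → β * Metric.infDist p.1 S < ‖p.1 - q.1‖) → C ≤ P.card →
      ∃ p ∈ P, ∃ q ∈ P, p ≠ q ∧ RingNear A (C * A.card / P.card) p.1 q.1 ∧
        RingNear B (C * B.card / P.card) p.2 q.2 := by
  obtain ⟨Λ, hΛ, H⟩ := exists_annulus_pair δ
  obtain ⟨N, hN, HN⟩ := exists_packing_bound (Real.exp (2 * Λ) / β)
  refine ⟨(K * (K + 1)) * N * (2 * δ + 3) + 18 * δ * (K * (K + 1) * N) + 1, ?_⟩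
  intro f S hf hδ hS hSK hSne A B P hP hsep hcard
  have hPne : P.Nonempty := Finset.card_pos.1 (by omega)
  obtain ⟨p₀, hp₀⟩ := hPne
  have hA : A.Nonempty := ⟨_, (hP p₀ hp₀).1⟩
  have hB : B.Nonempty := ⟨_, (hP p₀ hp₀).2.1⟩
  have hnear : ∀ x : ℂ, ∃ z ∈ S, Metric.infDist x S = ‖x - z‖ := by
    intro x
    obtain ⟨z, hz, h⟩ := S.finite_toSet.isCompact.exists_infDist_eq_dist
      (Finset.coe_nonempty.2 hSne) x
    exact ⟨z, hz, by rw [h, dist_eq_norm]⟩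
  choose nz hnz hnzd using hnear
  set col : ℂ × ℂ → ℂ × ℕ := fun p =>
    (nz p.1, (S.filter fun s => ‖s - nz p.1‖ < ‖p.1 - nz p.1‖).card) with hcol
  obtain ⟨⟨z, n⟩, hzn, T, hTsub, hTcol, hfib⟩ := exists_large_fibre P (S ×ˢ Finset.range (K + 1)) col
    (by
      intro p hp
      refine Finset.mem_product.2 ⟨hnz _, Finset.mem_range.2 ?_⟩
      exact Nat.lt_succ_of_le ((Finset.card_filter_le _ _).trans hSK))
    (hSne.product ⟨0, by simp⟩)
  rw [Finset.card_product, Finset.card_range] at hfib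
  have hPT : P.card ≤ K * (K + 1) * T.card := by
    refine hfib.trans (Nat.mul_le_mul_right _ (Nat.mul_le_mul_right _ hSK))
  have hzS : z ∈ S := (Finset.mem_product.1 hzn).1
  have hTP : ∀ p ∈ T, p ∈ P ∧ nz p.1 = z ∧ (S.filter fun s => ‖s - z‖ < ‖p.1 - z‖).card = n := by
    intro p hp
    have h1 := hTsub hp
    have h2 := hTcol p hp
    simp only [hcol, Prod.mk.injEq] at h2
    obtain ⟨h3, h4⟩ := h2
    rw [h3] at h4
    exact ⟨h1, h3, h4⟩
  have hTpos : ∀ p ∈ T, 0 < ‖p.1 - z‖ := by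
    intro p hp
    rw [norm_pos_iff, sub_ne_zero]
    rintro h
    exact (hP p (hTP p hp).1).2.2.1 (h ▸ hzS)
  obtain ⟨T', hT'T, hT'sep, hT'cov⟩ := exists_separated_subset T
    (fun p q => |Real.log ‖p.1 - z‖ - Real.log ‖q.1 - z‖| ≤ Λ) (by simp [hΛ.le])
    (fun p q h => by rwa [abs_sub_comm])
  have hTT' : T.card ≤ N * T'.card := by
    refine card_le_mul_of_cover T T' _ N hT'cov ?_
    intro q hq
    set τ := Real.log ‖q.1 - z‖ with hτ
    set U := T.filter fun p => |Real.log ‖p.1 - z‖ - τ| ≤ Λ with hU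
    have hUmem : ∀ p ∈ U, p ∈ T ∧ Real.exp (τ - Λ) ≤ ‖p.1 - z‖ ∧ ‖p.1 - z‖ ≤ Real.exp (τ + Λ) := by
      intro p hp
      obtain ⟨h1, h2⟩ := Finset.mem_filter.1 hp
      rw [abs_le] at h2
      refine ⟨h1, ?_, ?_⟩
      · rw [← Real.le_log_iff_exp_le (hTpos p h1)]; linarith
      · rw [← Real.log_le_iff_le_exp (hTpos p h1)]; linarith
    have hUsep : ∀ p ∈ U, ∀ q ∈ U, p ≠ q → β * Real.exp (τ - Λ) < ‖p.1 - q.1‖ := by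
      intro p hp q hq hpq
      have h1 := hUmem p hp
      have h2 := hTP p h1.1
      have h3 := hsep p h2.1 q (hTP q (hUmem q hq).1).1 hpq
      rw [hnzd, h2.2.1] at h3
      have := mul_le_mul_of_nonneg_left h1.2.1 hβ.le
      linarith
    have hr : 0 < β * Real.exp (τ - Λ) := by positivity
    have hinj : Set.InjOn Prod.fst (U : Set (ℂ × ℂ)) := by
      intro p hp q hq hpq
      by_contra hne
      have := hUsep p hp q hq hne
      rw [hpq, sub_self, norm_zero] at this
      linarith
    have hgoal := HN (β * Real.exp (τ - Λ)) z (U.image Prod.fst) hr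
      (by
        intro x hx
        obtain ⟨p, hp, rfl⟩ := Finset.mem_image.1 hx
        refine (hUmem p hp).2.2.trans (le_of_eq ?_)
        rw [← mul_assoc, div_mul_cancel₀ _ hβ.ne', ← Real.exp_add]
        congr 1; ring)
      (by
        intro x hx y hy hxy
        obtain ⟨p, hp, rfl⟩ := Finset.mem_image.1 hx
        obtain ⟨q, hq, rfl⟩ := Finset.mem_image.1 hy
        exact (hUsep p hp q hq (by rintro rfl; exact hxy rfl)).le)
    rwa [Finset.card_image_of_injOn hinj] at hgoal
  have hT'card : 2 * δ + 3 ≤ T'.card := by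
    by_contra hlt
    have h1 : N * T'.card ≤ N * (2 * δ + 3) := Nat.mul_le_mul_left _ (by omega)
    have h2 : K * (K + 1) * T.card ≤ K * (K + 1) * (N * (2 * δ + 3)) :=
      Nat.mul_le_mul_left _ (hTT'.trans h1)
    rw [← mul_assoc] at h2
    omega
  obtain ⟨p, hp, q, hq, hne, hX, hY⟩ := H f S hf hδ hS A B hA hB T' z hzS
    (fun p hp => (hP p (hTP p (hT'T hp)).1).2.2)
    (by
      intro p hp q hq s hs hlt
      have h1 := (hTP p (hT'T hp)).2.2
      have h2 := (hTP q (hT'T hq)).2.2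
      by_contra hge
      have hss : (S.filter fun s => ‖s - z‖ < ‖q.1 - z‖) ⊂ S.filter fun s => ‖s - z‖ < ‖p.1 - z‖ := by
        rw [Finset.ssubset_iff_of_subset]
        · exact ⟨s, Finset.mem_filter.2 ⟨hs, hlt⟩, fun h => hge (Finset.mem_filter.1 h).2⟩
        · intro s' hs'
          obtain ⟨h3, h4⟩ := Finset.mem_filter.1 hs'
          exact Finset.mem_filter.2 ⟨h3, by linarith⟩
      have := Finset.card_lt_card hss
      omega)
    (fun p hp q hq hpq => not_le.1 (hT'sep p hp q hq hpq)) hT'card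
  have hmono : ∀ m : ℕ, (6 * δ * m / (T'.card - 2) : ℝ) ≤
      (((K * (K + 1)) * N * (2 * δ + 3) + 18 * δ * (K * (K + 1) * N) + 1 : ℕ) : ℝ) * m / P.card := by
    intro m
    have hT'R : (3 : ℝ) ≤ T'.card := by exact_mod_cast (by omega : 3 ≤ T'.card)
    have hPR : (0 : ℝ) < P.card := by exact_mod_cast (by omega : 0 < P.card)
    rw [div_le_div_iff₀ (by linarith) hPR]
    have h1 : (P.card : ℝ) ≤ K * (K + 1) * N * T'.card := by
      have : P.card ≤ K * (K + 1) * N * T'.card := by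
        rw [mul_assoc]
        exact hPT.trans (Nat.mul_le_mul_left _ hTT')
      exact_mod_cast this
    have h2 : (P.card : ℝ) ≤ K * (K + 1) * N * (3 * (T'.card - 2)) := by
      refine h1.trans ?_
      have : (T'.card : ℝ) ≤ 3 * (T'.card - 2) := by linarith
      gcongr
    calc (6 * δ * m : ℝ) * P.card ≤ 6 * δ * m * (K * (K + 1) * N * (3 * (T'.card - 2))) := by gcongr
      _ = (18 * δ * (K * (K + 1) * N)) * m * (T'.card - 2) := by ring
      _ ≤ _ := by
        have h3 : (0 : ℝ) ≤ T'.card - 2 := by linarith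
        gcongr
        push_cast
        have : (0 : ℝ) ≤ K * (K + 1) * N * (2 * δ + 3) := by positivity
        linarith
  exact ⟨p, (hTP p (hT'T hp)).1, q, (hTP q (hT'T hq)).1, hne, hX.mono (hmono _), hY.mono (hmono _)⟩

lemma not_dvd_X_sub_C {f : MvPolynomial (Fin 2) ℂ} (hf : Irreducible f) {i j : Fin 2} (hij : i ≠ j)
    (hj : pderiv j f ≠ 0) (a : ℂ) : ¬ f ∣ X i - C a := by
  rintro ⟨g, hg⟩
  have hne : (X i - C a : MvPolynomial (Fin 2) ℂ) ≠ 0 := by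
    intro h
    have := congrArg (eval fun _ => a + 1) h
    simp at this
  have hg0 : g ≠ 0 := by rintro rfl; exact hne (by simpa using hg)
  have hdeg : (X i - C a : MvPolynomial (Fin 2) ℂ).totalDegree ≤ 1 := by
    refine (totalDegree_sub_C_le _ _).trans ?_
    simp
  rw [hg, totalDegree_mul_of_isDomain hf.ne_zero hg0] at hdeg
  have h1 := one_le_totalDegree_of_irreducible hf
  obtain ⟨c, rfl⟩ : ∃ c, g = C c := ⟨_, totalDegree_eq_zero_iff_eq_C.1 (by omega)⟩
  have h2 := congrArg (pderiv j) hg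
  simp only [map_sub, pderiv_X_of_ne hij, pderiv_C, sub_zero, Derivation.leibniz, smul_eq_mul,
    mul_zero, zero_add] at h2
  rcases mul_eq_zero.1 h2.symm with h | h
  · exact hg0 h
  · exact hj h

/-- Axis-parallel lines meet an irreducible curve which is not such a line in boundedly many
points. -/
lemma exists_fibre_bound (δ : ℕ) : ∃ B, ∀ f : MvPolynomial (Fin 2) ℂ, Irreducible f →
    f.totalDegree ≤ δ → ∀ i j : Fin 2, i ≠ j → pderiv j f ≠ 0 → ∀ (a : ℂ) (T : Finset (Fin 2 → ℂ)),
    (∀ x ∈ T, eval x f = 0 ∧ x i = a) → T.card ≤ B := by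
  obtain ⟨B, hB⟩ := exists_bezout_bound (δ + 1)
  refine ⟨B, fun f hf hδ i j hij hj a T hT => ?_⟩
  refine hB f (X i - C a) hf (not_dvd_X_sub_C hf hij hj a) (by omega) ?_ T fun x hx => ?_
  · refine (totalDegree_sub_C_le _ _).trans ?_
    simp
  · refine ⟨(hT x hx).1, ?_⟩
    simp [(hT x hx).2]

lemma surjOn_of_near_affine {Y : ℂ → ℂ} {a b : ℂ} {ε d : ℝ} (ha : a ≠ 0) (hε : 0 ≤ ε) (hd : 0 ≤ d)
    (h : ∀ z w, ‖z - b‖ ≤ d → ‖w - b‖ ≤ d → ‖Y z - Y w - a * (z - w)‖ ≤ ε * ‖a‖ * ‖z - w‖) {y : ℂ}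
    (hy : ‖y - Y b‖ ≤ (1 - ε) * ‖a‖ * d) : ∃ x, ‖x - b‖ ≤ d ∧ Y x = y := by
  have happ : ApproximatesLinearOn Y (ContinuousLinearMap.toSpanSingleton ℂ a)
      (Metric.closedBall b d) ⟨ε * ‖a‖, by positivity⟩ := by
    intro z hz w hw
    rw [Metric.mem_closedBall, dist_eq_norm] at hz hw
    have := h z w hz hw
    rw [ContinuousLinearMap.toSpanSingleton_apply, smul_eq_mul, mul_comm (z - w)]
    exact this
  let g : (ContinuousLinearMap.toSpanSingleton ℂ a).NonlinearRightInverse :=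
    { toFun := fun y => y / a
      nnnorm := ‖a‖₊⁻¹
      bound' := fun y => by
        rw [norm_div, NNReal.coe_inv, coe_nnnorm, div_eq_inv_mul]
      right_inv' := fun y => by
        rw [ContinuousLinearMap.toSpanSingleton_apply, smul_eq_mul, div_mul_cancel₀ _ ha] }
  have hs := happ.surjOn_closedBall_of_nonlinearRightInverse g hd subset_rfl
  obtain ⟨x, hx, hxy⟩ := hs (show y ∈ _ by
    rw [Metric.mem_closedBall, dist_eq_norm]
    refine hy.trans (le_of_eq ?_)
    change _ = (((‖a‖₊⁻¹ : NNReal) : ℝ)⁻¹ - ε * ‖a‖) * d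
    rw [NNReal.coe_inv, coe_nnnorm, inv_inv]
    ring)
  exact ⟨x, by simpa [dist_eq_norm] using hx, hxy⟩

lemma exists_near_affine_pairs : ∃ N : ℕ, ∀ (Y : ℂ → ℂ) (v a : ℂ) (ρ : ℝ), a ≠ 0 →
    (∀ z w, ‖z - v‖ ≤ ρ → ‖w - v‖ ≤ ρ → ‖Y z - Y w - a * (z - w)‖ ≤ 1 / 100 * ‖a‖ * ‖z - w‖) →
    ∀ Q : Finset ℂ, (∀ x ∈ Q, ‖x - v‖ ≤ ρ / 25) → 2 ≤ Q.card →
    ∃ (n : ℕ) (J : Finset (Fin n)) (p q : Fin n → ℂ) (Z : Fin n → ℂ → Prop),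
      Q.card ≤ N * J.card ∧
      (∀ j ∈ J, p j ∈ Q ∧ q j ∈ Q ∧ p j ≠ q j ∧ (∀ x, Z j x → ‖x - v‖ ≤ ρ) ∧
        (∀ (A : Finset ℂ) (τ : ℝ), ((A.filter (Z j)).card : ℝ) ≤ τ → RingNear A τ (p j) (q j)) ∧
        (∀ (A : Finset ℂ) (τ : ℝ), ((A.filter fun y => ∃ x, Z j x ∧ Y x = y).card : ℝ) ≤ τ →
          RingNear A τ (Y (p j)) (Y (q j)))) ∧
      ∀ i ∈ J, ∀ j ∈ J, i ≠ j → ∀ x, ¬ (Z i x ∧ Z j x) := by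
  obtain ⟨N, H⟩ := exists_forest_pairs
  refine ⟨N, fun Y v a ρ ha hY Q hQ hQ2 => ?_⟩
  obtain ⟨n, J, p, q, w, η, hcard, hJ, hdisj⟩ := H Q hQ2
  obtain ⟨Z, hZ⟩ : ∃ Z : Fin n → ℂ → Prop, ∀ j x, Z j x ↔
      ‖x - p j‖ ≤ 8 * ‖p j - q j‖ ∧ η j / 2 ≤ ‖x - w j‖ := ⟨_, fun _ _ => Iff.rfl⟩
  refine ⟨n, J, p, q, Z, hcard, ?_, ?_⟩
  swap
  · rintro i hi j hj hij x ⟨h12, h34⟩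
    obtain ⟨h1, h2⟩ := (hZ _ _).1 h12
    obtain ⟨h3, h4⟩ := (hZ _ _).1 h34
    exact hdisj i hi j hj hij x ⟨h1, h2, h3, h4⟩
  intro j hj
  obtain ⟨hp, hq, hpq, hη, hηp, hηq, hw, -⟩ := hJ j hj
  have hpv := hQ _ hp
  have hqv := hQ _ hq
  have hwv := hQ _ hw
  have hρ : 0 ≤ ρ := by linarith [norm_nonneg (p j - v)]
  have hpqd : ‖p j - q j‖ ≤ ρ / 25 + ρ / 25 := norm_sub_comm_le hpv (by rwa [norm_sub_rev])
  have hball : ∀ x, ‖x - p j‖ ≤ 8 * ‖p j - q j‖ → ‖x - v‖ ≤ ρ := by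
    intro x hx
    have := norm_sub_comm_le hx hpv
    linarith
  refine ⟨hp, hq, hpq, fun x hx => hball x ((hZ _ _).1 hx).1, ?_, ?_⟩
  · intro A τ hτ
    refine ⟨p j, w j, ‖p j - q j‖, η j, hη, by simp, by rw [norm_sub_rev], by linarith, by linarith,
      le_trans ?_ hτ⟩
    unfold ringCount
    refine Nat.cast_le.2 (Finset.card_le_card fun x hx => ?_)
    rw [Finset.mem_filter] at hx ⊢
    exact ⟨hx.1, (hZ _ _).2 ⟨by linarith [hx.2.1, norm_nonneg (p j - q j)], by linarith [hx.2.2]⟩⟩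
  · intro A τ hτ
    have hapos : 0 < ‖a‖ := norm_pos_iff.2 ha
    have lower : ∀ z z', ‖z - v‖ ≤ ρ → ‖z' - v‖ ≤ ρ → 99 / 100 * (‖a‖ * ‖z - z'‖) ≤ ‖Y z - Y z'‖ := by
      intro z z' hz hz'
      have h1 := hY z z' hz hz'
      have h2 := norm_sub_norm_le (a * (z - z')) (Y z - Y z')
      rw [norm_sub_rev (a * _), norm_mul] at h2
      linarith
    have upper : ∀ z z', ‖z - v‖ ≤ ρ → ‖z' - v‖ ≤ ρ → ‖Y z - Y z'‖ ≤ 101 / 100 * (‖a‖ * ‖z - z'‖) := by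
      intro z z' hz hz'
      have h1 := hY z z' hz hz'
      have h2 := norm_sub_norm_le (Y z - Y z') (a * (z - z'))
      rw [norm_mul] at h2
      linarith
    have hpρ : ‖p j - v‖ ≤ ρ := by linarith
    have hqρ : ‖q j - v‖ ≤ ρ := by linarith
    have hwρ : ‖w j - v‖ ≤ ρ := by linarith
    have e1 := mul_le_mul_of_nonneg_left hηp hapos.le
    have e2 := mul_le_mul_of_nonneg_left hηq hapos.le
    have hη0 : 0 ≤ ‖a‖ * η j := by positivity
    refine ⟨Y (p j), Y (w j), ‖Y (p j) - Y (q j)‖, ‖a‖ * η j, hη0, by simp,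
      by rw [norm_sub_rev], ?_, ?_, le_trans ?_ hτ⟩
    · have := lower _ _ hpρ hwρ
      linarith
    · have := lower _ _ hqρ hwρ
      linarith
    unfold ringCount
    refine Nat.cast_le.2 (Finset.card_le_card fun y hy => ?_)
    rw [Finset.mem_filter] at hy ⊢
    have h3 := upper _ _ hpρ hqρ
    have h4 : 0 ≤ ‖a‖ * ‖p j - q j‖ := by positivity
    obtain ⟨x, hx, rfl⟩ := surjOn_of_near_affine (Y := Y) (b := p j) (ε := 1 / 100) (y := y)
      (d := 8 * ‖p j - q j‖) ha (by norm_num) (by positivity)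
      (fun z z' hz hz' => hY z z' (hball z hz) (hball z' hz')) (by linarith [hy.2.1])
    refine ⟨hy.1, x, (hZ _ _).2 ⟨hx, ?_⟩, rfl⟩
    have h5 := upper x (w j) (hball x hx) hwρ
    have h6 : ‖a‖ * (η j / 2) ≤ ‖a‖ * ‖x - w j‖ := by linarith [hy.2.2]
    exact le_of_mul_le_mul_left h6 hapos

lemma infDist_le_add {S : Set ℂ} (x y : ℂ) :
    Metric.infDist x S ≤ Metric.infDist y S + ‖x - y‖ := by
  have := Metric.infDist_le_infDist_add_dist (s := S) (x := x) (y := y)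
  rwa [dist_eq_norm] at this

/-- Points separated on the scale of their distance to `S` have discs of comparable radius with
bounded overlap. -/
lemma exists_disc_overlap_bound (α β : ℝ) (hα' : α < 1 / 2) (hβ : 0 < β) :
    ∃ N : ℕ, ∀ (S : Set ℂ) (V : Finset ℂ), (∀ v ∈ V, 0 < Metric.infDist v S) →
      (∀ v ∈ V, ∀ w ∈ V, v ≠ w → β * Metric.infDist v S < ‖v - w‖) → ∀ x : ℂ,
      (V.filter fun v => ‖x - v‖ ≤ α * Metric.infDist v S).card ≤ N := by
  obtain ⟨N, -, H⟩ := exists_packing_bound (2 / β)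
  refine ⟨N, fun S V hpos hsep x => ?_⟩
  set U := V.filter fun v => ‖x - v‖ ≤ α * Metric.infDist v S with hU
  have hmem : ∀ v ∈ U, v ∈ V ∧ ‖x - v‖ ≤ α * Metric.infDist v S := fun v hv => by
    simpa [hU] using hv
  have hcomp : ∀ v ∈ U, Metric.infDist v S ≤ 2 * Metric.infDist x S ∧
      Metric.infDist x S ≤ 2 * Metric.infDist v S := by
    intro v hv
    obtain ⟨h1, h2⟩ := hmem v hv
    have h3 := infDist_le_add (S := S) v x
    have h4 := infDist_le_add (S := S) x v
    rw [norm_sub_rev] at h3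
    have h5 : α * Metric.infDist v S ≤ 1 / 2 * Metric.infDist v S :=
      mul_le_mul_of_nonneg_right hα'.le (hpos v h1).le
    constructor <;> linarith [hpos v h1]
  rcases U.eq_empty_or_nonempty with he | ⟨v₀, hv₀⟩
  · simp [he]
  have hx : 0 < Metric.infDist x S := by
    linarith [(hcomp v₀ hv₀).1, hpos v₀ (hmem v₀ hv₀).1]
  refine H (β * (Metric.infDist x S / 2)) x U (by positivity) ?_ ?_
  · intro v hv
    obtain ⟨h1, h2⟩ := hmem v hv
    have h5 : α * Metric.infDist v S ≤ 1 / 2 * Metric.infDist v S :=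
      mul_le_mul_of_nonneg_right hα'.le (hpos v h1).le
    rw [norm_sub_rev]
    have : 2 / β * (β * (Metric.infDist x S / 2)) = Metric.infDist x S := by field_simp
    rw [this]
    linarith [(hcomp v hv).1]
  · intro v hv w hw hvw
    have := hsep v (hmem v hv).1 w (hmem w hw).1 hvw
    have h2 := mul_le_mul_of_nonneg_left (hcomp v hv).2 hβ.le
    linarith

lemma exists_pair_off_singular (δ K : ℕ) : ∃ C : ℕ,
    ∀ (f : MvPolynomial (Fin 2) ℂ) (S : Finset ℂ), Irreducible f → f.totalDegree ≤ δ →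
      pderiv 1 f ≠ 0 → IsSingularBound f S → S.card ≤ K → S.Nonempty →
      ∀ (A B : Finset ℂ) (P : Finset (ℂ × ℂ)),
      (∀ p ∈ P, p.1 ∈ A ∧ p.2 ∈ B ∧ p.1 ∉ S ∧ eval ![p.2, p.1] f = 0) → C ≤ P.card →
      ∃ p ∈ P, ∃ q ∈ P, p ≠ q ∧ RingNear A (C * A.card / P.card) p.1 q.1 ∧
        RingNear B (C * B.card / P.card) p.2 q.2 := by
  obtain ⟨α, hα, hα', Hslope⟩ := exists_slope_bound δ (1 / 100) (by norm_num)
  set β := α / 50 with hβdef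
  have hβ : 0 < β := by positivity
  obtain ⟨Np, HN⟩ := exists_disc_overlap_bound α β hα' hβ
  obtain ⟨C₁, HC₁⟩ := exists_sparse_pair δ K β hβ
  obtain ⟨N₀, HN₀⟩ := exists_near_affine_pairs
  obtain ⟨Bf, HBf⟩ := exists_fibre_bound δ
  set K' := δ * Np * (Bf + 1) with hK'
  refine ⟨2 * δ * C₁ + 4 * K' * N₀ + 1, ?_⟩
  intro f S hf hδ hf1 hS hSK hSne A B P hP hcard
  set C := 2 * δ * C₁ + 4 * K' * N₀ + 1 with hC
  have hPR : (0 : ℝ) < P.card := by exact_mod_cast (by omega : 0 < P.card)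
  obtain ⟨p₀, hp₀⟩ : P.Nonempty := Finset.card_pos.1 (by omega)
  have hA : A.Nonempty := ⟨_, (hP p₀ hp₀).1⟩
  have hB : B.Nonempty := ⟨_, (hP p₀ hp₀).2.1⟩
  obtain ⟨r, hr⟩ : ∃ r : ℂ → ℝ, ∀ x, r x = Metric.infDist x S := ⟨_, fun _ => rfl⟩
  have hrpos : ∀ x, x ∉ S → 0 < r x := by
    intro x hx
    rw [hr]
    exact (S.finite_toSet.isClosed.notMem_iff_infDist_pos (Finset.coe_nonempty.2 hSne)).1
      (by simpa using hx)
  have hball : ∀ v, ∀ z ∈ Metric.ball v (r v), z ∉ S := by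
    intro v z hz hzS
    have h1 := Metric.infDist_le_dist_of_mem (x := v) (Finset.mem_coe.2 hzS)
    rw [Metric.mem_ball, dist_comm, hr] at hz
    linarith
  have hlip : ∀ x y, r x ≤ r y + ‖x - y‖ := fun x y => by
    rw [hr, hr]; exact infDist_le_add x y
  obtain ⟨V, hVsub, hVsep, hVcov⟩ := exists_separated_subset (P.image Prod.fst)
    (fun v w => ‖v - w‖ ≤ β * max (r v) (r w))
    (fun v => by
      rw [sub_self, norm_zero]
      have : 0 ≤ r v := by rw [hr]; exact Metric.infDist_nonneg
      simp only [max_self]; positivity)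
    (fun v w h => by rwa [norm_sub_rev, max_comm])
  have hVP : ∀ v ∈ V, ∃ y, (v, y) ∈ P := by
    intro v hv
    obtain ⟨p, hp, rfl⟩ := Finset.mem_image.1 (hVsub hv)
    exact ⟨p.2, hp⟩
  have hVS : ∀ v ∈ V, v ∉ S := fun v hv => by
    obtain ⟨y, hy⟩ := hVP v hv
    exact (hP _ hy).2.2.1
  have hVsep' : ∀ v ∈ V, ∀ w ∈ V, v ≠ w → β * r v < ‖v - w‖ := by
    intro v hv w hw hvw
    refine lt_of_le_of_lt ?_ (not_le.1 (hVsep v hv w hw hvw))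
    exact mul_le_mul_of_nonneg_left (le_max_left _ _) hβ.le
  by_cases hcase : P.card ≤ 2 * δ * V.card
  · choose! y hy using hVP
    set P' := V.image fun v => (v, y v) with hP'
    have hP'card : P'.card = V.card :=
      Finset.card_image_of_injective _ fun a b h => congrArg Prod.fst h
    have hP'mem : ∀ p ∈ P', p ∈ P ∧ p.1 ∈ V ∧ p = (p.1, y p.1) := by
      intro p hp
      obtain ⟨v, hv, rfl⟩ := Finset.mem_image.1 hp
      exact ⟨hy v hv, hv, rfl⟩
    have hVC : C₁ ≤ V.card := by
      by_contra hlt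
      have : 2 * δ * V.card ≤ 2 * δ * C₁ := Nat.mul_le_mul_left _ (by omega)
      omega
    obtain ⟨p, hp, q, hq, hne, hX, hY⟩ := HC₁ f S hf hδ hS hSK hSne A B P'
      (fun p hp => hP p (hP'mem p hp).1)
      (by
        intro p hp q hq hpq
        rw [← hr]
        refine hVsep' _ (hP'mem p hp).2.1 _ (hP'mem q hq).2.1 fun h => hpq ?_
        rw [(hP'mem p hp).2.2, (hP'mem q hq).2.2, h])
      (by omega)
    have hmono : ∀ m : ℕ, (C₁ * m / P'.card : ℝ) ≤ C * m / P.card := by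
      intro m
      have hVpos : (0 : ℝ) < V.card := by
        rcases Nat.eq_zero_or_pos V.card with h | h
        · rw [h] at hcase; omega
        · exact_mod_cast h
      rw [hP'card, div_le_div_iff₀ hVpos hPR]
      have h1 : (P.card : ℝ) ≤ 2 * δ * V.card := by exact_mod_cast hcase
      calc (C₁ * m : ℝ) * P.card ≤ C₁ * m * (2 * δ * V.card) := by gcongr
        _ = (2 * δ * C₁) * m * V.card := by ring
        _ ≤ _ := by
          have : 2 * δ * C₁ ≤ C := by omega
          have h2 : (2 * δ * C₁ : ℝ) ≤ C := by exact_mod_cast this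
          exact mul_le_mul_of_nonneg_right (mul_le_mul_of_nonneg_right h2 m.cast_nonneg) hVpos.le
    exact ⟨p, (hP'mem p hp).1, q, (hP'mem q hq).1, hne, hX.mono (hmono _), hY.mono (hmono _)⟩
  rw [not_le] at hcase
  -- the branch through each point, over a disc around a nearby centre
  have hkey : ∀ p, ∃ (v : ℂ) (Y : ℂ → ℂ), p ∈ P → v ∈ V ∧ ‖p.1 - v‖ ≤ α * r v / 25 ∧
      IsBranch f (Metric.ball v (r v)) Y ∧ Y p.1 = p.2 := by
    intro p
    by_cases hp : p ∈ P
    swap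
    · exact ⟨0, 0, fun h => absurd h hp⟩
    obtain ⟨v, hv, hpv⟩ := hVcov p.1 (Finset.mem_image_of_mem _ hp)
    have hrv := hrpos v (hVS v hv)
    have hd : ‖p.1 - v‖ ≤ α * r v / 25 := by
      rcases le_total (r p.1) (r v) with h | h
      · rw [max_eq_right h] at hpv
        rw [hβdef] at hpv
        have : 0 < α * r v := by positivity
        linarith
      · rw [max_eq_left h] at hpv
        have h1 := mul_le_mul_of_nonneg_left (hlip p.1 v) hβ.le
        have h2 : β * ‖p.1 - v‖ ≤ 1 / 2 * ‖p.1 - v‖ :=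
          mul_le_mul_of_nonneg_right (by rw [hβdef]; linarith) (norm_nonneg _)
        have h3 : β * r v = α * r v / 50 := by rw [hβdef]; ring
        linarith
    have hin : p.1 ∈ Metric.ball v (r v) := by
      rw [Metric.mem_ball, dist_eq_norm]
      nlinarith
    obtain ⟨Y, hYd, hY0, hYz⟩ := hS.exists_branch Metric.isOpen_ball (convex_ball v (r v))
      (e := fun z => z) (by fun_prop) (hball v) hin (hP p hp).2.2.2
    exact ⟨v, Y, fun _ => ⟨hv, hd, ⟨hYd, hYz⟩, hY0⟩⟩
  choose v Y hvY using hkey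
  set key : ℂ × ℂ → ℂ × ℂ := fun p => (v p, Y p (v p)) with hkeydef
  have hmemball : ∀ w ∈ V, ∀ x, ‖x - w‖ ≤ α * r w → x ∈ Metric.ball w (r w) := by
    intro w hw x hx
    rw [Metric.mem_ball, dist_eq_norm]
    nlinarith [hrpos w (hVS w hw)]
  have hagree : ∀ p ∈ P, ∀ q ∈ P, key p = key q → Y q p.1 = p.2 := by
    intro p hp q hq h
    simp only [hkeydef, Prod.mk.injEq] at h
    obtain ⟨h1, h2⟩ := h
    obtain ⟨hpV, hpd, hpY, hpp⟩ := hvY p hp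
    obtain ⟨hqV, hqd, hqY, hqq⟩ := hvY q hq
    rw [← hpp]
    rw [← h1] at hqY h2
    have hrv := hrpos _ (hVS _ hpV)
    refine (hS.branch_unique (convex_ball (v p) (r (v p))).isPreconnected (e := fun z => z)
      (by fun_prop) (hball _) hpY.diff.continuousOn hqY.diff.continuousOn hpY.zero hqY.zero
      (Metric.mem_ball_self hrv) h2 _ (hmemball _ hpV _ ?_)).symm
    have : 0 < α * r (v p) := by positivity
    linarith
  set 𝒦 := P.image key with h𝒦
  have h𝒦mem : ∀ k ∈ 𝒦, k.1 ∈ V ∧ eval ![k.2, k.1] f = 0 := by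
    intro k hk
    obtain ⟨p, hp, rfl⟩ := Finset.mem_image.1 hk
    obtain ⟨hpV, hpd, hpY, hpp⟩ := hvY p hp
    exact ⟨hpV, hpY.zero _ (Metric.mem_ball_self (hrpos _ (hVS _ hpV)))⟩
  have hcolumn : ∀ L : Finset (ℂ × ℂ), L ⊆ 𝒦 → ∀ W : Finset ℂ, (∀ k ∈ L, k.1 ∈ W) →
      L.card ≤ δ * W.card := by
    intro L hL W hW
    refine card_le_mul_of_cover L W (fun k w => k.1 = w) δ (fun k hk => ⟨k.1, hW k hk, rfl⟩) ?_
    intro w hw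
    rcases (L.filter fun k => k.1 = w).eq_empty_or_nonempty with he | ⟨k₀, hk₀⟩
    · rw [he]; simp
    have hk₀' := Finset.mem_filter.1 hk₀
    have hwS : w ∉ S := hk₀'.2 ▸ hVS _ (h𝒦mem _ (hL hk₀'.1)).1
    have hinj : Set.InjOn Prod.snd ((L.filter fun k => k.1 = w : Finset (ℂ × ℂ)) : Set (ℂ × ℂ)) := by
      intro a ha b hb hab
      have h1 := (Finset.mem_filter.1 ha).2
      have h2 := (Finset.mem_filter.1 hb).2
      exact Prod.ext (h1.trans h2.symm) hab
    rw [← Finset.card_image_of_injOn hinj]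
    refine card_fibre_le_of_map_ne_zero hδ (hS.map_ne_zero hwS) _ ?_
    intro y hy
    obtain ⟨k, hk, rfl⟩ := Finset.mem_image.1 hy
    obtain ⟨h1, h2⟩ := Finset.mem_filter.1 hk
    have := (h𝒦mem k (hL h1)).2
    rwa [h2] at this
  have h𝒦card : 𝒦.card ≤ δ * V.card := hcolumn 𝒦 subset_rfl V fun k hk => (h𝒦mem k hk).1
  have hfamily : ∀ k : ℂ × ℂ, ∃ (n : ℕ) (J : Finset (Fin n)) (p q : Fin n → ℂ)
      (Z : Fin n → ℂ → Prop) (y : ℂ → ℂ), k ∈ 𝒦 → 2 ≤ (P.filter fun p => key p = k).card →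
      (P.filter fun p => key p = k).card ≤ N₀ * J.card ∧ IsBranch f (Metric.ball k.1 (r k.1)) y ∧
      (∀ j ∈ J, (p j, y (p j)) ∈ P ∧ (q j, y (q j)) ∈ P ∧ p j ≠ q j ∧
        (∀ x, Z j x → ‖x - k.1‖ ≤ α * r k.1) ∧
        (∀ (A : Finset ℂ) (τ : ℝ), ((A.filter (Z j)).card : ℝ) ≤ τ → RingNear A τ (p j) (q j)) ∧
        (∀ (A : Finset ℂ) (τ : ℝ), ((A.filter fun w => ∃ x, Z j x ∧ y x = w).card : ℝ) ≤ τ →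
          RingNear A τ (y (p j)) (y (q j)))) ∧
      ∀ i ∈ J, ∀ j ∈ J, i ≠ j → ∀ x, ¬ (Z i x ∧ Z j x) := by
    intro k
    by_cases hk : k ∈ 𝒦
    swap
    · exact ⟨0, ∅, 0, 0, fun _ _ => True, 0, fun h => absurd h hk⟩
    by_cases h2 : 2 ≤ (P.filter fun p => key p = k).card
    swap
    · exact ⟨0, ∅, 0, 0, fun _ _ => True, 0, fun _ h => absurd h h2⟩
    obtain ⟨p, hp, rfl⟩ := Finset.mem_image.1 hk
    obtain ⟨hpV, hpd, hpY, hpp⟩ := hvY p hp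
    have hrv := hrpos _ (hVS _ hpV)
    have hslope := Hslope f S (v p) (r (v p)) (Y p) hf hδ hS hrv (hball _) hpY
    have hagree' : ∀ q ∈ P.filter fun q => key q = key p, (q.1, Y p q.1) = q := by
      intro q hq
      obtain ⟨h3, h4⟩ := Finset.mem_filter.1 hq
      rw [hagree q h3 p hp h4]
    have hinj : Set.InjOn Prod.fst
        ((P.filter fun q => key q = key p : Finset (ℂ × ℂ)) : Set (ℂ × ℂ)) := by
      intro a ha b hb hab
      rw [← hagree' a ha, ← hagree' b hb, hab]
    obtain ⟨n, J, a, b, Z, h3, h4, h5⟩ := HN₀ (Y p) (v p) (deriv (Y p) (v p)) (α * r (v p))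
      (hpY.deriv_ne_zero hS Metric.isOpen_ball (Metric.mem_ball_self hrv) (hVS _ hpV))
      (fun z w hz hw => norm_sub_affine_le hpY.diff (by nlinarith) hslope hz hw)
      ((P.filter fun q => key q = key p).image Prod.fst)
      (by
        intro x hx
        obtain ⟨q, hq, rfl⟩ := Finset.mem_image.1 hx
        obtain ⟨h3, h4⟩ := Finset.mem_filter.1 hq
        have h5 : v q = v p := congrArg Prod.fst h4
        have := (hvY q h3).2.1
        rwa [h5] at this)
      (by rwa [Finset.card_image_of_injOn hinj])
    rw [Finset.card_image_of_injOn hinj] at h3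
    have hback : ∀ x ∈ (P.filter fun q => key q = key p).image Prod.fst, (x, Y p x) ∈ P := by
      intro x hx
      obtain ⟨q, hq, rfl⟩ := Finset.mem_image.1 hx
      rw [hagree' q hq]
      exact (Finset.mem_filter.1 hq).1
    refine ⟨n, J, a, b, Z, Y p, fun _ _ => ⟨h3, hpY, fun j hj => ?_, h5⟩⟩
    obtain ⟨h6, h7, h8⟩ := h4 j hj
    exact ⟨hback _ h6, hback _ h7, h8⟩
  choose n J p q Z y hfam using hfamily
  set 𝒦₂ := 𝒦.filter fun k => 2 ≤ (P.filter fun p => key p = k).card with h𝒦₂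
  have hfam₂ : ∀ k ∈ 𝒦₂, _ := fun k hk =>
    hfam k (Finset.mem_filter.1 hk).1 (Finset.mem_filter.1 hk).2
  set 𝒥 := 𝒦₂.sigma J with h𝒥
  have h𝒥mem : ∀ j ∈ 𝒥, j.1 ∈ 𝒦₂ ∧ j.2 ∈ J j.1 := fun j hj => Finset.mem_sigma.1 hj
  have hPJ : P.card ≤ 2 * N₀ * 𝒥.card := by
    have h1 : P.card = ∑ k ∈ 𝒦, (P.filter fun p => key p = k).card :=
      Finset.card_eq_sum_card_image key P
    have h2 : ∑ k ∈ 𝒦, (P.filter fun p => key p = k).card ≤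
        ∑ k ∈ 𝒦, (1 + if 2 ≤ (P.filter fun p => key p = k).card then
          (P.filter fun p => key p = k).card else 0) := by
      refine Finset.sum_le_sum fun k _ => ?_
      split_ifs <;> omega
    rw [Finset.sum_add_distrib, Finset.sum_const, smul_eq_mul, mul_one, ← Finset.sum_filter] at h2
    have h3 : ∑ k ∈ 𝒦₂, (P.filter fun p => key p = k).card ≤ N₀ * 𝒥.card := by
      rw [h𝒥, Finset.card_sigma, Finset.mul_sum]
      exact Finset.sum_le_sum fun k hk => (hfam₂ k hk).1
    have h4 : P.card ≤ 𝒦.card + N₀ * 𝒥.card := by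
      rw [h1]
      exact h2.trans (Nat.add_le_add_left h3 _)
    have h5 : 2 * (N₀ * 𝒥.card) = 2 * N₀ * 𝒥.card := by ring
    have h6 : 2 * (δ * V.card) = 2 * δ * V.card := by ring
    omega
  have hdisc : ∀ x, (𝒥.filter fun j => Z j.1 j.2 x).card ≤ δ * Np := by
    intro x
    set U := 𝒥.filter fun j => Z j.1 j.2 x with hU
    have hUmem : ∀ j ∈ U, j ∈ 𝒥 ∧ Z j.1 j.2 x := fun j hj => Finset.mem_filter.1 hj
    have hinj : Set.InjOn (fun j : (k : ℂ × ℂ) × Fin (n k) => j.1) (U : Set _) := by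
      rintro ⟨k, i⟩ hi ⟨k', j⟩ hj hkk
      simp only at hkk
      subst hkk
      have hi' := hUmem _ hi
      have hj' := hUmem _ hj
      have h1 := h𝒥mem _ hi'.1
      have h2 := h𝒥mem _ hj'.1
      by_contra hne
      refine (hfam₂ k h1.1).2.2.2 i h1.2 j h2.2 ?_ x ⟨hi'.2, hj'.2⟩
      rintro rfl
      exact hne rfl
    rw [← Finset.card_image_of_injOn hinj]
    refine (hcolumn _ ?_ (V.filter fun v => ‖x - v‖ ≤ α * Metric.infDist v S) ?_).trans
      (Nat.mul_le_mul_left _ (HN S V (fun w hw => hr w ▸ hrpos w (hVS w hw)) ?_ x))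
    · intro k hk
      obtain ⟨j, hj, rfl⟩ := Finset.mem_image.1 hk
      exact (Finset.mem_filter.1 (h𝒥mem j (hUmem j hj).1).1).1
    · intro k hk
      obtain ⟨j, hj, rfl⟩ := Finset.mem_image.1 hk
      have h1 := h𝒥mem j (hUmem j hj).1
      refine Finset.mem_filter.2 ⟨(h𝒦mem _ (Finset.mem_filter.1 h1.1).1).1, ?_⟩
      rw [← hr]
      exact ((hfam₂ _ h1.1).2.2.1 _ h1.2).2.2.2.1 x (hUmem j hj).2
    · intro a ha b hb hab
      rw [← hr]
      exact hVsep' a ha b hb hab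
  have hdiscY : ∀ w, (𝒥.filter fun j => ∃ x, Z j.1 j.2 x ∧ y j.1 x = w).card ≤ δ * Np * Bf := by
    intro w
    set U := 𝒥.filter fun j => ∃ x, Z j.1 j.2 x ∧ y j.1 x = w with hU
    have hUmem : ∀ j ∈ U, j ∈ 𝒥 ∧ ∃ x, Z j.1 j.2 x ∧ y j.1 x = w := fun j hj =>
      Finset.mem_filter.1 hj
    have hex : ∀ j : (k : ℂ × ℂ) × Fin (n k), ∃ x, j ∈ U → Z j.1 j.2 x ∧ y j.1 x = w := by
      intro j
      by_cases hj : j ∈ U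
      · obtain ⟨x, hx⟩ := (hUmem j hj).2
        exact ⟨x, fun _ => hx⟩
      · exact ⟨0, fun h => absurd h hj⟩
    choose g hg using hex
    have hT : ((U.image g).image fun x => (![w, x] : Fin 2 → ℂ)).card ≤ Bf := by
      refine HBf f hf hδ 0 1 (by decide) hf1 w _ ?_
      intro u hu
      obtain ⟨x, hx, rfl⟩ := Finset.mem_image.1 hu
      obtain ⟨j, hj, rfl⟩ := Finset.mem_image.1 hx
      have h1 := h𝒥mem j (hUmem j hj).1
      have h2 := hfam₂ _ h1.1
      refine ⟨?_, rfl⟩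
      have h3 := h2.2.1.zero (g j) (hmemball _ (h𝒦mem _ (Finset.mem_filter.1 h1.1).1).1 _
        ((h2.2.2.1 _ h1.2).2.2.2.1 _ (hg j hj).1))
      rwa [(hg j hj).2] at h3
    rw [Finset.card_image_of_injective _ (fun a b h => by simpa using congrFun h 1)] at hT
    refine (card_le_mul_of_cover U (U.image g) (fun j x => Z j.1 j.2 x) (δ * Np)
      (fun j hj => ⟨g j, Finset.mem_image_of_mem _ hj, (hg j hj).1⟩) fun x _ => ?_).trans
      (Nat.mul_le_mul_left _ hT)
    refine (Finset.card_le_card ?_).trans (hdisc x)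
    exact Finset.filter_subset_filter _ (Finset.filter_subset _ _)
  have h𝒥ne : 𝒥.Nonempty := by
    rw [Finset.nonempty_iff_ne_empty]
    intro h
    rw [h] at hPJ
    simp only [Finset.card_empty] at hPJ
    omega
  obtain ⟨j, hj, hjA, hjB⟩ := exists_light_index 𝒥 h𝒥ne hA hB (fun j x => Z j.1 j.2 x)
    (fun j w => ∃ x, Z j.1 j.2 x ∧ y j.1 x = w) K'
    (fun x => (hdisc x).trans (Nat.le_mul_of_pos_right _ (by omega)))
    (fun x => (hdiscY x).trans (Nat.mul_le_mul_left _ (by omega)))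
  have h1 := h𝒥mem j hj
  obtain ⟨hpj, hqj, hne, -, hRA, hRB⟩ := (hfam₂ _ h1.1).2.2.1 _ h1.2
  have hlight : ∀ a m : ℕ, a * 𝒥.card ≤ 2 * K' * m → (a : ℝ) ≤ C * m / P.card := by
    intro a m h
    rw [le_div_iff₀ hPR]
    have h2 : a * P.card ≤ C * m := by
      calc a * P.card ≤ a * (2 * N₀ * 𝒥.card) := Nat.mul_le_mul_left _ hPJ
        _ = 2 * N₀ * (a * 𝒥.card) := by ring
        _ ≤ 2 * N₀ * (2 * K' * m) := Nat.mul_le_mul_left _ h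
        _ = (4 * K' * N₀) * m := by ring
        _ ≤ C * m := Nat.mul_le_mul_right _ (by omega)
    exact_mod_cast h2
  exact ⟨_, hpj, _, hqj, fun h => hne (congrArg Prod.fst h), hRA A _ (hlight _ _ hjA),
    hRB B _ (hlight _ _ hjB)⟩

/-- Among sufficiently many grid points of an irreducible curve, some two are close in both
coordinates, in the ring metric. -/
theorem exists_curve_pair (δ : ℕ) : ∃ C : ℕ, ∀ f : MvPolynomial (Fin 2) ℂ, Irreducible f →
    f.totalDegree ≤ δ → pderiv 0 f ≠ 0 → pderiv 1 f ≠ 0 →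
    ∀ (A B : Finset ℂ) (P : Finset (ℂ × ℂ)),
      (∀ p ∈ P, p.1 ∈ A ∧ p.2 ∈ B ∧ eval ![p.2, p.1] f = 0) → C ≤ P.card →
      ∃ p ∈ P, ∃ q ∈ P, p ≠ q ∧ RingNear A (C * A.card / P.card) p.1 q.1 ∧
        RingNear B (C * B.card / P.card) p.2 q.2 := by
  obtain ⟨K, HK⟩ := exists_isSingularBound δ
  obtain ⟨C, HC⟩ := exists_pair_off_singular δ K
  obtain ⟨Bf, HBf⟩ := exists_fibre_bound δ
  refine ⟨2 * C + 2 * (K * Bf) + 1, fun f hf hδ h0 h1 A B P hP hcard => ?_⟩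
  obtain ⟨S, hSK, hSne, hS⟩ := HK f hf hδ h0 h1
  have hbad : (P.filter fun p => p.1 ∈ S).card ≤ Bf * S.card := by
    refine card_le_mul_of_cover _ S (fun p s => p.1 = s) Bf
      (fun p hp => ⟨p.1, (Finset.mem_filter.1 hp).2, rfl⟩) fun s hs => ?_
    have hinj : Set.InjOn (fun p : ℂ × ℂ => (![p.2, p.1] : Fin 2 → ℂ))
        (((P.filter fun p => p.1 ∈ S).filter fun p => p.1 = s : Finset (ℂ × ℂ)) : Set (ℂ × ℂ)) := by
      intro a _ b _ hab
      exact Prod.ext (by simpa using congrFun hab 1) (by simpa using congrFun hab 0)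
    rw [← Finset.card_image_of_injOn hinj]
    refine HBf f hf hδ 1 0 (by decide) h0 s _ fun u hu => ?_
    obtain ⟨p, hp, rfl⟩ := Finset.mem_image.1 hu
    obtain ⟨h2, h3⟩ := Finset.mem_filter.1 hp
    exact ⟨(hP p (Finset.mem_filter.1 h2).1).2.2, h3⟩
  have hsplit := Finset.card_filter_add_card_filter_not (s := P) (fun p => p.1 ∈ S)
  have hbad' : Bf * S.card ≤ K * Bf := by rw [mul_comm]; exact Nat.mul_le_mul_right _ hSK
  obtain ⟨P', hP'sub, hP'mem, hP'card⟩ : ∃ P' ⊆ P, (∀ p ∈ P', p.1 ∉ S) ∧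
      P.card ≤ P'.card + K * Bf :=
    ⟨P.filter fun p => p.1 ∉ S, Finset.filter_subset _ _, fun p hp => (Finset.mem_filter.1 hp).2,
      by omega⟩
  obtain ⟨p, hp, q, hq, hne, hX, hY⟩ := HC f S hf hδ h1 hS hSK hSne A B P'
    (fun p hp => ⟨(hP p (hP'sub hp)).1, (hP p (hP'sub hp)).2.1, hP'mem p hp, (hP p (hP'sub hp)).2.2⟩)
    (by omega)
  have hmono : ∀ m : ℕ, (C * m / P'.card : ℝ) ≤
      ((2 * C + 2 * (K * Bf) + 1 : ℕ) : ℝ) * m / P.card := by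
    intro m
    have hle : P.card ≤ 2 * P'.card := by omega
    have hpos : 0 < P'.card := by omega
    rw [div_le_div_iff₀ (by exact_mod_cast hpos) (by exact_mod_cast (by omega : 0 < P.card))]
    have : C * m * P.card ≤ (2 * C + 2 * (K * Bf) + 1) * m * P'.card :=
      calc C * m * P.card ≤ C * m * (2 * P'.card) := Nat.mul_le_mul_left _ hle
        _ = (2 * C) * m * P'.card := by ring
        _ ≤ _ := by gcongr; omega
    exact_mod_cast this
  exact ⟨p, hP'sub hp, q, hP'sub hq, hne, hX.mono (hmono _), hY.mono (hmono _)⟩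

/-- A digraph of bounded out-degree has a large independent set. -/
lemma exists_independent_of_outDegree_le {α : Type*} (R : α → α → Prop) (M : ℕ) :
    ∀ (k : ℕ) (U : Finset α), U.card = k → (∀ p ∈ U, (U.filter fun q => R p q).card ≤ M) →
    ∃ I ⊆ U, (∀ p ∈ I, ∀ q ∈ I, p ≠ q → ¬ R p q) ∧ U.card ≤ (2 * M + 1) * I.card := by
  intro k
  induction k using Nat.strong_induction_on with
  | _ k ih =>
  intro U hU hM
  rcases U.eq_empty_or_nonempty with rfl | hne
  · exact ⟨∅, by simp, by simp, by simp⟩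
  obtain ⟨p, hp, hdeg⟩ := Finset.exists_le_of_sum_le hne
    (f := fun p => (U.filter fun q => R p q).card + (U.filter fun q => R q p).card)
    (g := fun _ => 2 * M) (by
      rw [Finset.sum_add_distrib]
      have h1 : ∑ p ∈ U, (U.filter fun q => R p q).card = ∑ p ∈ U, (U.filter fun q => R q p).card := by
        simp only [Finset.card_filter]
        exact Finset.sum_comm
      rw [← h1]
      have h2 : ∑ p ∈ U, (U.filter fun q => R p q).card ≤ ∑ p ∈ U, M := Finset.sum_le_sum hM
      simp only [Finset.sum_const, smul_eq_mul] at h2 ⊢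
      nlinarith)
  obtain ⟨W, hW⟩ : ∃ W : Finset α, ∀ q, q ∈ W ↔ q ∈ U ∧ (q = p ∨ R p q ∨ R q p) :=
    ⟨U.filter fun q => q = p ∨ R p q ∨ R q p, fun q => by simp⟩
  have hWcard : W.card ≤ 2 * M + 1 := by
    have hsub : W ⊆ insert p ((U.filter fun q => R p q) ∪ U.filter fun q => R q p) := by
      intro q hq
      obtain ⟨h1, h2⟩ := (hW q).1 hq
      simp only [Finset.mem_insert, Finset.mem_union, Finset.mem_filter]
      tauto
    refine (Finset.card_le_card hsub).trans ((Finset.card_insert_le _ _).trans ?_)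
    have := Finset.card_union_le (U.filter fun q => R p q) (U.filter fun q => R q p)
    omega
  have hWU : W ⊆ U := fun q hq => ((hW q).1 hq).1
  have hpW : p ∈ W := (hW p).2 ⟨hp, Or.inl rfl⟩
  have hcard := Finset.card_sdiff_add_card_eq_card hWU
  have hWpos : 0 < W.card := Finset.card_pos.2 ⟨p, hpW⟩
  obtain ⟨I, hI, hind, hIcard⟩ := ih (U \ W).card (by omega) (U \ W) rfl (by
    intro q hq
    refine (Finset.card_le_card ?_).trans (hM q (Finset.mem_sdiff.1 hq).1)
    exact Finset.filter_subset_filter _ Finset.sdiff_subset)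
  have hIU : ∀ q ∈ I, q ∈ U ∧ q ≠ p ∧ ¬ R p q ∧ ¬ R q p := by
    intro q hq
    obtain ⟨h1, h2⟩ := Finset.mem_sdiff.1 (hI hq)
    rw [hW] at h2
    tauto
  have hpI : p ∉ I := fun h => (hIU p h).2.1 rfl
  refine ⟨insert p I, ?_, ?_, ?_⟩
  · exact Finset.insert_subset hp fun q hq => (hIU q hq).1
  · intro a ha b hb hab
    rcases Finset.mem_insert.1 ha with rfl | ha' <;> rcases Finset.mem_insert.1 hb with rfl | hb'
    · exact absurd rfl hab
    · exact (hIU b hb').2.2.1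
    · exact (hIU a ha').2.2.2
    · exact hind a ha' b hb' hab
  · rw [Finset.card_insert_of_notMem hpI]
    nlinarith

/-- The incidence bound: close pairs on a common curve are frequent on rich curves, but
each pair lies on few curves. -/
lemma sum_card_incidences_le {Γ : Type*} (G : Finset Γ) (A B : Finset ℂ)
    (inc : Γ → Finset (ℂ × ℂ)) (Deg : Γ → ℂ × ℂ → ℂ × ℂ → Prop) (M C : ℕ)
    (hinc : ∀ γ ∈ G, ∀ p ∈ inc γ, p.1 ∈ A ∧ p.2 ∈ B)
    (ha : ∀ p q, (G.filter fun γ => p ∈ inc γ ∧ q ∈ inc γ ∧ ¬ Deg γ p q).card ≤ M)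
    (hb : ∀ γ ∈ G, ∀ p ∈ inc γ, ((inc γ).filter fun q => Deg γ p q).card ≤ M)
    (hc : ∀ γ ∈ G, ∀ I ⊆ inc γ, C ≤ I.card → ∃ p ∈ I, ∃ q ∈ I, p ≠ q ∧
      RingNear A (C * A.card / I.card) p.1 q.1 ∧ RingNear B (C * B.card / I.card) p.2 q.2)
    (n : ℝ) (hn : 0 < n) :
    ∑ γ ∈ G, ((inc γ).card : ℝ) ≤
      G.card * ((2 * M + 1) * (C * (1 + n) + 1)) + 9 * M * ((A.card * B.card / n) ^ 2) := by
  obtain ⟨Rel, hRel⟩ : ∃ Rel : ℂ × ℂ → ℂ × ℂ → Prop, ∀ p q, Rel p q ↔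
      RingNear A (A.card / n) p.1 q.1 ∧ RingNear B (B.card / n) p.2 q.2 := ⟨_, fun _ _ => Iff.rfl⟩
  obtain ⟨Q, hQ⟩ : ∃ Q : Γ → ℂ × ℂ → ℂ × ℂ → Prop, ∀ γ p q, Q γ p q ↔
      Rel p q ∧ p ∈ inc γ ∧ q ∈ inc γ ∧ ¬ Deg γ p q := ⟨_, fun _ _ _ => Iff.rfl⟩
  have hper : ∀ γ ∈ G, ((inc γ).card : ℝ) ≤ (2 * M + 1) * (C * (1 + n) + 1) +
      ∑ p ∈ A ×ˢ B, (((A ×ˢ B).filter fun q => Q γ p q).card : ℝ) := by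
    intro γ hγ
    set U := (inc γ).filter fun p => ∀ q ∈ inc γ, p ≠ q → ¬ Q γ p q with hU
    have hUmem : ∀ p ∈ U, p ∈ inc γ ∧ ∀ q ∈ inc γ, p ≠ q → ¬ Q γ p q := fun p hp =>
      Finset.mem_filter.1 hp
    obtain ⟨I, hIU, hind, hIcard⟩ := exists_independent_of_outDegree_le (Deg γ) M _ U rfl (by
      intro p hp
      refine (Finset.card_le_card ?_).trans (hb γ hγ p (hUmem p hp).1)
      exact Finset.filter_subset_filter _ (Finset.filter_subset _ _))
    have hIlt : (I.card : ℝ) ≤ C * (1 + n) + 1 := by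
      by_contra! hlt
      have hC0 : (0 : ℝ) ≤ C := C.cast_nonneg
      have hIpos : (0 : ℝ) < I.card := by nlinarith
      have hCI : C ≤ I.card := by
        have : (C : ℝ) ≤ I.card := by nlinarith
        exact_mod_cast this
      obtain ⟨p, hp, q, hq, hne, hX, hY⟩ := hc γ hγ I (fun p hp => (hUmem p (hIU hp)).1) hCI
      have hmono : ∀ m : ℕ, (C * m / I.card : ℝ) ≤ m / n := by
        intro m
        rw [div_le_div_iff₀ hIpos hn]
        have : (C * n : ℝ) ≤ I.card := by nlinarith
        nlinarith [mul_le_mul_of_nonneg_left this m.cast_nonneg]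
      refine (hUmem p (hIU hp)).2 q (hUmem q (hIU hq)).1 hne ((hQ _ _ _).2 ⟨?_, ?_, ?_, ?_⟩)
      · exact (hRel _ _).2 ⟨hX.mono (hmono _), hY.mono (hmono _)⟩
      · exact (hUmem p (hIU hp)).1
      · exact (hUmem q (hIU hq)).1
      · exact hind p hp q hq hne
    have hUle : (U.card : ℝ) ≤ (2 * M + 1) * (C * (1 + n) + 1) := by
      have h1 : (U.card : ℝ) ≤ (2 * M + 1) * I.card := by exact_mod_cast hIcard
      exact h1.trans (by gcongr)
    have hsub : inc γ ⊆ A ×ˢ B := fun p hp => Finset.mem_product.2 (hinc γ hγ p hp)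
    have hrest : ((inc γ \ U).card : ℝ) ≤
        ∑ p ∈ A ×ˢ B, (((A ×ˢ B).filter fun q => Q γ p q).card : ℝ) := by
      calc ((inc γ \ U).card : ℝ) = ∑ p ∈ inc γ \ U, (1 : ℝ) := by simp
        _ ≤ ∑ p ∈ inc γ \ U, (((A ×ˢ B).filter fun q => Q γ p q).card : ℝ) := by
          refine Finset.sum_le_sum fun p hp => ?_
          obtain ⟨h1, h2⟩ := Finset.mem_sdiff.1 hp
          have : ∃ q ∈ inc γ, Q γ p q := by
            by_contra! hcon
            exact h2 (Finset.mem_filter.2 ⟨h1, fun q hq _ => hcon q hq⟩)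
          obtain ⟨q, hq, hpq⟩ := this
          have : 0 < ((A ×ˢ B).filter fun q => Q γ p q).card :=
            Finset.card_pos.2 ⟨q, Finset.mem_filter.2 ⟨hsub hq, hpq⟩⟩
          exact_mod_cast this
        _ ≤ _ := Finset.sum_le_sum_of_subset_of_nonneg
          (Finset.sdiff_subset.trans hsub) fun _ _ _ => Nat.cast_nonneg _
    have hsplit := Finset.card_sdiff_add_card_eq_card (Finset.filter_subset _ _ : U ⊆ inc γ)
    have hsplit' : ((inc γ \ U).card : ℝ) + U.card = (inc γ).card := by exact_mod_cast hsplit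
    linarith
  have hpairs : ∑ γ ∈ G, ∑ p ∈ A ×ˢ B, (((A ×ˢ B).filter fun q => Q γ p q).card : ℝ) ≤
      9 * M * ((A.card * B.card / n) ^ 2) := by
    rw [Finset.sum_comm]
    have hp : ∀ p ∈ A ×ˢ B, ∑ γ ∈ G, (((A ×ˢ B).filter fun q => Q γ p q).card : ℝ) ≤
        M * (3 * (A.card / n) * (3 * (B.card / n))) := by
      intro p _
      have h1 : ∑ γ ∈ G, (((A ×ˢ B).filter fun q => Q γ p q).card : ℝ) =
          ∑ q ∈ A ×ˢ B, ((G.filter fun γ => Q γ p q).card : ℝ) := by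
        simp only [Finset.card_filter, Nat.cast_sum]
        exact Finset.sum_comm
      have h2 : ∑ q ∈ A ×ˢ B, ((G.filter fun γ => Q γ p q).card : ℝ) ≤
          ∑ q ∈ A ×ˢ B, if Rel p q then (M : ℝ) else 0 := by
        refine Finset.sum_le_sum fun q _ => ?_
        split_ifs with h
        · refine Nat.cast_le.2 (le_trans (Finset.card_le_card fun γ hγ => ?_) (ha p q))
          rw [Finset.mem_filter] at hγ ⊢
          exact ⟨hγ.1, ((hQ _ _ _).1 hγ.2).2⟩
        · have : (G.filter fun γ => Q γ p q) = ∅ := by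
            rw [Finset.filter_eq_empty_iff]
            exact fun γ _ hγ => h ((hQ _ _ _).1 hγ).1
          simp [this]
      rw [h1]
      refine h2.trans ?_
      rw [← Finset.sum_filter, Finset.sum_const, nsmul_eq_mul, mul_comm]
      refine mul_le_mul_of_nonneg_left ?_ M.cast_nonneg
      have hsub : ((A ×ˢ B).filter fun q => Rel p q) ⊆
          (A.filter fun b => RingNear A (A.card / n) p.1 b) ×ˢ
            (B.filter fun b => RingNear B (B.card / n) p.2 b) := by
        intro q hq
        rw [Finset.mem_filter, Finset.mem_product, hRel] at hq
        rw [Finset.mem_product, Finset.mem_filter, Finset.mem_filter]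
        exact ⟨⟨hq.1.1, hq.2.1⟩, hq.1.2, hq.2.2⟩
      have hle := Finset.card_le_card hsub
      rw [Finset.card_product] at hle
      calc (((A ×ˢ B).filter fun q => Rel p q).card : ℝ) ≤ _ := Nat.cast_le.2 hle
        _ ≤ _ := by
          rw [Nat.cast_mul]
          exact mul_le_mul (card_ringNear_le A (by positivity) _)
            (card_ringNear_le B (by positivity) _) (Nat.cast_nonneg _) (by positivity)
    refine (Finset.sum_le_sum hp).trans (le_of_eq ?_)
    rw [Finset.sum_const, nsmul_eq_mul, Finset.card_product]
    push_cast
    ring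
  calc ∑ γ ∈ G, ((inc γ).card : ℝ) ≤ ∑ γ ∈ G, ((2 * M + 1) * (C * (1 + n) + 1) +
        ∑ p ∈ A ×ˢ B, (((A ×ˢ B).filter fun q => Q γ p q).card : ℝ)) := Finset.sum_le_sum hper
    _ ≤ _ := by
      rw [Finset.sum_add_distrib, Finset.sum_const, nsmul_eq_mul]
      linarith

lemma dvd_of_forall_eval_eq_zero {n : ℕ} {f g : MvPolynomial (Fin n) ℂ} (hf : Irreducible f)
    (h : ∀ x, eval x f = 0 → eval x g = 0) : f ∣ g := by
  have hprime : (Ideal.span {f}).IsPrime :=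
    (Ideal.span_singleton_prime hf.ne_zero).2 hf.prime
  have hmem : g ∈ vanishingIdeal ℂ (zeroLocus ℂ (Ideal.span {f})) := by
    intro x hx
    have h1 := hx f (Ideal.mem_span_singleton_self f)
    simpa [coe_aeval_eq_eval] using h x (by simpa [coe_aeval_eq_eval] using h1)
  rw [IsPrime.vanishingIdeal_zeroLocus] at hmem
  exact Ideal.mem_span_singleton.1 hmem

lemma card_le_totalDegree_prod {n : ℕ} (s : Multiset (MvPolynomial (Fin n) ℂ))
    (hs : ∀ f ∈ s, Irreducible f) : s.card ≤ s.prod.totalDegree := by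
  induction s using Multiset.induction with
  | empty => simp
  | cons a s ih =>
    have h1 := ih fun f hf => hs f (Multiset.mem_cons_of_mem hf)
    have ha := hs a (Multiset.mem_cons_self a s)
    have h2 := one_le_totalDegree_of_irreducible ha
    have h3 : s.prod ≠ 0 := Multiset.prod_ne_zero fun h0 =>
      (hs 0 (Multiset.mem_cons_of_mem h0)).ne_zero rfl
    rw [Multiset.prod_cons, totalDegree_mul_of_isDomain ha.ne_zero h3, Multiset.card_cons]
    omega

lemma totalDegree_le_of_dvd {n : ℕ} {f g : MvPolynomial (Fin n) ℂ} (hg : g ≠ 0) (h : f ∣ g) :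
    f.totalDegree ≤ g.totalDegree := by
  obtain ⟨k, rfl⟩ := h
  rw [totalDegree_mul_of_isDomain (left_ne_zero_of_mul hg) (right_ne_zero_of_mul hg)]
  omega

lemma exists_finset_factors {n : ℕ} {g : MvPolynomial (Fin n) ℂ} (hg : g ≠ 0) :
    ∃ L : Finset (MvPolynomial (Fin n) ℂ), L.card ≤ g.totalDegree ∧
      (∀ f ∈ L, Irreducible f ∧ f ∣ g ∧ f.totalDegree ≤ g.totalDegree) ∧
      ∀ x, eval x g = 0 → ∃ f ∈ L, eval x f = 0 := by
  have hassoc := UniqueFactorizationMonoid.factors_prod hg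
  refine ⟨(UniqueFactorizationMonoid.factors g).toFinset, ?_, ?_, ?_⟩
  · refine (Multiset.toFinset_card_le _).trans ?_
    exact (card_le_totalDegree_prod _ UniqueFactorizationMonoid.irreducible_of_factor).trans
      (totalDegree_le_of_dvd hg hassoc.dvd)
  · intro f hf
    rw [Multiset.mem_toFinset] at hf
    have hd := UniqueFactorizationMonoid.dvd_of_mem_factors hf
    exact ⟨UniqueFactorizationMonoid.irreducible_of_factor f hf, hd, totalDegree_le_of_dvd hg hd⟩
  · intro x hx
    obtain ⟨k, hk⟩ := hassoc.symm.dvd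
    have h0 : eval x (UniqueFactorizationMonoid.factors g).prod = 0 := by
      rw [hk, map_mul, hx, zero_mul]
    rw [map_multiset_prod, Multiset.prod_eq_zero_iff, Multiset.mem_map] at h0
    obtain ⟨f, hf, hfx⟩ := h0
    exact ⟨f, Multiset.mem_toFinset.2 hf, hfx⟩

lemma eval_pderiv_mul {n : ℕ} (f h : MvPolynomial (Fin n) ℂ) {x : Fin n → ℂ} (hx : eval x f = 0)
    (i : Fin n) : eval x (pderiv i (f * h)) = eval x h * eval x (pderiv i f) := by
  simp [Derivation.leibniz, hx]

/-- The polynomial `F(·, ·, s, t)`. -/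
def sliceFst (F : MvPolynomial (Fin 4) ℂ) (γ : ℂ × ℂ) : MvPolynomial (Fin 2) ℂ :=
  aeval ![X 0, X 1, C γ.1, C γ.2] F

/-- The polynomial `F(x, y, ·, ·)`. -/
def sliceSnd (F : MvPolynomial (Fin 4) ℂ) (p : ℂ × ℂ) : MvPolynomial (Fin 2) ℂ :=
  aeval ![C p.1, C p.2, X 0, X 1] F

lemma eval_aeval_eq {m n : ℕ} (g : Fin m → MvPolynomial (Fin n) ℂ) (x : Fin n → ℂ)
    (F : MvPolynomial (Fin m) ℂ) : eval x (aeval g F) = eval (fun i => eval x (g i)) F := by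
  induction F using MvPolynomial.induction_on with
  | C a => simp
  | add p q hp hq => simp only [map_add, hp, hq]
  | mul_X p i hp => simp only [map_mul, aeval_X, eval_X, hp]

lemma eval_sliceFst (F : MvPolynomial (Fin 4) ℂ) (γ : ℂ × ℂ) (x y : ℂ) :
    eval ![x, y] (sliceFst F γ) = eval ![x, y, γ.1, γ.2] F := by
  rw [sliceFst, eval_aeval_eq]
  congr 2
  ext i
  fin_cases i <;> simp

lemma eval_sliceSnd (F : MvPolynomial (Fin 4) ℂ) (p : ℂ × ℂ) (s t : ℂ) :
    eval ![s, t] (sliceSnd F p) = eval ![p.1, p.2, s, t] F := by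
  rw [sliceSnd, eval_aeval_eq]
  congr 2
  ext i
  fin_cases i <;> simp

lemma pderiv_aeval_eq {m n : ℕ} (g : Fin m → MvPolynomial (Fin n) ℂ) (i : Fin n) (j : Fin m)
    (hj : ∀ k, pderiv i (g k) = if k = j then 1 else 0) (F : MvPolynomial (Fin m) ℂ) :
    pderiv i (aeval g F) = aeval g (pderiv j F) := by
  induction F using MvPolynomial.induction_on with
  | C a => simp
  | add p q hp hq => simp only [map_add, hp, hq]
  | mul_X p k hp =>
    simp only [map_mul, aeval_X, Derivation.leibniz, smul_eq_mul, hp, hj, map_add]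
    by_cases h : k = j
    · subst h; simp
    · simp [h, pderiv_X_of_ne h]

lemma pderiv_sliceFst (F : MvPolynomial (Fin 4) ℂ) (γ : ℂ × ℂ) :
    pderiv 0 (sliceFst F γ) = sliceFst (pderiv 0 F) γ ∧
    pderiv 1 (sliceFst F γ) = sliceFst (pderiv 1 F) γ := by
  constructor <;> refine pderiv_aeval_eq _ _ _ (fun k => ?_) F <;> fin_cases k <;>
    simp

lemma pderiv_sliceSnd (F : MvPolynomial (Fin 4) ℂ) (p : ℂ × ℂ) :
    pderiv 0 (sliceSnd F p) = sliceSnd (pderiv 2 F) p ∧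
    pderiv 1 (sliceSnd F p) = sliceSnd (pderiv 3 F) p := by
  constructor <;> refine pderiv_aeval_eq _ _ _ (fun k => ?_) F <;> fin_cases k <;>
    simp

lemma totalDegree_aeval_le {m n : ℕ} (g : Fin m → MvPolynomial (Fin n) ℂ)
    (hg : ∀ i, (g i).totalDegree ≤ 1) (F : MvPolynomial (Fin m) ℂ) :
    (aeval g F).totalDegree ≤ F.totalDegree := by
  rw [aeval_def, eval₂_eq']
  refine totalDegree_finsetSum_le fun d hd => ?_
  refine (totalDegree_mul _ _).trans ?_
  have h1 : (∏ i, g i ^ d i).totalDegree ≤ ∑ i, d i := by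
    refine (totalDegree_finsetProd _ _).trans (Finset.sum_le_sum fun i _ => ?_)
    refine (totalDegree_pow _ _).trans ?_
    simpa using Nat.mul_le_mul_left (d i) (hg i)
  have h2 : ∑ i, d i ≤ F.totalDegree := by
    have := le_totalDegree hd
    rwa [Finsupp.sum_fintype _ _ (fun _ => rfl)] at this
  have h3 : ((algebraMap ℂ (MvPolynomial (Fin n) ℂ)) (coeff d F)).totalDegree = 0 := by
    rw [algebraMap_eq, totalDegree_C]
  omega

lemma totalDegree_sliceFst_le (F : MvPolynomial (Fin 4) ℂ) (γ : ℂ × ℂ) :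
    (sliceFst F γ).totalDegree ≤ F.totalDegree := by
  refine totalDegree_aeval_le _ (fun i => ?_) F
  fin_cases i <;> simp

lemma totalDegree_sliceSnd_le (F : MvPolynomial (Fin 4) ℂ) (p : ℂ × ℂ) :
    (sliceSnd F p).totalDegree ≤ F.totalDegree := by
  refine totalDegree_aeval_le _ (fun i => ?_) F
  fin_cases i <;> simp

/-- The obstruction to `F_x / F_y` being a function of `(x, y)` alone on `Z(F)`. -/
def splitObstruction (F : MvPolynomial (Fin 4) ℂ) : MvPolynomial (Fin 4) ℂ :=
  pderiv 3 F * (pderiv 1 F * pderiv 2 (pderiv 0 F) - pderiv 0 F * pderiv 2 (pderiv 1 F)) -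
    pderiv 2 F * (pderiv 1 F * pderiv 3 (pderiv 0 F) - pderiv 0 F * pderiv 3 (pderiv 1 F))

/-- Zeros of `F` at which no partial derivative and not the obstruction vanish. -/
structure IsGoodZero (F : MvPolynomial (Fin 4) ℂ) (p γ : ℂ × ℂ) : Prop where
  zero : eval ![p.1, p.2, γ.1, γ.2] F = 0
  deriv : ∀ i, eval ![p.1, p.2, γ.1, γ.2] (pderiv i F) ≠ 0
  split : eval ![p.1, p.2, γ.1, γ.2] (splitObstruction F) ≠ 0

lemma IsGoodZero.sliceFst_ne_zero {F : MvPolynomial (Fin 4) ℂ} {p γ : ℂ × ℂ}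
    (h : IsGoodZero F p γ) : sliceFst F γ ≠ 0 := by
  intro h0
  have h1 := (pderiv_sliceFst F γ).1
  rw [h0, map_zero] at h1
  have h2 := eval_sliceFst (pderiv 0 F) γ p.1 p.2
  rw [← h1, map_zero] at h2
  exact h.deriv 0 h2.symm

lemma IsGoodZero.sliceSnd_ne_zero {F : MvPolynomial (Fin 4) ℂ} {p γ : ℂ × ℂ}
    (h : IsGoodZero F p γ) : sliceSnd F p ≠ 0 := by
  intro h0
  have h1 := (pderiv_sliceSnd F p).1
  rw [h0, map_zero] at h1
  have h2 := eval_sliceSnd (pderiv 2 F) p γ.1 γ.2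
  rw [← h1, map_zero] at h2
  exact h.deriv 2 h2.symm

/-- A component of the curve of `γ` cannot stay on all curves parametrised by a component of the
dual curve. -/
lemma IsGoodZero.exists_not_dvd {F κ β : MvPolynomial _ ℂ} {q γ : ℂ × ℂ} (h : IsGoodZero F q γ)
    (hκ : Irreducible κ) (hκγ : eval ![γ.1, γ.2] κ = 0) (hκq : κ ∣ sliceSnd F q)
    (hβγ : β ∣ sliceFst F γ) (hβq : eval ![q.1, q.2] β = 0) :
    ∃ s t, eval ![s, t] κ = 0 ∧ ¬ β ∣ sliceFst F (s, t) := by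
  by_contra! hcon
  set bx := eval ![q.1, q.2] (pderiv 0 β) with hbx
  set by' := eval ![q.1, q.2] (pderiv 1 β) with hby
  have hgrad : ∀ γ', β ∣ sliceFst F γ' → ∃ c, eval ![q.1, q.2, γ'.1, γ'.2] (pderiv 0 F) = c * bx ∧
      eval ![q.1, q.2, γ'.1, γ'.2] (pderiv 1 F) = c * by' := by
    rintro γ' ⟨k, hk⟩
    refine ⟨eval ![q.1, q.2] k, ?_, ?_⟩
    · rw [← eval_sliceFst, ← (pderiv_sliceFst F γ').1, hk, eval_pderiv_mul _ _ hβq]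
    · rw [← eval_sliceFst, ← (pderiv_sliceFst F γ').2, hk, eval_pderiv_mul _ _ hβq]
  have hdvd : κ ∣ sliceSnd (pderiv 0 F) q * C by' - sliceSnd (pderiv 1 F) q * C bx := by
    refine dvd_of_forall_eval_eq_zero hκ fun z hz => ?_
    have hz' : z = ![z 0, z 1] := by ext i; fin_cases i <;> rfl
    rw [hz'] at hz ⊢
    obtain ⟨c, h1, h2⟩ := hgrad (z 0, z 1) (hcon _ _ hz)
    simp only [map_sub, map_mul, eval_C, eval_sliceSnd]
    simp only at h1 h2
    rw [h1, h2]; ring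
  obtain ⟨k, hk⟩ := hdvd
  obtain ⟨k', hk'⟩ := hκq
  obtain ⟨c, hc0, hc1⟩ := hgrad γ hβγ
  have e2 := eval_pderiv_mul κ k hκγ 0
  have e3 := eval_pderiv_mul κ k hκγ 1
  have e2' := eval_pderiv_mul κ k' hκγ 0
  have e3' := eval_pderiv_mul κ k' hκγ 1
  rw [← hk] at e2 e3
  rw [← hk'] at e2' e3'
  simp only [map_sub, map_mul, Derivation.leibniz, pderiv_C, smul_eq_mul, mul_zero,
    zero_add, (pderiv_sliceSnd _ q).1, (pderiv_sliceSnd _ q).2, eval_sliceSnd, eval_C] at e2 e3 e2' e3'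
  refine h.split ?_
  simp only [splitObstruction, map_sub, map_mul]
  rw [hc0, hc1, e2', e3']
  linear_combination (c * eval ![γ.1, γ.2] k' * eval ![γ.1, γ.2] (pderiv 1 κ)) * e2 -
    (c * eval ![γ.1, γ.2] k' * eval ![γ.1, γ.2] (pderiv 0 κ)) * e3

lemma exists_bezout_bound_prod (δ : ℕ) : ∃ B : ℕ, ∀ f g : MvPolynomial (Fin 2) ℂ,
    Irreducible f → ¬ f ∣ g → f.totalDegree ≤ δ → g.totalDegree ≤ δ →
    ∀ T : Finset (ℂ × ℂ), (∀ x ∈ T, eval ![x.1, x.2] f = 0 ∧ eval ![x.1, x.2] g = 0) →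
      T.card ≤ B := by
  obtain ⟨B, hB⟩ := exists_bezout_bound δ
  refine ⟨B, fun f g hf hfg h1 h2 T hT => ?_⟩
  have hinj : Function.Injective fun x : ℂ × ℂ => ![x.1, x.2] := by
    intro x y h
    exact Prod.ext (congrFun h 0) (congrFun h 1)
  rw [← Finset.card_image_of_injective T hinj]
  refine hB f g hf hfg h1 h2 _ fun x hx => ?_
  obtain ⟨y, hy, rfl⟩ := Finset.mem_image.1 hx
  exact hT y hy

lemma pderiv_ne_zero_of_dvd_sliceFst {F : MvPolynomial (Fin 4) ℂ} {β : MvPolynomial (Fin 2) ℂ}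
    {p γ : ℂ × ℂ} (h : IsGoodZero F p γ) (hβ : β ∣ sliceFst F γ) (hβp : eval ![p.1, p.2] β = 0) :
    pderiv 0 β ≠ 0 ∧ pderiv 1 β ≠ 0 := by
  obtain ⟨k, hk⟩ := hβ
  constructor <;> intro h0
  · apply h.deriv 0
    rw [← eval_sliceFst, ← (pderiv_sliceFst F γ).1, hk, eval_pderiv_mul _ _ hβp, h0, map_zero,
      mul_zero]
  · apply h.deriv 1
    rw [← eval_sliceFst, ← (pderiv_sliceFst F γ).2, hk, eval_pderiv_mul _ _ hβp, h0, map_zero,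
      mul_zero]

/-- Incidence bound for the good zeros of `F` on a grid. -/
lemma exists_good_zeros_bound (δ : ℕ) : ∃ M K : ℕ, ∀ F : MvPolynomial (Fin 4) ℂ,
    F.totalDegree ≤ δ → ∀ (A B : Finset ℂ) (G : Finset (ℂ × ℂ)) (inc : ℂ × ℂ → Finset (ℂ × ℂ)),
    (∀ γ p, p ∈ inc γ ↔ p ∈ A ×ˢ B ∧ IsGoodZero F p γ) → ∀ n : ℝ, 0 < n →
    ∑ γ ∈ G, ((inc γ).card : ℝ) ≤
      G.card * ((2 * M + 1) * (K * (1 + n) + 1)) + 9 * M * ((A.card * B.card / n) ^ 2) := by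
  obtain ⟨N, hN⟩ := exists_bezout_bound_prod δ
  obtain ⟨K, hK⟩ := exists_curve_pair δ
  refine ⟨N * δ + N * (δ * δ), δ * K + 1, fun F hδ A B G inc hinc n hn => ?_⟩
  have hL : ∀ g : MvPolynomial (Fin 2) ℂ, ∃ L : Finset (MvPolynomial (Fin 2) ℂ),
      g ≠ 0 → g.totalDegree ≤ δ → L.card ≤ δ ∧
      (∀ f ∈ L, Irreducible f ∧ f ∣ g ∧ f.totalDegree ≤ δ) ∧
      ∀ x, eval x g = 0 → ∃ f ∈ L, eval x f = 0 := by
    intro g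
    by_cases hg : g = 0
    · exact ⟨∅, fun h => absurd hg h⟩
    obtain ⟨L, h1, h2, h3⟩ := exists_finset_factors hg
    exact ⟨L, fun _ hd => ⟨h1.trans hd, fun f hf => ⟨(h2 f hf).1, (h2 f hf).2.1,
      (h2 f hf).2.2.trans hd⟩, h3⟩⟩
  choose L hL using hL
  have hFst : ∀ γ, (sliceFst F γ).totalDegree ≤ δ := fun γ => (totalDegree_sliceFst_le F γ).trans hδ
  have hSnd : ∀ p, (sliceSnd F p).totalDegree ≤ δ := fun p => (totalDegree_sliceSnd_le F p).trans hδ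
  obtain ⟨Deg, hDeg⟩ : ∃ Deg : ℂ × ℂ → ℂ × ℂ → ℂ × ℂ → Prop, ∀ γ p q, Deg γ p q ↔
      ∃ κ ∈ L (sliceSnd F p), eval ![γ.1, γ.2] κ = 0 ∧ κ ∣ sliceSnd F q := ⟨_, fun _ _ _ => Iff.rfl⟩
  refine sum_card_incidences_le G A B inc Deg _ _ ?_ ?_ ?_ ?_ n hn
  · intro γ _ p hp
    exact Finset.mem_product.1 ((hinc γ p).1 hp).1
  · intro p q
    refine le_trans ?_ (Nat.le_add_right _ _)
    set T := G.filter fun γ => p ∈ inc γ ∧ q ∈ inc γ ∧ ¬ Deg γ p q with hT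
    have hTm : ∀ γ ∈ T, IsGoodZero F p γ ∧ IsGoodZero F q γ ∧ ¬ Deg γ p q := fun γ hγ => by
      have := (Finset.mem_filter.1 hγ).2
      exact ⟨((hinc γ p).1 this.1).2, ((hinc γ q).1 this.2.1).2, this.2.2⟩
    rcases T.eq_empty_or_nonempty with h0 | ⟨γ₀, hγ₀⟩
    · rw [h0]; simp
    obtain ⟨hc, hirr, hcov⟩ := hL _ (hTm γ₀ hγ₀).1.sliceSnd_ne_zero (hSnd p)
    refine (card_le_mul_of_cover T (L (sliceSnd F p)) (fun γ κ => eval ![γ.1, γ.2] κ = 0) N ?_ ?_).trans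
      (Nat.mul_le_mul_left N hc)
    · intro γ hγ
      exact hcov _ (by rw [eval_sliceSnd]; exact (hTm γ hγ).1.zero)
    · intro κ hκ
      by_cases hdvd : κ ∣ sliceSnd F q
      · rw [Finset.filter_eq_empty_iff.2, Finset.card_empty]
        · exact Nat.zero_le _
        intro γ hγ hz
        exact (hTm γ hγ).2.2 ((hDeg _ _ _).2 ⟨κ, hκ, hz, hdvd⟩)
      refine hN κ _ (hirr κ hκ).1 hdvd (hirr κ hκ).2.2 (hSnd q) _ fun γ hγ => ?_
      rw [Finset.mem_filter] at hγ
      exact ⟨hγ.2, by rw [eval_sliceSnd]; exact (hTm γ hγ.1).2.1.zero⟩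
  · intro γ _ p hp
    refine le_trans ?_ (Nat.le_add_left _ _)
    have hgp := ((hinc γ p).1 hp).2
    obtain ⟨hc, hirr, -⟩ := hL _ hgp.sliceSnd_ne_zero (hSnd p)
    obtain ⟨hc', hirr', hcov'⟩ := hL _ hgp.sliceFst_ne_zero (hFst γ)
    set T := (inc γ).filter fun q => Deg γ p q with hT
    have hTm : ∀ q ∈ T, IsGoodZero F q γ ∧ Deg γ p q := fun q hq =>
      ⟨((hinc γ q).1 (Finset.mem_filter.1 hq).1).2, (Finset.mem_filter.1 hq).2⟩
    refine (card_le_mul_of_cover T (L (sliceSnd F p) ×ˢ L (sliceFst F γ))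
      (fun q k => eval ![γ.1, γ.2] k.1 = 0 ∧ k.1 ∣ sliceSnd F q ∧ eval ![q.1, q.2] k.2 = 0) N
      ?_ ?_).trans ?_
    · intro q hq
      obtain ⟨κ, hκ, h1, h2⟩ := (hDeg _ _ _).1 (hTm q hq).2
      obtain ⟨β, hβ, h3⟩ := hcov' ![q.1, q.2] (by rw [eval_sliceFst]; exact (hTm q hq).1.zero)
      exact ⟨(κ, β), Finset.mem_product.2 ⟨hκ, hβ⟩, h1, h2, h3⟩
    · rintro ⟨κ, β⟩ hk
      obtain ⟨hκ, hβ⟩ := Finset.mem_product.1 hk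
      simp only at hκ hβ ⊢
      by_cases hex : ∃ q ∈ T, eval ![γ.1, γ.2] κ = 0 ∧ κ ∣ sliceSnd F q ∧ eval ![q.1, q.2] β = 0
      · obtain ⟨q, hq, h1, h2, h3⟩ := hex
        obtain ⟨s, t, hst, hnd⟩ := (hTm q hq).1.exists_not_dvd (hirr κ hκ).1 h1 h2
          (hirr' β hβ).2.1 h3
        refine hN β _ (hirr' β hβ).1 hnd (hirr' β hβ).2.2 (hFst _) _ fun q' hq' => ?_
        rw [Finset.mem_filter] at hq'
        obtain ⟨-, -, ⟨k, hk⟩, h6⟩ := hq'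
        refine ⟨h6, ?_⟩
        rw [eval_sliceFst, ← eval_sliceSnd F q' s t, hk, map_mul, hst, zero_mul]
      · rw [Finset.filter_eq_empty_iff.2, Finset.card_empty]
        · exact Nat.zero_le _
        intro q hq hz
        exact hex ⟨q, hq, hz⟩
    · rw [Finset.card_product]
      exact Nat.mul_le_mul_left N (Nat.mul_le_mul hc hc')
  · intro γ _ I hI hcard
    have hIpos : 0 < I.card := by omega
    obtain ⟨p₀, hp₀⟩ := Finset.card_pos.1 hIpos
    have hgI : ∀ p ∈ I, p ∈ A ×ˢ B ∧ IsGoodZero F p γ := fun p hp => (hinc γ p).1 (hI hp)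
    obtain ⟨hc, hirr, hcov⟩ := hL _ (hgI p₀ hp₀).2.sliceFst_ne_zero (hFst γ)
    have hex : ∀ p, ∃ β, p ∈ I → β ∈ L (sliceFst F γ) ∧ eval ![p.1, p.2] β = 0 := by
      intro p
      by_cases hp : p ∈ I
      · obtain ⟨β, hβ, h3⟩ := hcov ![p.1, p.2] (by rw [eval_sliceFst]; exact (hgI p hp).2.zero)
        exact ⟨β, fun _ => ⟨hβ, h3⟩⟩
      · exact ⟨0, fun h => absurd h hp⟩
    choose g hg using hex
    obtain ⟨β, hβ, I', hI', hfib, hle⟩ := exists_large_fibre I (L (sliceFst F γ)) g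
      (fun p hp => (hg p hp).1) ⟨_, (hg p₀ hp₀).1⟩
    have hle' : I.card ≤ δ * I'.card := hle.trans (Nat.mul_le_mul_right _ hc)
    have hI'pos : 0 < I'.card := by
      rcases Nat.eq_zero_or_pos I'.card with h | h
      · rw [h] at hle'; omega
      · exact h
    have hKI : K ≤ I'.card := by
      by_contra! hlt
      have := Nat.mul_le_mul_left δ hlt.le
      omega
    obtain ⟨p₁, hp₁⟩ := Finset.card_pos.1 hI'pos
    have hβz : ∀ p ∈ I', eval ![p.1, p.2] β = 0 := fun p hp => by
      rw [← hfib p hp]; exact (hg p (hI' hp)).2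
    obtain ⟨hd0, hd1⟩ := pderiv_ne_zero_of_dvd_sliceFst (hgI p₁ (hI' hp₁)).2 (hirr β hβ).2.1
      (hβz p₁ hp₁)
    have hcs : (I'.image Prod.swap).card = I'.card :=
      Finset.card_image_of_injective _ Prod.swap_injective
    obtain ⟨p, hp, q, hq, hpq, hn1, hn2⟩ := hK β (hirr β hβ).1 (hirr β hβ).2.2 hd0 hd1 B A
      (I'.image Prod.swap) (fun p hp => by
        obtain ⟨q, hq, rfl⟩ := Finset.mem_image.1 hp
        have := Finset.mem_product.1 (hgI q (hI' hq)).1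
        exact ⟨this.2, this.1, hβz q hq⟩) (by rw [hcs]; exact hKI)
    obtain ⟨p, hp', rfl⟩ := Finset.mem_image.1 hp
    obtain ⟨q, hq', rfl⟩ := Finset.mem_image.1 hq
    rw [hcs] at hn1 hn2
    have hmono : ∀ a : ℕ, (K : ℝ) * a / I'.card ≤ ((δ * K + 1 : ℕ) : ℝ) * a / I.card := by
      intro a
      rw [div_le_div_iff₀ (by exact_mod_cast hI'pos) (by exact_mod_cast hIpos)]
      have : K * a * I.card ≤ (δ * K + 1) * a * I'.card := by
        calc K * a * I.card ≤ K * a * (δ * I'.card) := Nat.mul_le_mul_left _ hle'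
          _ = δ * K * a * I'.card := by ring
          _ ≤ _ := by gcongr; omega
      exact_mod_cast this
    exact ⟨p, hI' hp', q, hI' hq', fun h => hpq (by rw [h]), hn2.mono (hmono _), hn1.mono (hmono _)⟩

lemma totalDegree_pderiv_le' {n : ℕ} {f : MvPolynomial (Fin n) ℂ} {δ : ℕ} (h : f.totalDegree ≤ δ)
    (i : Fin n) : (pderiv i f).totalDegree ≤ δ :=
  (totalDegree_pderiv_le f i).trans (by omega)

lemma totalDegree_mul_le_of_le {n : ℕ} {f g : MvPolynomial (Fin n) ℂ} {a b : ℕ}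
    (hf : f.totalDegree ≤ a) (hg : g.totalDegree ≤ b) : (f * g).totalDegree ≤ a + b :=
  (totalDegree_mul f g).trans (add_le_add hf hg)

lemma totalDegree_sub_le_of_le {n : ℕ} {f g : MvPolynomial (Fin n) ℂ} {a : ℕ}
    (hf : f.totalDegree ≤ a) (hg : g.totalDegree ≤ a) : (f - g).totalDegree ≤ a :=
  (totalDegree_sub f g).trans (max_le hf hg)

lemma totalDegree_splitObstruction_le {F : MvPolynomial (Fin 4) ℂ} {δ : ℕ}
    (h : F.totalDegree ≤ δ) : (splitObstruction F).totalDegree ≤ δ + (δ + δ) := by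
  have h1 := fun i => totalDegree_pderiv_le' h i
  have h2 := fun i j => totalDegree_pderiv_le' (h1 i) j
  exact totalDegree_sub_le_of_le
    (totalDegree_mul_le_of_le (h1 _) (totalDegree_sub_le_of_le
      (totalDegree_mul_le_of_le (h1 _) (h2 _ _)) (totalDegree_mul_le_of_le (h1 _) (h2 _ _))))
    (totalDegree_mul_le_of_le (h1 _) (totalDegree_sub_le_of_le
      (totalDegree_mul_le_of_le (h1 _) (h2 _ _)) (totalDegree_mul_le_of_le (h1 _) (h2 _ _))))

lemma not_dvd_pderiv {n : ℕ} {F : MvPolynomial (Fin n) ℂ} (hF : Irreducible F) {i : Fin n}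
    (hi : pderiv i F ≠ 0) : ¬ F ∣ pderiv i F := by
  refine not_dvd_of_totalDegree_lt hi ?_
  have := totalDegree_pderiv_le F i
  have := one_le_totalDegree_of_irreducible hF
  omega

lemma exists_bad_zeros_bound (δ : ℕ) : ∃ K : ℕ, ∀ F : MvPolynomial (Fin 4) ℂ,
    Irreducible F → F.totalDegree ≤ δ → (∀ i, pderiv i F ≠ 0) → ¬ F ∣ splitObstruction F →
    ∀ (A B C D : Finset ℂ) (T : Finset (ℂ × ℂ × ℂ × ℂ)), T ⊆ A ×ˢ B ×ˢ C ×ˢ D →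
    (∀ q ∈ T, eval ![q.1, q.2.1, q.2.2.1, q.2.2.2] F = 0 ∧
      ¬ IsGoodZero F (q.1, q.2.1) (q.2.2.1, q.2.2.2)) →
    T.card ≤ K * (A.card * B.card + A.card * C.card + A.card * D.card + B.card * C.card +
      B.card * D.card + C.card * D.card) := by
  obtain ⟨K, hK⟩ := card_common_zeros_le 4 (δ + (δ + δ) + (δ + δ + (δ + δ)))
  refine ⟨K, fun F hF hδ hd hs A B C D T hT hbad => ?_⟩
  have hp := hF.prime
  set g := splitObstruction F * (pderiv 0 F * pderiv 1 F * (pderiv 2 F * pderiv 3 F)) with hg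
  have hndvd : ¬ F ∣ g := by
    rw [hg]
    simp only [hp.dvd_mul, not_or]
    exact ⟨hs, ⟨not_dvd_pderiv hF (hd 0), not_dvd_pderiv hF (hd 1)⟩,
      not_dvd_pderiv hF (hd 2), not_dvd_pderiv hF (hd 3)⟩
  have h1 := fun i => totalDegree_pderiv_le' hδ i
  have hdeg : g.totalDegree ≤ δ + (δ + δ) + (δ + δ + (δ + δ)) :=
    totalDegree_mul_le_of_le (totalDegree_splitObstruction_le hδ)
      (totalDegree_mul_le_of_le (totalDegree_mul_le_of_le (h1 _) (h1 _))
        (totalDegree_mul_le_of_le (h1 _) (h1 _)))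
  have hmain := hK F g hF hndvd (by omega) hdeg ![A, B, C, D]
  have hcard : codimTwo 4 (fun i => (![A, B, C, D] i).card) =
      A.card * B.card + A.card * C.card + A.card * D.card + B.card * C.card +
      B.card * D.card + C.card * D.card := by
    simp [codimTwo, codimOne, Fin.tail, Fin.prod_univ_succ]
    ring
  rw [hcard] at hmain
  refine le_trans ?_ hmain
  refine Finset.card_le_card_of_injOn (fun q => ![q.1, q.2.1, q.2.2.1, q.2.2.2]) ?_ ?_
  · intro q hq
    have hq' := hT hq
    simp only [Finset.mem_product] at hq'
    obtain ⟨hz, hng⟩ := hbad q hq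
    refine Finset.mem_coe.2 (Finset.mem_filter.2 ⟨Fintype.mem_piFinset.2 fun i => ?_, hz, ?_⟩)
    · fin_cases i
      exacts [hq'.1, hq'.2.1, hq'.2.2.1, hq'.2.2.2]
    · by_contra hne
      rw [hg] at hne
      simp only [map_mul, mul_ne_zero_iff] at hne
      refine hng ⟨hz, fun i => ?_, hne.1⟩
      fin_cases i
      exacts [hne.2.1.1, hne.2.1.2, hne.2.2.1, hne.2.2.2]
  · intro q _ q' _ h
    have h0 := congrFun h 0
    have h1 := congrFun h 1
    have h2 := congrFun h 2
    have h3 := congrFun h 3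
    exact Prod.ext h0 (Prod.ext h1 (Prod.ext h2 h3))

/-- The bound on the right-hand side of the four-dimensional Elekes–Szabó theorem. -/
def gridBound (a b c d : ℝ) : ℝ :=
  a ^ ((2 : ℝ) / 3) * b ^ ((2 : ℝ) / 3) * c ^ ((2 : ℝ) / 3) * d ^ ((2 : ℝ) / 3)
    + a * b + a * c + a * d + b * c + b * d + c * d

lemma exists_optimal_parameter {a b c d : ℝ} (ha : 0 < a) (hb : 0 < b) (hc : 0 < c) (hd : 0 < d) :
    ∃ n : ℝ, 0 < n ∧
      c * d * n = a ^ ((2 : ℝ) / 3) * b ^ ((2 : ℝ) / 3) * c ^ ((2 : ℝ) / 3) * d ^ ((2 : ℝ) / 3) ∧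
      (a * b / n) ^ 2 =
        a ^ ((2 : ℝ) / 3) * b ^ ((2 : ℝ) / 3) * c ^ ((2 : ℝ) / 3) * d ^ ((2 : ℝ) / 3) := by
  have key : ∀ x : ℝ, 0 < x → ∃ u : ℝ, 0 < u ∧ x = u ^ 3 ∧ x ^ ((2 : ℝ) / 3) = u ^ 2 := by
    intro x hx
    refine ⟨x ^ ((1 : ℝ) / 3), by positivity, ?_, ?_⟩
    · rw [← Real.rpow_natCast, ← Real.rpow_mul hx.le]; norm_num
    · rw [← Real.rpow_natCast, ← Real.rpow_mul hx.le]; norm_num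
  obtain ⟨u, hu, h1, h1'⟩ := key a ha
  obtain ⟨v, hv, h2, h2'⟩ := key b hb
  obtain ⟨w, hw, h3, h3'⟩ := key c hc
  obtain ⟨z, hz, h4, h4'⟩ := key d hd
  rw [h1', h2', h3', h4', h1, h2, h3, h4]
  refine ⟨u ^ 2 * v ^ 2 / (w * z), by positivity, ?_, ?_⟩ <;> field_simp

lemma combine_bounds {M K K' R s₁ s₂ s₃ s₄ s₅ s₆ : ℝ} (hM : 0 ≤ M) (hK : 0 ≤ K) (hK' : 0 ≤ K')
    (hR : 0 ≤ R) (h₁ : 0 ≤ s₁) (h₂ : 0 ≤ s₂) (h₃ : 0 ≤ s₃) (h₄ : 0 ≤ s₄) (h₅ : 0 ≤ s₅)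
    (h₆ : 0 ≤ s₆) :
    (2 * M + 1) * (K + 1) * s₆ + (2 * M + 1) * K * R + 9 * M * R +
      K' * (s₁ + s₂ + s₃ + s₄ + s₅ + s₆) ≤
    ((2 * M + 1) * (K + 1) + (2 * M + 1) * K + 9 * M + K' + 1) *
      (R + s₁ + s₂ + s₃ + s₄ + s₅ + s₆) := by
  have p1 : 0 ≤ ((2 * M + 1) * (K + 1) + K' + 1) * R := by positivity
  have p2 : 0 ≤ ((2 * M + 1) * (K + 1) + (2 * M + 1) * K + 9 * M + 1) *
    (s₁ + s₂ + s₃ + s₄ + s₅) := by positivity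
  have p3 : 0 ≤ ((2 * M + 1) * K + 9 * M + 1) * s₆ := by positivity
  linarith

/-- The grid bound holds if the obstruction does not vanish on `Z(F)`. -/
theorem exists_bound_of_not_dvd (δ : ℕ) : ∃ c : ℝ, 0 < c ∧ ∀ F : MvPolynomial (Fin 4) ℂ,
    Irreducible F → F.totalDegree ≤ δ → (∀ i, pderiv i F ≠ 0) → ¬ F ∣ splitObstruction F →
    ∀ (A B C D : Finset ℂ) (T : Finset (ℂ × ℂ × ℂ × ℂ)), T ⊆ A ×ˢ B ×ˢ C ×ˢ D →
    (∀ q ∈ T, eval ![q.1, q.2.1, q.2.2.1, q.2.2.2] F = 0) →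
    (T.card : ℝ) ≤ c * gridBound A.card B.card C.card D.card := by
  obtain ⟨M, K, hgood⟩ := exists_good_zeros_bound δ
  obtain ⟨K', hbad⟩ := exists_bad_zeros_bound δ
  refine ⟨(2 * M + 1) * (K + 1) + (2 * M + 1) * K + 9 * M + K' + 1, by positivity,
    fun F hF hδ hd hs A B C D T hT hz => ?_⟩
  rcases T.eq_empty_or_nonempty with rfl | ⟨q₀, hq₀⟩
  · simp only [Finset.card_empty, Nat.cast_zero, gridBound]
    positivity
  have hq₀' := hT hq₀
  simp only [Finset.mem_product] at hq₀'
  have hA : (0 : ℝ) < A.card := by exact_mod_cast Finset.card_pos.2 ⟨_, hq₀'.1⟩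
  have hB : (0 : ℝ) < B.card := by exact_mod_cast Finset.card_pos.2 ⟨_, hq₀'.2.1⟩
  have hC : (0 : ℝ) < C.card := by exact_mod_cast Finset.card_pos.2 ⟨_, hq₀'.2.2.1⟩
  have hD : (0 : ℝ) < D.card := by exact_mod_cast Finset.card_pos.2 ⟨_, hq₀'.2.2.2⟩
  obtain ⟨n, hn, hn1, hn2⟩ := exists_optimal_parameter hA hB hC hD
  obtain ⟨Z, hZ⟩ : ∃ Z : ℂ × ℂ × ℂ × ℂ → Prop, ∀ q, Z q ↔
    IsGoodZero F (q.1, q.2.1) (q.2.2.1, q.2.2.2) := ⟨_, fun _ => Iff.rfl⟩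
  obtain ⟨inc, hinc⟩ : ∃ inc : ℂ × ℂ → Finset (ℂ × ℂ), ∀ γ p, p ∈ inc γ ↔
      p ∈ A ×ˢ B ∧ IsGoodZero F p γ :=
    ⟨fun γ => (A ×ˢ B).filter fun p => IsGoodZero F p γ, fun γ p => by
      rw [Finset.mem_filter]⟩
  have h1 := hgood F hδ A B (C ×ˢ D) inc hinc n hn
  have h2 : (T.filter fun q => Z q).card ≤ ∑ γ ∈ C ×ˢ D, (inc γ).card := by
    rw [← Finset.card_sigma]
    refine Finset.card_le_card_of_injOn (fun q => ⟨(q.2.2.1, q.2.2.2), (q.1, q.2.1)⟩) ?_ ?_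
    · intro q hq
      obtain ⟨hqT, hqZ⟩ := Finset.mem_filter.1 hq
      have hq' := hT hqT
      simp only [Finset.mem_product] at hq'
      exact Finset.mem_coe.2 (Finset.mem_sigma.2 ⟨Finset.mem_product.2 hq'.2.2,
        (hinc _ _).2 ⟨Finset.mem_product.2 ⟨hq'.1, hq'.2.1⟩, (hZ q).1 hqZ⟩⟩)
    · rintro ⟨x, y, s, t⟩ _ ⟨x', y', s', t'⟩ _ h
      simp only [Sigma.mk.injEq, Prod.mk.injEq, heq_eq_eq] at h
      simp only [Prod.mk.injEq]
      tauto
  have h3 := hbad F hF hδ hd hs A B C D (T.filter fun q => ¬ Z q)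
    ((Finset.filter_subset _ _).trans hT) fun q hq => by
      obtain ⟨hqT, hqZ⟩ := Finset.mem_filter.1 hq
      exact ⟨hz q hqT, fun h => hqZ ((hZ q).2 h)⟩
  have h4 := Finset.card_filter_add_card_filter_not (s := T) Z
  have h2' : ((T.filter fun q => Z q).card : ℝ) ≤ ∑ γ ∈ C ×ˢ D, ((inc γ).card : ℝ) := by
    exact_mod_cast h2
  have h3' : ((T.filter fun q => ¬ Z q).card : ℝ) ≤ K' * (A.card * B.card + A.card * C.card +
      A.card * D.card + B.card * C.card + B.card * D.card + C.card * D.card) := by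
    exact_mod_cast h3
  have h4' : (T.card : ℝ) = (T.filter fun q => Z q).card + (T.filter fun q => ¬ Z q).card := by
    exact_mod_cast h4.symm
  rw [hn2, Finset.card_product, Nat.cast_mul] at h1
  rw [h4', gridBound]
  set R := (A.card : ℝ) ^ ((2 : ℝ) / 3) * (B.card : ℝ) ^ ((2 : ℝ) / 3) *
    (C.card : ℝ) ^ ((2 : ℝ) / 3) * (D.card : ℝ) ^ ((2 : ℝ) / 3) with hR
  have hR0 : 0 ≤ R := by positivity
  have e1 : (C.card : ℝ) * D.card * ((2 * M + 1) * (K * (1 + n) + 1)) =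
      (2 * M + 1) * (K + 1) * (C.card * D.card) + (2 * M + 1) * K * R := by
    rw [← hn1]; ring
  rw [e1] at h1
  have h5 := add_le_add (h2'.trans h1) h3'
  exact h5.trans (combine_bounds (Nat.cast_nonneg M) (Nat.cast_nonneg K) (Nat.cast_nonneg K') hR0
    (by positivity) (by positivity) (by positivity) (by positivity) (by positivity) (by positivity))

lemma IsAlgSet.eq_zeroLocus {n : ℕ} {S : Set (Fin n → ℂ)} (h : IsAlgSet S) :
    zeroLocus ℂ (vanishingIdeal ℂ S) = S := by
  obtain ⟨I, rfl⟩ := h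
  refine Set.Subset.antisymm (fun x hx f hf => ?_) (zeroLocus_vanishingIdeal_le _)
  have := hx f fun y hy => by simpa [coe_aeval_eq_eval] using hy f hf
  simpa [coe_aeval_eq_eval] using this

lemma IsAlgSet.inter_zero {n : ℕ} {S : Set (Fin n → ℂ)} (h : IsAlgSet S)
    (f : MvPolynomial (Fin n) ℂ) : IsAlgSet (S ∩ {x | eval x f = 0}) := by
  obtain ⟨I, rfl⟩ := h
  refine ⟨insert f I, Set.ext fun x => ?_⟩
  simp only [zeroSetOf, Set.mem_inter_iff, Set.mem_ofPred_eq, Set.mem_insert_iff, forall_eq_or_imp]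
  tauto

lemma IsIrredAlgSet.isPrime {n : ℕ} {S : Set (Fin n → ℂ)} (h : IsIrredAlgSet S) :
    (vanishingIdeal ℂ S).IsPrime := by
  obtain ⟨hS, ⟨x₀, hx₀⟩, hirr⟩ := h
  have hmem : ∀ f : MvPolynomial (Fin n) ℂ, f ∈ vanishingIdeal ℂ S ↔ ∀ x ∈ S, eval x f = 0 :=
    fun f => by simp [mem_vanishingIdeal_iff]
  rw [Ideal.isPrime_iff]
  refine ⟨fun htop => ?_, fun {f g} hfg => ?_⟩
  · have : (1 : MvPolynomial (Fin n) ℂ) ∈ vanishingIdeal ℂ S := by rw [htop]; trivial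
    simpa using (hmem 1).1 this x₀ hx₀
  · have hunion : S = (S ∩ {x | eval x f = 0}) ∪ (S ∩ {x | eval x g = 0}) := by
      ext x
      constructor
      · intro hx
        have := (hmem _).1 hfg x hx
        rw [map_mul, mul_eq_zero] at this
        exact this.imp (fun h => ⟨hx, h⟩) fun h => ⟨hx, h⟩
      · rintro (h | h) <;> exact h.1
    rcases hirr _ _ (hS.inter_zero f) (hS.inter_zero g) hunion with h | h
    · exact Or.inl ((hmem f).2 fun x hx => (h ▸ hx : x ∈ S ∩ {x | eval x f = 0}).2)
    · exact Or.inr ((hmem g).2 fun x hx => (h ▸ hx : x ∈ S ∩ {x | eval x g = 0}).2)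

/-- A proper hypersurface section of an irreducible hypersurface in `ℂ⁴` has dimension at most 2. -/
lemma algDimLE_two_of_not_dvd {F g : MvPolynomial (Fin 4) ℂ} (hF : Irreducible F)
    (hg : ¬ F ∣ g) : algDimLE {v : Fin 4 → ℂ | eval v F = 0 ∧ eval v g = 0} 2 := by
  intro Z hZ hmono
  have hprime : ∀ i, (vanishingIdeal ℂ (Z i)).IsPrime := fun i => (hZ i).1.isPrime
  have hFp : (Ideal.span {F}).IsPrime := (Ideal.span_singleton_prime hF.ne_zero).2 hF.prime
  have hlt : ∀ i j, i < j → vanishingIdeal ℂ (Z j) < vanishingIdeal ℂ (Z i) := by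
    intro i j hij
    refine lt_of_le_of_ne (vanishingIdeal_anti_mono (hmono hij).le) fun h => (hmono hij).ne ?_
    rw [← (hZ i).1.1.eq_zeroLocus, ← (hZ j).1.1.eq_zeroLocus, h]
  have hFlt : Ideal.span {F} < vanishingIdeal ℂ (Z 3) := by
    refine lt_of_le_of_ne ?_ fun h => hg ?_
    · rw [Ideal.span_singleton_le_iff_mem]
      intro x hx
      simpa [coe_aeval_eq_eval] using ((hZ 3).2 hx).1
    · rw [← Ideal.mem_span_singleton, h]
      intro x hx
      simpa [coe_aeval_eq_eval] using ((hZ 3).2 hx).2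
  have hbot : (⊥ : Ideal (MvPolynomial (Fin 4) ℂ)) < Ideal.span {F} := by
    rw [bot_lt_iff_ne_bot, Ne, Ideal.span_singleton_eq_bot]
    exact hF.ne_zero
  let P : Fin 6 → PrimeSpectrum (MvPolynomial (Fin 4) ℂ) :=
    ![⟨⊥, Ideal.isPrime_bot⟩, ⟨_, hFp⟩, ⟨_, hprime 3⟩, ⟨_, hprime 2⟩, ⟨_, hprime 1⟩, ⟨_, hprime 0⟩]
  let s : LTSeries (PrimeSpectrum (MvPolynomial (Fin 4) ℂ)) :=
    { length := 5
      toFun := P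
      step := by
        intro i
        fin_cases i
        · exact hbot
        · exact hFlt
        · exact hlt 2 3 (by decide)
        · exact hlt 1 2 (by decide)
        · exact hlt 0 1 (by decide) }
  have h1 := Order.LTSeries.length_le_krullDim s
  have h2 : ringKrullDim (MvPolynomial (Fin 4) ℂ) = 4 := by
    rw [MvPolynomial.ringKrullDim_of_isNoetherianRing, ringKrullDim_eq_zero_of_field]
    simp
  have h3 : ((5 : ℕ) : WithBot ℕ∞) ≤ (4 : ℕ) := by
    rw [ringKrullDim] at h2
    rw [h2] at h1
    exact h1
  have h4 : (5 : ℕ) ≤ 4 := by exact_mod_cast h3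
  omega

open Filter Topology in
/-- Projection to the hypersurface `F = 0` along the `i`-th coordinate near a point where `F_i` does
not vanish. -/
lemma exists_zero_projection {n : ℕ} {F : MvPolynomial (Fin n) ℂ} {v : Fin n → ℂ} (i : Fin n)
    (h0 : eval v F = 0) (hi : eval v (pderiv i F) ≠ 0) :
    ∃ π : (Fin n → ℂ) → Fin n → ℂ, π v = v ∧ (∀ u w, π (Function.update u i w) = π u) ∧
      ∀ᶠ u in 𝓝 v, DifferentiableAt ℂ π u ∧ eval (π u) F = 0 ∧ (∀ j, j ≠ i → π u j = u j) ∧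
        (eval u F = 0 → π u = u) := by
  let Φ : (Fin n → ℂ) → Fin n → ℂ := fun u => u + (eval u F - u i) • Pi.single i (1 : ℂ)
  have hΦi : ∀ u, Φ u i = eval u F := fun u => by simp [Φ]
  have hΦj : ∀ u j, j ≠ i → Φ u j = u j := fun u j hj => by simp [Φ, hj]
  let ev : (Fin n → ℂ) →L[ℂ] ℂ :=
    ∑ k, eval v (pderiv k F) • (ContinuousLinearMap.proj k : (Fin n → ℂ) →L[ℂ] ℂ)
  let L : (Fin n → ℂ) →L[ℂ] (Fin n → ℂ) := ContinuousLinearMap.id ℂ _ +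
    (ev - ContinuousLinearMap.proj i).smulRight (Pi.single i (1 : ℂ))
  have hL : HasFDerivAt Φ L v :=
    (hasFDerivAt_id v).add (((hasStrictFDerivAt_mvPolynomial F v).hasFDerivAt.sub
      (ContinuousLinearMap.proj (R := ℂ) (φ := fun _ : Fin n => ℂ) i).hasFDerivAt).smul_const _)
  have hinj : Function.Injective L := by
    rw [injective_iff_map_eq_zero]
    intro w hw
    have hwj : ∀ j, j ≠ i → w j = 0 := fun j hj => by
      have := congrFun hw j
      simpa [L, hj] using this
    have hwi : ev w = 0 := by
      have := congrFun hw i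
      simpa [L] using this
    have hev : ev w = eval v (pderiv i F) * w i := by
      simp only [ev, sum_apply, smul_apply,
        ContinuousLinearMap.proj_apply, smul_eq_mul]
      exact Finset.sum_eq_single i (fun j _ hj => by rw [hwj j hj, mul_zero]) (by simp)
    rw [hev] at hwi
    ext j
    by_cases hj : j = i
    · subst hj; simpa [hi] using hwi
    · exact hwj j hj
  let E : (Fin n → ℂ) ≃L[ℂ] (Fin n → ℂ) :=
    (LinearEquiv.ofInjectiveEndo (L : (Fin n → ℂ) →ₗ[ℂ] (Fin n → ℂ)) hinj).toContinuousLinearEquiv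
  have hE : (E : (Fin n → ℂ) →L[ℂ] (Fin n → ℂ)) = L := by
    ext w : 1
    rfl
  have hsm : ContDiffAt ℂ 1 Φ v := by
    have hF : ContDiff ℂ 1 fun u : Fin n → ℂ => eval u F := by
      have : AnalyticOnNhd ℂ (fun u : Fin n → ℂ => eval u F) Set.univ :=
        AnalyticOnNhd.eval_mvPolynomial F
      exact this.contDiff
    have : ContDiff ℂ 1 Φ := by
      have h2 : ContDiff ℂ 1 fun u : Fin n → ℂ => u i := contDiff_apply ℂ ℂ i
      exact contDiff_id.add ((hF.sub h2).smul contDiff_const)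
    exact this.contDiffAt
  rw [← hE] at hL
  have hstrict := hsm.hasStrictFDerivAt' hL one_ne_zero
  set Ψ := hstrict.localInverse Φ E v with hΨ
  have hΦv : Φ v = Function.update v i 0 := by
    ext j
    by_cases hj : j = i
    · subst hj; simp [hΦi, h0]
    · simp [hΦj v j hj, hj]
  have hΨv : Ψ (Φ v) = v := hstrict.localInverse_apply_image
  have hleft : ∀ᶠ u in 𝓝 v, Ψ (Φ u) = u := hstrict.eventually_left_inverse
  have hright : ∀ᶠ w in 𝓝 (Φ v), Φ (Ψ w) = w := hstrict.eventually_right_inverse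
  have hdiff : ∀ᶠ w in 𝓝 (Φ v), DifferentiableAt ℂ Ψ w := by
    have h1 : ContDiffAt ℂ 1 Ψ (Φ v) := hsm.to_localInverse hL one_ne_zero
    filter_upwards [h1.eventually (by simp)] with w hw
    exact hw.differentiableAt one_ne_zero
  have hup : Differentiable ℂ fun u : Fin n → ℂ => Function.update u i 0 := by
    rw [differentiable_pi]
    intro j
    by_cases hj : j = i
    · subst hj; simp
    · simpa [hj] using differentiable_apply j
  have htend : Tendsto (fun u : Fin n → ℂ => Function.update u i 0) (𝓝 v) (𝓝 (Φ v)) := by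
    rw [hΦv]
    exact hup.continuous.continuousAt
  refine ⟨fun u => Ψ (Function.update u i 0), ?_, fun u w => by simp, ?_⟩
  · change Ψ (Function.update v i 0) = v
    rw [← hΦv, hΨv]
  · filter_upwards [hleft, htend.eventually hright, htend.eventually hdiff] with u h1 h2 h3
    refine ⟨h3.comp u (hup u), ?_, fun j hj => ?_, fun hz => ?_⟩
    · rw [← hΦi, h2]; simp
    · rw [← hΦj (Ψ (Function.update u i 0)) j hj, h2]; simp [hj]
    · have : Function.update u i 0 = Φ u := by
        ext j
        by_cases hj : j = i
        · subst hj; simp [hΦi, hz]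
        · simp [hΦj u j hj, hj]
      rw [this, h1]

open Filter Topology in
/-- Derivative of a polynomial along a coordinate line of a zero projection. -/
lemma hasDerivAt_eval_projection {n : ℕ} {F : MvPolynomial (Fin n) ℂ}
    {π : (Fin n → ℂ) → Fin n → ℂ} {i j : Fin n} (hij : j ≠ i) {u : Fin n → ℂ}
    (hd : DifferentiableAt ℂ π u) (hi : eval (π u) (pderiv i F) ≠ 0)
    (hz : ∀ᶠ w in 𝓝 u, eval (π w) F = 0) (hc : ∀ᶠ w in 𝓝 u, ∀ k, k ≠ i → π w k = w k)
    (P : MvPolynomial (Fin n) ℂ) :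
    HasDerivAt (fun z => eval (π (Function.update u j z)) P)
      (eval (π u) (pderiv j P) -
        eval (π u) (pderiv j F) / eval (π u) (pderiv i F) * eval (π u) (pderiv i P)) (u j) := by
  have hup : HasDerivAt (fun z => Function.update u j z) (Pi.single j 1) (u j) :=
    hasDerivAt_update u j (u j)
  have htend : Tendsto (fun z => Function.update u j z) (𝓝 (u j)) (𝓝 u) := by
    have := hup.continuousAt.tendsto
    rwa [Function.update_eq_self] at this
  have hd' : HasFDerivAt π (fderiv ℂ π u) (Function.update u j (u j)) := by
    rw [Function.update_eq_self]; exact hd.hasFDerivAt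
  have hcurve := hd'.comp_hasDerivAt (u j) hup
  set d := (fderiv ℂ π u) (Pi.single j 1) with hd_def
  have hpoly : ∀ Q : MvPolynomial (Fin n) ℂ,
      HasDerivAt (fun z => eval (π (Function.update u j z)) Q)
        (∑ k, eval (π u) (pderiv k Q) * d k) (u j) := by
    intro Q
    have h1 : HasFDerivAt (fun w : Fin n → ℂ => eval w Q) _ (π (Function.update u j (u j))) :=
      (hasStrictFDerivAt_mvPolynomial Q _).hasFDerivAt
    have h2 := h1.comp_hasDerivAt (u j) hcurve
    rw [Function.update_eq_self] at h2
    have h3 : HasDerivAt (fun z => eval (π (Function.update u j z)) Q) _ (u j) := h2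
    convert! h3 using 1
    simp [sum_apply]
  have hdk : ∀ k, k ≠ i → d k = (Pi.single j (1 : ℂ) : Fin n → ℂ) k := by
    intro k hk
    have h1 : HasDerivAt (fun z => π (Function.update u j z) k) (d k) (u j) :=
      (hasDerivAt_pi.1 hcurve) k
    have h2 : HasDerivAt (fun z => Function.update u j z k) ((Pi.single j (1 : ℂ) : Fin n → ℂ) k)
      (u j) := (hasDerivAt_pi.1 hup) k
    refine h1.unique (h2.congr_of_eventuallyEq ?_)
    filter_upwards [htend.eventually hc] with z hz
    exact hz k hk
  have hsum : ∀ Q : MvPolynomial (Fin n) ℂ, ∑ k, eval (π u) (pderiv k Q) * d k =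
      eval (π u) (pderiv j Q) + eval (π u) (pderiv i Q) * d i := by
    intro Q
    rw [← Finset.add_sum_erase _ _ (Finset.mem_univ i), Finset.sum_eq_single j, hdk j hij,
      Pi.single_eq_same, mul_one, add_comm]
    · intro k hk hkj
      rw [hdk k (Finset.ne_of_mem_erase hk), Pi.single_eq_of_ne hkj, mul_zero]
    · intro h; simp [hij] at h
  have hF0 : eval (π u) (pderiv j F) + eval (π u) (pderiv i F) * d i = 0 := by
    rw [← hsum]
    refine (hpoly F).unique ((hasDerivAt_const (u j) (0 : ℂ)).congr_of_eventuallyEq ?_)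
    exact htend.eventually hz
  have hdi : d i = -(eval (π u) (pderiv j F) / eval (π u) (pderiv i F)) := by
    field_simp
    linear_combination hF0
  have := hpoly P
  rw [hsum, hdi] at this
  convert! this using 1
  ring

lemma update_mem_ball {n : ℕ} {v u : Fin n → ℂ} {ε : ℝ} (hε : 0 < ε) (hu : u ∈ Metric.ball v ε)
    {j : Fin n} {z : ℂ} (hz : z ∈ Metric.ball (v j) ε) :
    Function.update u j z ∈ Metric.ball v ε := by
  rw [Metric.mem_ball, dist_pi_lt_iff hε] at hu ⊢
  intro k
  by_cases hk : k = j
  · subst hk; simpa using hz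
  · simpa [hk] using hu k

/-- `π` projects a polydisc around `v` to `Z(F)` along the `i`-th coordinate, avoiding the critical
points of the coordinates. -/
structure IsZeroProjection {n : ℕ} (F : MvPolynomial (Fin n) ℂ) (i : Fin n) (v : Fin n → ℂ) (ε : ℝ)
    (π : (Fin n → ℂ) → Fin n → ℂ) : Prop where
  pos : 0 < ε
  center : π v = v
  update : ∀ u w, π (Function.update u i w) = π u
  diff : ∀ u ∈ Metric.ball v ε, DifferentiableAt ℂ π u
  zero : ∀ u ∈ Metric.ball v ε, eval (π u) F = 0
  coord : ∀ u ∈ Metric.ball v ε, ∀ k, k ≠ i → π u k = u k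
  fix : ∀ u ∈ Metric.ball v ε, eval u F = 0 → π u = u
  deriv : ∀ u ∈ Metric.ball v ε, ∀ k, eval (π u) (pderiv k F) ≠ 0

open Filter Topology in
lemma exists_isZeroProjection {n : ℕ} {F : MvPolynomial (Fin n) ℂ} {v : Fin n → ℂ} (i : Fin n)
    (h0 : eval v F = 0) (hd : ∀ k, eval v (pderiv k F) ≠ 0) {U : Set (Fin n → ℂ)} (hU : U ∈ 𝓝 v) :
    ∃ ε π, IsZeroProjection F i v ε π ∧ ∀ u ∈ Metric.ball v ε, π u ∈ U := by
  obtain ⟨π, hπv, hup, hev⟩ := exists_zero_projection i h0 (hd i)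
  have hcont : Tendsto π (𝓝 v) (𝓝 v) := by
    have := hev.self_of_nhds.1.continuousAt.tendsto
    rwa [hπv] at this
  have hder : ∀ᶠ u in 𝓝 v, ∀ k, eval u (pderiv k F) ≠ 0 := by
    rw [eventually_all]
    exact fun k => (hasStrictFDerivAt_mvPolynomial (pderiv k F) v).continuousAt.eventually_ne (hd k)
  obtain ⟨ε, hε, hball⟩ := Metric.eventually_nhds_iff_ball.1
    (hev.and ((hcont.eventually hder).and (hcont.eventually hU)))
  exact ⟨ε, π, ⟨hε, hπv, hup, fun u hu => (hball u hu).1.1, fun u hu => (hball u hu).1.2.1,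
    fun u hu => (hball u hu).1.2.2.1, fun u hu => (hball u hu).1.2.2.2,
    fun u hu => (hball u hu).2.1⟩, fun u hu => (hball u hu).2.2⟩

lemma IsZeroProjection.hasDerivAt {n : ℕ} {F : MvPolynomial (Fin n) ℂ} {i j : Fin n}
    {v u : Fin n → ℂ} {ε : ℝ} {π : (Fin n → ℂ) → Fin n → ℂ} (h : IsZeroProjection F i v ε π)
    (hu : u ∈ Metric.ball v ε) (hij : j ≠ i) (P : MvPolynomial (Fin n) ℂ) :
    HasDerivAt (fun z => eval (π (Function.update u j z)) P)
      (eval (π u) (pderiv j P) -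
        eval (π u) (pderiv j F) / eval (π u) (pderiv i F) * eval (π u) (pderiv i P)) (u j) := by
  have hn := Metric.isOpen_ball.mem_nhds hu
  refine hasDerivAt_eval_projection hij (h.diff u hu) (h.deriv u hu i) ?_ ?_ P
  · filter_upwards [hn] with w hw using h.zero w hw
  · filter_upwards [hn] with w hw using h.coord w hw

lemma eq_of_forall_hasDerivAt_zero {n : ℕ} {v : Fin n → ℂ} {ε : ℝ} (hε : 0 < ε) {j : Fin n}
    {h : (Fin n → ℂ) → ℂ}
    (hd : ∀ u ∈ Metric.ball v ε, HasDerivAt (fun z => h (Function.update u j z)) 0 (u j))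
    {u : Fin n → ℂ} (hu : u ∈ Metric.ball v ε) {z : ℂ} (hz : z ∈ Metric.ball (v j) ε) :
    h (Function.update u j z) = h u := by
  have hda : ∀ w ∈ Metric.ball (v j) ε, HasDerivAt (fun z => h (Function.update u j z)) 0 w := by
    intro w hw
    have := hd _ (update_mem_ball hε hu hw)
    simpa using this
  have huj : u j ∈ Metric.ball (v j) ε := (dist_pi_lt_iff hε).1 hu j
  have := Metric.isOpen_ball.is_const_of_deriv_eq_zero (convex_ball (v j) ε).isPreconnected
    (fun w hw => (hda w hw).differentiableAt.differentiableWithinAt)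
    (fun w hw => (hda w hw).deriv) hz huj
  simpa using this

/-- The obstruction to `F_a / F_b` being locally constant in the direction of the `j`-th coordinate
on `Z(F)`, parametrised by the first three coordinates. -/
def ratioObstruction (F : MvPolynomial (Fin 4) ℂ) (a b j : Fin 4) : MvPolynomial (Fin 4) ℂ :=
  pderiv 3 F * (pderiv b F * pderiv j (pderiv a F) - pderiv a F * pderiv j (pderiv b F)) -
    pderiv j F * (pderiv b F * pderiv 3 (pderiv a F) - pderiv a F * pderiv 3 (pderiv b F))

lemma IsZeroProjection.ratio_differentiableAt {n : ℕ} {F : MvPolynomial (Fin n) ℂ} {i j : Fin n}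
    {v u : Fin n → ℂ} {ε : ℝ} {π : (Fin n → ℂ) → Fin n → ℂ} (h : IsZeroProjection F i v ε π)
    (hu : u ∈ Metric.ball v ε) (hij : j ≠ i) (a b : Fin n) :
    DifferentiableAt ℂ (fun z => eval (π (Function.update u j z)) (pderiv a F) /
      eval (π (Function.update u j z)) (pderiv b F)) (u j) :=
  (h.hasDerivAt hu hij _).differentiableAt.div (h.hasDerivAt hu hij _).differentiableAt
    (by rw [Function.update_eq_self]; exact h.deriv u hu b)

lemma IsZeroProjection.ratio_eq {F : MvPolynomial (Fin 4) ℂ} {j : Fin 4}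
    {v u : Fin 4 → ℂ} {ε : ℝ} {π : (Fin 4 → ℂ) → Fin 4 → ℂ} (h : IsZeroProjection F 3 v ε π)
    (hj : j ≠ 3) {a b : Fin 4} (hW : F ∣ ratioObstruction F a b j) (hu : u ∈ Metric.ball v ε)
    {z : ℂ} (hz : z ∈ Metric.ball (v j) ε) :
    eval (π (Function.update u j z)) (pderiv a F) / eval (π (Function.update u j z)) (pderiv b F) =
      eval (π u) (pderiv a F) / eval (π u) (pderiv b F) := by
  refine eq_of_forall_hasDerivAt_zero (h := fun u => eval (π u) (pderiv a F) /
    eval (π u) (pderiv b F)) h.pos (fun w hw => ?_) hu hz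
  have hb := h.deriv w hw b
  have h3 := h.deriv w hw 3
  have hdiv := (h.hasDerivAt hw hj (pderiv a F)).fun_div (h.hasDerivAt hw hj (pderiv b F))
    (by rw [Function.update_eq_self]; exact hb)
  rw [Function.update_eq_self] at hdiv
  obtain ⟨k, hk⟩ := hW
  have hW0 : eval (π w) (ratioObstruction F a b j) = 0 := by
    rw [hk, map_mul, h.zero w hw, zero_mul]
  simp only [ratioObstruction, map_sub, map_mul] at hW0
  convert! hdiv using 1
  field_simp
  linear_combination -hW0

/-- Under the vanishing of the obstructions the gradient of `F` on `Z(F)` is locally proportional to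
a vector whose first three entries each depend on one coordinate. -/
lemma exists_separated_gradient {F : MvPolynomial (Fin 4) ℂ} {v : Fin 4 → ℂ} (h0 : eval v F = 0)
    (hd : ∀ k, eval v (pderiv k F) ≠ 0) (h01 : F ∣ ratioObstruction F 0 1 2)
    (h02 : F ∣ ratioObstruction F 0 2 1) (h12 : F ∣ ratioObstruction F 1 2 0) :
    ∃ (ε : ℝ) (a b c : ℂ → ℂ), 0 < ε ∧ DifferentiableOn ℂ a (Metric.ball (v 0) ε) ∧
      DifferentiableOn ℂ b (Metric.ball (v 1) ε) ∧ DifferentiableOn ℂ c (Metric.ball (v 2) ε) ∧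
      a (v 0) ≠ 0 ∧ b (v 1) ≠ 0 ∧ c (v 2) ≠ 0 ∧
      ∀ u ∈ Metric.ball v ε, eval u F = 0 →
        eval u (pderiv 0 F) * b (u 1) = a (u 0) * eval u (pderiv 1 F) ∧
        eval u (pderiv 0 F) * c (u 2) = a (u 0) * eval u (pderiv 2 F) := by
  obtain ⟨ε, π, h, -⟩ := exists_isZeroProjection 3 h0 hd Filter.univ_mem
  have hε := h.pos
  have hmem : ∀ x y s, x ∈ Metric.ball (v 0) ε → y ∈ Metric.ball (v 1) ε →
      s ∈ Metric.ball (v 2) ε → ![x, y, s, v 3] ∈ Metric.ball v ε := by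
    intro x y s hx hy hs
    rw [Metric.mem_ball, dist_pi_lt_iff hε]
    intro k
    fin_cases k
    exacts [hx, hy, hs, by simpa using hε]
  obtain ⟨S, hS⟩ : ∃ S : Fin 4 → Fin 4 → ℂ → ℂ → ℂ → ℂ, ∀ a b x y s, S a b x y s =
      eval (π ![x, y, s, v 3]) (pderiv a F) / eval (π ![x, y, s, v 3]) (pderiv b F) :=
    ⟨_, fun _ _ _ _ _ => rfl⟩
  have e0 : ∀ x y s t z : ℂ, Function.update ![x, y, s, t] 0 z = ![z, y, s, t] := fun x y s t z => by
    ext k; fin_cases k <;> rfl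
  have e1 : ∀ x y s t z : ℂ, Function.update ![x, y, s, t] 1 z = ![x, z, s, t] := fun x y s t z => by
    ext k; fin_cases k <;> rfl
  have e2 : ∀ x y s t z : ℂ, Function.update ![x, y, s, t] 2 z = ![x, y, z, t] := fun x y s t z => by
    ext k; fin_cases k <;> rfl
  have m0 : v 0 ∈ Metric.ball (v 0) ε := Metric.mem_ball_self hε
  have m1 : v 1 ∈ Metric.ball (v 1) ε := Metric.mem_ball_self hε
  have m2 : v 2 ∈ Metric.ball (v 2) ε := Metric.mem_ball_self hε
  have c01 : ∀ x y s, x ∈ Metric.ball (v 0) ε → y ∈ Metric.ball (v 1) ε →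
      s ∈ Metric.ball (v 2) ε → S 0 1 x y s = S 0 1 x y (v 2) := by
    intro x y s hx hy hs
    have := h.ratio_eq (by decide) h01 (hmem x y s hx hy hs) m2
    rw [e2] at this
    rw [hS, hS, this]
  have c02 : ∀ x y s, x ∈ Metric.ball (v 0) ε → y ∈ Metric.ball (v 1) ε →
      s ∈ Metric.ball (v 2) ε → S 0 2 x y s = S 0 2 x (v 1) s := by
    intro x y s hx hy hs
    have := h.ratio_eq (by decide) h02 (hmem x y s hx hy hs) m1
    rw [e1] at this
    rw [hS, hS, this]
  have c12 : ∀ x y s, x ∈ Metric.ball (v 0) ε → y ∈ Metric.ball (v 1) ε →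
      s ∈ Metric.ball (v 2) ε → S 1 2 x y s = S 1 2 (v 0) y s := by
    intro x y s hx hy hs
    have := h.ratio_eq (by decide) h12 (hmem x y s hx hy hs) m0
    rw [e0] at this
    rw [hS, hS, this]
  have hne : ∀ a b x y s, x ∈ Metric.ball (v 0) ε → y ∈ Metric.ball (v 1) ε →
      s ∈ Metric.ball (v 2) ε → S a b x y s ≠ 0 := by
    intro a b x y s hx hy hs
    rw [hS]
    exact div_ne_zero (h.deriv _ (hmem x y s hx hy hs) a) (h.deriv _ (hmem x y s hx hy hs) b)
  have hmul : ∀ x y s, x ∈ Metric.ball (v 0) ε → y ∈ Metric.ball (v 1) ε →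
      s ∈ Metric.ball (v 2) ε → S 0 2 x y s = S 0 1 x y s * S 1 2 x y s := by
    intro x y s hx hy hs
    have := h.deriv _ (hmem x y s hx hy hs) 1
    have := h.deriv _ (hmem x y s hx hy hs) 2
    rw [hS, hS, hS]
    field_simp
  have d0 : ∀ a b, DifferentiableOn ℂ (fun x => S a b x (v 1) (v 2)) (Metric.ball (v 0) ε) := by
    intro a b x hx
    have := h.ratio_differentiableAt (hmem x _ _ hx m1 m2) (j := 0) (by decide) a b
    simp only [e0] at this
    simp only [hS]
    exact this.differentiableWithinAt
  have d1 : ∀ a b, DifferentiableOn ℂ (fun y => S a b (v 0) y (v 2)) (Metric.ball (v 1) ε) := by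
    intro a b y hy
    have := h.ratio_differentiableAt (hmem _ y _ m0 hy m2) (j := 1) (by decide) a b
    simp only [e1] at this
    simp only [hS]
    exact this.differentiableWithinAt
  have d2 : ∀ a b, DifferentiableOn ℂ (fun s => S a b (v 0) (v 1) s) (Metric.ball (v 2) ε) := by
    intro a b s hs
    have := h.ratio_differentiableAt (hmem _ _ s m0 m1 hs) (j := 2) (by decide) a b
    simp only [e2] at this
    simp only [hS]
    exact this.differentiableWithinAt
  refine ⟨ε, fun x => S 0 1 x (v 1) (v 2), fun y => S 1 2 (v 0) y (v 2) / S 1 2 (v 0) (v 1) (v 2),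
    fun s => (S 1 2 (v 0) (v 1) s)⁻¹, hε, d0 _ _, (d1 _ _).div_const _,
    (d2 _ _).fun_inv fun s hs => hne _ _ _ _ _ m0 m1 hs, hne _ _ _ _ _ m0 m1 m2,
    div_ne_zero (hne _ _ _ _ _ m0 m1 m2) (hne _ _ _ _ _ m0 m1 m2),
    inv_ne_zero (hne _ _ _ _ _ m0 m1 m2), fun u hu hz => ?_⟩
  have hx : u 0 ∈ Metric.ball (v 0) ε := (dist_pi_lt_iff hε).1 hu 0
  have hy : u 1 ∈ Metric.ball (v 1) ε := (dist_pi_lt_iff hε).1 hu 1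
  have hs : u 2 ∈ Metric.ball (v 2) ε := (dist_pi_lt_iff hε).1 hu 2
  have hu' : π ![u 0, u 1, u 2, v 3] = u := by
    have : ![u 0, u 1, u 2, v 3] = Function.update u 3 (v 3) := by
      ext k; fin_cases k <;> rfl
    rw [this, h.update, h.fix u hu hz]
  have hSu : ∀ a b, S a b (u 0) (u 1) (u 2) = eval u (pderiv a F) / eval u (pderiv b F) := by
    intro a b
    rw [hS, hu']
  have hder : ∀ k, eval u (pderiv k F) ≠ 0 := fun k => by
    have := h.deriv u hu k
    rwa [h.fix u hu hz] at this
  constructor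
  · have k1 := hSu 0 1
    rw [c01 _ _ _ hx hy hs] at k1
    have k2 := hmul _ _ _ hx hy m2
    rw [c02 _ _ _ hx hy m2, hmul _ _ _ hx m1 m2, c12 _ _ _ hx m1 m2, c12 _ _ _ hx hy m2, k1] at k2
    have n1 := hne 1 2 _ _ _ m0 m1 m2
    have := hder 1
    field_simp at k2 ⊢
    linear_combination -k2
  · have k1 := hSu 0 2
    rw [c02 _ _ _ hx hy hs, hmul _ _ _ hx m1 hs, c01 _ _ _ hx m1 hs, c12 _ _ _ hx m1 hs] at k1
    have n1 := hne 1 2 _ _ _ m0 m1 hs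
    have := hder 2
    field_simp at k1 ⊢
    linear_combination -k1

open Filter Topology in
lemma exists_analytic_left_inverse {φ : ℂ → ℂ} {a d : ℂ} (hφ : AnalyticAt ℂ φ a)
    (hd : HasDerivAt φ d a) (hd0 : d ≠ 0) :
    ∃ ψ : ℂ → ℂ, ∀ᶠ z in 𝓝 a, AnalyticAt ℂ φ z ∧ AnalyticAt ℂ ψ (φ z) ∧ ψ (φ z) = z := by
  have hE : HasFDerivAt φ
      ((ContinuousLinearEquiv.unitsEquivAut ℂ (Units.mk0 d hd0) : ℂ ≃L[ℂ] ℂ) : ℂ →L[ℂ] ℂ) a := by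
    convert! hd.hasFDerivAt using 1
  have hc : ContDiffAt ℂ ⊤ φ a := hφ.contDiffAt
  have hstrict := hc.hasStrictFDerivAt' hE (by simp)
  have hinv : ContDiffAt ℂ ⊤ (hstrict.localInverse φ _ a) (φ a) := hc.to_localInverse hE (by simp)
  refine ⟨hstrict.localInverse φ _ a, ?_⟩
  have hinv' : AnalyticAt ℂ (hstrict.localInverse φ _ a) (φ a) := hinv.analyticAt
  filter_upwards [hφ.eventually_analyticAt,
    hφ.continuousAt.eventually hinv'.eventually_analyticAt, hstrict.eventually_left_inverse]
    with z h1 h2 h3 using ⟨h1, h2, h3⟩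

open Filter Topology in
/-- The local sum form near a point where no partial derivative vanishes. -/
lemma exists_local_sum_form {F : MvPolynomial (Fin 4) ℂ} {v : Fin 4 → ℂ} (h0 : eval v F = 0)
    (hd : ∀ k, eval v (pderiv k F) ≠ 0) (h01 : F ∣ ratioObstruction F 0 1 2)
    (h02 : F ∣ ratioObstruction F 0 2 1) (h12 : F ∣ ratioObstruction F 1 2 0) :
    ∃ (D : Fin 4 → Set ℂ) (φ ψ : Fin 4 → ℂ → ℂ),
      (∀ i, IsOpen (D i) ∧ v i ∈ D i ∧ Set.InjOn (φ i) (D i) ∧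
        ∀ z ∈ D i, AnalyticAt ℂ (φ i) z ∧ AnalyticAt ℂ (ψ i) (φ i z) ∧ ψ i (φ i z) = z) ∧
      ∀ x y s t : ℂ, x ∈ D 0 → y ∈ D 1 → s ∈ D 2 → t ∈ D 3 →
        (eval ![x, y, s, t] F = 0 ↔ φ 0 x + φ 1 y + φ 2 s + φ 3 t = 0) := by
  obtain ⟨ε, a, b, c, hε, ha, hb, hc, ha0, hb0, hc0, hsep⟩ :=
    exists_separated_gradient h0 hd h01 h02 h12
  obtain ⟨f, hf⟩ := ha.isExactOn_ball
  obtain ⟨g, hg⟩ := hb.isExactOn_ball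
  obtain ⟨k, hk⟩ := hc.isExactOn_ball
  have han : ∀ {f a : ℂ → ℂ} {z₀ : ℂ}, (∀ z ∈ Metric.ball z₀ ε, HasDerivAt f (a z) z) →
      AnalyticAt ℂ f z₀ := fun h =>
    DifferentiableOn.analyticAt (fun z hz => (h z hz).differentiableAt.differentiableWithinAt)
      (Metric.ball_mem_nhds _ hε)
  have self_mem : ∀ i, v i ∈ Metric.ball (v i) ε := fun i => Metric.mem_ball_self hε
  obtain ⟨ψ₀, hψ₀⟩ := exists_analytic_left_inverse (han hf) (hf _ (self_mem 0)) ha0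
  obtain ⟨ψ₁, hψ₁⟩ := exists_analytic_left_inverse (han hg) (hg _ (self_mem 1)) hb0
  obtain ⟨ψ₂, hψ₂⟩ := exists_analytic_left_inverse (han hk) (hk _ (self_mem 2)) hc0
  have hU : Metric.ball v ε ∩ {u | ψ₀ (f (u 0)) = u 0} ∈ 𝓝 v := by
    refine inter_mem (Metric.ball_mem_nhds v hε) ?_
    have : Tendsto (fun u : Fin 4 → ℂ => u 0) (𝓝 v) (𝓝 (v 0)) := (continuous_apply 0).continuousAt
    filter_upwards [this.eventually hψ₀] with u hu using hu.2.2
  obtain ⟨η, π, h, hπU⟩ := exists_isZeroProjection 0 h0 hd hU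
  have hη := h.pos
  have hpos : ∀ j : Fin 4, j ≠ 0 → ∀ u ∈ Metric.ball v η, HasDerivAt
      (fun z => f (π (Function.update u j z) 0))
      (a (π u 0) * -(eval (π u) (pderiv j F) / eval (π u) (pderiv 0 F))) (u j) := by
    intro j hj u hu
    have h1 := h.hasDerivAt hu hj (X 0)
    simp only [eval_X, pderiv_X_self, pderiv_X_of_ne hj.symm, map_zero, map_one, zero_sub,
      mul_one] at h1
    have h2 : HasDerivAt f (a (π u 0)) (π (Function.update u j (u j)) 0) := by
      rw [Function.update_eq_self]
      exact hf _ ((dist_pi_lt_iff hε).1 (hπU u hu).1 0)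
    exact h2.comp (u j) h1
  have hη' : ∀ u ∈ Metric.ball v η, ∀ j, j ≠ 0 → u j ∈ Metric.ball (v j) ε := by
    intro u hu j hj
    rw [← h.coord u hu j hj]
    exact (dist_pi_lt_iff hε).1 (hπU u hu).1 j
  have c1 : ∀ u ∈ Metric.ball v η, f (π (Function.update u 1 (v 1)) 0) + g (v 1) =
      f (π u 0) + g (u 1) := by
    intro u hu
    have := eq_of_forall_hasDerivAt_zero (h := fun u => f (π u 0) + g (u 1)) (j := 1) hη
      (fun w hw => ?_) hu (Metric.mem_ball_self hη)
    · simpa using this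
    have h1 := (hpos 1 (by decide) w hw).add (hg (w 1) (hη' w hw 1 (by decide)))
    have h2 := (hsep (π w) (hπU w hw).1 (h.zero w hw)).1
    rw [h.coord w hw 1 (by decide)] at h2
    have h3 := h.deriv w hw 0
    simp only [Function.update_self]
    convert! h1 using 1
    field_simp
    linear_combination -h2
  have c2 : ∀ u ∈ Metric.ball v η, f (π (Function.update u 2 (v 2)) 0) + k (v 2) =
      f (π u 0) + k (u 2) := by
    intro u hu
    have := eq_of_forall_hasDerivAt_zero (h := fun u => f (π u 0) + k (u 2)) (j := 2) hη
      (fun w hw => ?_) hu (Metric.mem_ball_self hη)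
    · simpa using this
    have h1 := (hpos 2 (by decide) w hw).add (hk (w 2) (hη' w hw 2 (by decide)))
    have h2 := (hsep (π w) (hπU w hw).1 (h.zero w hw)).2
    rw [h.coord w hw 2 (by decide)] at h2
    have h3 := h.deriv w hw 0
    simp only [Function.update_self]
    convert! h1 using 1
    field_simp
    linear_combination -h2
  obtain ⟨l, hl⟩ : ∃ l : ℂ → ℂ, ∀ t, l t =
      -(f (π (Function.update v 3 t) 0) + g (v 1) + k (v 2)) := ⟨_, fun _ => rfl⟩
  have hvball : v ∈ Metric.ball v η := Metric.mem_ball_self hη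
  have hlder : ∀ u ∈ Metric.ball v η, u = Function.update v 3 (u 3) → HasDerivAt l
      (-(a (π u 0) * -(eval (π u) (pderiv 3 F) / eval (π u) (pderiv 0 F)))) (u 3) := by
    intro u hu huv
    have h1 := (((hpos 3 (by decide) u hu).add_const (g (v 1))).add_const (k (v 2))).neg
    have h2 : l = -fun z => f (π (Function.update u 3 z) 0) + g (v 1) + k (v 2) := by
      ext z
      rw [hl, huv]
      simp
    rw [h2]
    exact h1
  have hlan : AnalyticAt ℂ l (v 3) := by
    refine DifferentiableOn.analyticAt (s := Metric.ball (v 3) η) (fun t ht => ?_)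
      (Metric.ball_mem_nhds _ hη)
    have h1 := hlder (Function.update v 3 t) (update_mem_ball hη hvball ht) (by simp)
    rw [Function.update_self] at h1
    exact h1.differentiableAt.differentiableWithinAt
  obtain ⟨ψ₃, hψ₃⟩ := exists_analytic_left_inverse hlan (hlder v hvball (by simp)) (by
    rw [h.center, mul_neg, neg_neg]
    exact mul_ne_zero ha0 (div_ne_zero (hd 3) (hd 0)))
  have hcombine : ∀ᶠ r in 𝓝[>] (0 : ℝ), r ≤ η ∧ ∀ i : Fin 4, ∀ z ∈ Metric.ball (v i) r,
      AnalyticAt ℂ (![f, g, k, l] i) z ∧ AnalyticAt ℂ (![ψ₀, ψ₁, ψ₂, ψ₃] i) (![f, g, k, l] i z) ∧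
        ![ψ₀, ψ₁, ψ₂, ψ₃] i (![f, g, k, l] i z) = z := by
    have hball : ∀ (w : ℂ) (p : ℂ → Prop), (∀ᶠ z in 𝓝 w, p z) →
        ∀ᶠ r in 𝓝[>] (0 : ℝ), ∀ z ∈ Metric.ball w r, p z := by
      intro w p hp
      obtain ⟨ρ, hρ, hρp⟩ := Metric.eventually_nhds_iff_ball.1 hp
      filter_upwards [Ioc_mem_nhdsGT hρ] with r hr z hz
      exact hρp z (Metric.ball_subset_ball hr.2 hz)
    refine Filter.Eventually.and ?_ (eventually_all.2 fun i => hball _ _ ?_)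
    · filter_upwards [Ioc_mem_nhdsGT hη] with r hr using hr.2
    · fin_cases i
      exacts [hψ₀, hψ₁, hψ₂, hψ₃]
  obtain ⟨r, ⟨hrη, hr⟩, hr0⟩ := (hcombine.and self_mem_nhdsWithin).exists
  have hr0 : 0 < r := hr0
  refine ⟨fun i => Metric.ball (v i) r, ![f, g, k, l], ![ψ₀, ψ₁, ψ₂, ψ₃], fun i =>
    ⟨Metric.isOpen_ball, Metric.mem_ball_self hr0, fun z hz w hw hzw => ?_, hr i⟩, ?_⟩
  · rw [← (hr i z hz).2.2, ← (hr i w hw).2.2, hzw]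
  intro x y s t hx hy hs ht
  have hu : ![x, y, s, t] ∈ Metric.ball v η := by
    rw [Metric.mem_ball, dist_pi_lt_iff hη]
    intro i
    fin_cases i
    exacts [lt_of_lt_of_le hx hrη, lt_of_lt_of_le hy hrη, lt_of_lt_of_le hs hrη,
      lt_of_lt_of_le ht hrη]
  have hsum : f (π ![x, y, s, t] 0) + g y + k s + l t = 0 := by
    have h1 := c1 _ hu
    have h2 := c2 _ (update_mem_ball hη hu (j := 1) (Metric.mem_ball_self hη))
    have h3 : π (Function.update (Function.update ![x, y, s, t] 1 (v 1)) 2 (v 2)) =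
        π (Function.update v 3 t) := by
      rw [← h.update _ (v 0)]
      congr 1
      ext i
      fin_cases i <;> rfl
    rw [h3] at h2
    have e1 : ![x, y, s, t] 1 = y := rfl
    have e2 : Function.update ![x, y, s, t] 1 (v 1) 2 = s := rfl
    rw [e1] at h1
    rw [e2] at h2
    rw [hl]
    linear_combination -h1 - h2
  change eval ![x, y, s, t] F = 0 ↔ f x + g y + k s + l t = 0
  constructor
  · intro hz
    have h1 := h.fix _ hu hz
    rw [h1] at hsum
    exact hsum
  · intro hz
    have h1 : f (π ![x, y, s, t] 0) = f x := by linear_combination hsum - hz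
    have h2 : π ![x, y, s, t] 0 = x := by
      have e1 : ψ₀ (f (π ![x, y, s, t] 0)) = π ![x, y, s, t] 0 := (hπU _ hu).2
      rw [← e1, h1]
      exact (hr 0 x hx).2.2
    have h3 : π ![x, y, s, t] = ![x, y, s, t] := by
      ext i
      by_cases hi : i = 0
      · subst hi; exact h2
      · exact h.coord _ hu i hi
    rw [← h3]
    exact h.zero _ hu

lemma pderiv_pderiv_swap {σ R : Type*} [CommRing R] (i j : σ) (f : MvPolynomial σ R) :
    pderiv i (pderiv j f) = pderiv j (pderiv i f) := by
  have h : ⁅(pderiv i : Derivation R (MvPolynomial σ R) (MvPolynomial σ R)),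
      (pderiv j : Derivation R (MvPolynomial σ R) (MvPolynomial σ R))⁆ = 0 := by
    ext1 k
    simp [Derivation.commutator_apply, pderiv_X, Pi.single_apply, apply_ite]
  have := congrArg (fun D => D f) h
  simpa [Derivation.commutator_apply, sub_eq_zero] using this

/-- If all obstructions vanish on `Z(F)`, then `F` has the special sum form. -/
theorem specialSumForm_of_dvd {F : MvPolynomial (Fin 4) ℂ} (hF : Irreducible F)
    (hd : ∀ i, pderiv i F ≠ 0) (h01 : F ∣ ratioObstruction F 0 1 2)
    (h02 : F ∣ ratioObstruction F 0 2 1) : SpecialSumForm F := by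
  have h12 : F ∣ ratioObstruction F 1 2 0 := by
    have hc : ∀ i j : Fin 4, pderiv i (pderiv j F) = pderiv j (pderiv i F) := fun i j =>
      pderiv_pderiv_swap i j F
    have : ratioObstruction F 1 2 0 = ratioObstruction F 0 2 1 - ratioObstruction F 0 1 2 := by
      simp only [ratioObstruction]
      rw [hc 0 1, hc 0 2, hc 1 2, hc 3 0, hc 3 1, hc 3 2]
      ring
    rw [this]
    exact dvd_sub h02 h01
  set g := pderiv 0 F * pderiv 1 F * (pderiv 2 F * pderiv 3 F) with hg
  have hndvd : ¬ F ∣ g := by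
    rw [hg]
    simp only [hF.prime.dvd_mul, not_or]
    exact ⟨⟨not_dvd_pderiv hF (hd 0), not_dvd_pderiv hF (hd 1)⟩,
      not_dvd_pderiv hF (hd 2), not_dvd_pderiv hF (hd 3)⟩
  refine ⟨{v | eval v F = 0 ∧ eval v g = 0}, ⟨{F, g}, ?_⟩, fun v hv => hv.1,
    algDimLE_two_of_not_dvd hF hndvd, fun v hv hvZ => ?_⟩
  · ext v
    simp [zeroSetOf]
  · refine exists_local_sum_form hv (fun i hi => hvZ ⟨hv, ?_⟩) h01 h02 h12
    rw [hg]
    simp only [map_mul]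
    fin_cases i <;> simp at hi <;> simp [hi]

/-- The constant for `F` with a nonvanishing obstruction serves also for `F` with the roles of
the second and third variables exchanged. -/
lemma card_le_of_not_dvd_swap {δ : ℕ} {c : ℝ}
    (hc : ∀ F : MvPolynomial (Fin 4) ℂ, Irreducible F → F.totalDegree ≤ δ →
      (∀ i, pderiv i F ≠ 0) → ¬ F ∣ splitObstruction F →
      ∀ (A B C D : Finset ℂ) (T : Finset (ℂ × ℂ × ℂ × ℂ)), T ⊆ A ×ˢ B ×ˢ C ×ˢ D →
      (∀ q ∈ T, eval ![q.1, q.2.1, q.2.2.1, q.2.2.2] F = 0) →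
      (T.card : ℝ) ≤ c * gridBound A.card B.card C.card D.card)
    {F : MvPolynomial (Fin 4) ℂ} (hF : Irreducible F) (hδ : F.totalDegree ≤ δ)
    (hd : ∀ i, pderiv i F ≠ 0) (hW : ¬ F ∣ ratioObstruction F 0 2 1)
    {A B C D : Finset ℂ} {T : Finset (ℂ × ℂ × ℂ × ℂ)} (hT : T ⊆ A ×ˢ B ×ˢ C ×ˢ D)
    (h0 : ∀ q ∈ T, eval ![q.1, q.2.1, q.2.2.1, q.2.2.2] F = 0) :
    (T.card : ℝ) ≤ c * gridBound A.card B.card C.card D.card := by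
  let e : Fin 4 ≃ Fin 4 := Equiv.swap 1 2
  let R := renameEquiv ℂ e
  have he : Function.Injective e := e.injective
  have hpd : ∀ i (G : MvPolynomial (Fin 4) ℂ), pderiv (e i) (R G) = R (pderiv i G) := fun i G =>
    pderiv_rename he i G
  have hobs : splitObstruction (R F) = R (ratioObstruction F 0 2 1) := by
    have e0 : e 0 = 0 := by decide
    have e1 : e 1 = 2 := by decide
    have e2 : e 2 = 1 := by decide
    have e3 : e 3 = 3 := by decide
    have p0 := hpd 0
    have p1 := hpd 1
    have p2 := hpd 2
    have p3 := hpd 3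
    rw [e0] at p0
    rw [e1] at p1
    rw [e2] at p2
    rw [e3] at p3
    simp only [splitObstruction, ratioObstruction, p0, p1, p2, p3, map_sub, map_mul]
  let m : (ℂ × ℂ × ℂ × ℂ) ↪ (ℂ × ℂ × ℂ × ℂ) :=
    ⟨fun q => (q.1, q.2.2.1, q.2.1, q.2.2.2), fun p q h => by
      simp only [Prod.mk.injEq] at h
      exact Prod.ext h.1 (Prod.ext h.2.2.1 (Prod.ext h.2.1 h.2.2.2))⟩
  have key := hc (R F) ((MulEquiv.irreducible_iff R).2 hF)
    ((totalDegree_renameEquiv e F).trans_le hδ)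
    (fun i => by
      rw [← e.apply_symm_apply i, hpd]
      exact (map_ne_zero_iff R R.injective).2 (hd _))
    (by rwa [hobs, map_dvd_iff R]) A C B D (T.map m)
    (fun p hp => by
      obtain ⟨q, hq, rfl⟩ := Finset.mem_map.1 hp
      have := hT hq
      simp only [Finset.mem_product] at this
      simp only [m, Finset.mem_product]
      exact ⟨this.1, this.2.2.1, this.2.1, this.2.2.2⟩)
    (fun p hp => by
      obtain ⟨q, hq, rfl⟩ := Finset.mem_map.1 hp
      rw [← h0 q hq]
      change eval _ (rename e F) = _
      rw [eval_rename]
      congr 2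
      funext i
      fin_cases i <;> rfl)
  rw [Finset.card_map] at key
  refine key.trans_eq ?_
  simp only [gridBound]
  ring

/-- **The Elekes–Szabó Theorem in four dimensions.**
Let `F ∈ ℂ[x,y,s,t]` be irreducible of total degree `δ`, with none of the four partial
derivatives identically zero. Then either, with a constant `c` depending only on `δ`, for all
finite `A,B,C,D ⊂ ℂ` one has
`|Z(F) ∩ (A×B×C×D)| ≤ c(|A|^{2/3}|B|^{2/3}|C|^{2/3}|D|^{2/3} + Σ pairwise products)`,
or `F` has the special sum form. -/
theorem elekes_szabo_four_dim (δ : ℕ) :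
    ∃ c : ℝ, 0 < c ∧ ∀ F : MvPolynomial (Fin 4) ℂ,
      Irreducible F → F.totalDegree = δ → (∀ i : Fin 4, pderiv i F ≠ 0) →
      (∀ A B C D : Finset ℂ,
        ((((A ×ˢ B ×ˢ C ×ˢ D).filter fun q : ℂ × ℂ × ℂ × ℂ =>
            eval ![q.1, q.2.1, q.2.2.1, q.2.2.2] F = 0).card : ℝ) ≤
          c * ((A.card : ℝ) ^ ((2:ℝ)/3) * (B.card : ℝ) ^ ((2:ℝ)/3) *
                (C.card : ℝ) ^ ((2:ℝ)/3) * (D.card : ℝ) ^ ((2:ℝ)/3)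
              + (A.card : ℝ) * B.card + (A.card : ℝ) * C.card + (A.card : ℝ) * D.card
              + (B.card : ℝ) * C.card + (B.card : ℝ) * D.card + (C.card : ℝ) * D.card)))
      ∨ SpecialSumForm F := by
  obtain ⟨c, hc0, hc⟩ := exists_bound_of_not_dvd δ
  refine ⟨c, hc0, fun F hF hδ hd => ?_⟩
  by_cases h1 : F ∣ splitObstruction F
  · by_cases h2 : F ∣ ratioObstruction F 0 2 1
    · exact Or.inr (specialSumForm_of_dvd hF hd h1 h2)
    · exact Or.inl fun A B C D => card_le_of_not_dvd_swap hc hF hδ.le hd h2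
        (Finset.filter_subset _ _) fun q hq => (Finset.mem_filter.1 hq).2
  · exact Or.inl fun A B C D => hc F hF hδ.le hd h1 A B C D _
      (Finset.filter_subset _ _) fun q hq => (Finset.mem_filter.1 hq).2
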